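/- arXiv:2006.14542 — 5 statements merged into one kernel-verified Lean document; each statement's English description precedes it below -/
import Mathlib

section
/- Let n ≥ 1 and let p : ℝ^(2n) → ℝ be a smooth (C^∞) function whose gradient ∇p is nonzero at some point. Then there exist an open set U ⊆ ℝ^(2n) and a smooth map f : U → ℝ^(2n) that is a diffeomorphism onto its image, such that f is a symplectomorphism for the standard symplectic structure (i.e. Df(z)ᵀ · J · Df(z) = J for all z ∈ U, where J is the standard 2n×2n symplectic matrix) and p(f(z)) = z₁ (the first coordinate of z) for all z ∈ U. -/
open Set Matrix

/-- The standard symplectic matrix `J` on `ℝ^(2n)`, with coordinates indexed by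
`Fin n ⊕ Fin n` (the `x`-coordinates first, then the `y`-coordinates). -/
noncomputable def stdSymplMatrix (n : ℕ) : Matrix (Fin n ⊕ Fin n) (Fin n ⊕ Fin n) ℝ :=
  Matrix.fromBlocks 0 1 (-1) 0

/-- The Jacobian matrix of a map of `ℝ^(2n)` at a point. -/
noncomputable def jacMatrix {n : ℕ} (f : (Fin n ⊕ Fin n → ℝ) → (Fin n ⊕ Fin n → ℝ))
    (z : Fin n ⊕ Fin n → ℝ) : Matrix (Fin n ⊕ Fin n) (Fin n ⊕ Fin n) ℝ :=
  LinearMap.toMatrix' (fderiv ℝ f z).toLinearMap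

open scoped ContDiff unitInterval Topology

section InverseFunction

variable {E F : Type*} [NormedAddCommGroup E] [NormedSpace ℝ E] [CompleteSpace E]
  [NormedAddCommGroup F] [NormedSpace ℝ F]

/-- The inverse function theorem for a map that is smooth on an open set: a local inverse that
is smooth on its whole domain. -/
theorem exists_openPartialHomeomorph_contDiffOn_symm {f : E → F} {s : Set E} {a : E}
    (hs : IsOpen s) (ha : a ∈ s) (hf : ContDiffOn ℝ ∞ f s)
    (f' : E ≃L[ℝ] F) (hf' : fderiv ℝ f a = f') :
    ∃ e : OpenPartialHomeomorph E F, a ∈ e.source ∧ e.source ⊆ s ∧ (∀ x, e x = f x) ∧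
      ContDiffOn ℝ ∞ e.symm e.target := by
  have hfa : ContDiffAt ℝ ∞ f a := hf.contDiffAt (hs.mem_nhds ha)
  have hd : HasFDerivAt f (f' : E →L[ℝ] F) a := by
    rw [← hf']; exact (hfa.differentiableAt (by simp)).hasFDerivAt
  set t : Set E := s ∩ fderiv ℝ f ⁻¹' range ContinuousLinearEquiv.toContinuousLinearMap with ht_def
  have ht : IsOpen t :=
    (hf.continuousOn_fderiv_of_isOpen hs (by simp)).isOpen_inter_preimage hs
      ContinuousLinearEquiv.isOpen
  set e₀ := hfa.toOpenPartialHomeomorph f hd (by simp) with he₀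
  have hsource : (e₀.restrOpen t ht).source = e₀.source ∩ t := rfl
  refine ⟨e₀.restrOpen t ht, ?_, ?_, fun x => rfl, ?_⟩
  · rw [hsource]
    exact ⟨hfa.mem_toOpenPartialHomeomorph_source hd (by simp), ha, f', hf'.symm⟩
  · rw [hsource]
    exact fun x hx => hx.2.1
  · intro y hy
    set e := e₀.restrOpen t ht
    have hx : e.symm y ∈ e.source := e.map_target hy
    rw [hsource] at hx
    obtain ⟨-, hxs, g', hg'⟩ := hx
    have hc : ContDiffAt ℝ ∞ f (e.symm y) := hf.contDiffAt (hs.mem_nhds hxs)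
    refine (e.contDiffAt_symm (f₀' := g') hy ?_ hc).contDiffWithinAt
    rw [hg']
    exact (hc.differentiableAt (by simp)).hasFDerivAt

end InverseFunction

section Superposition

universe u

variable {K : Type*} [TopologicalSpace K] [CompactSpace K]
  {E F : Type u} [NormedAddCommGroup E] [NormedSpace ℝ E] [NormedAddCommGroup F] [NormedSpace ℝ F]

namespace ContinuousMap

/-- Pointwise application of a continuous family of continuous linear maps, as a continuous
bilinear map. -/
noncomputable def pointwiseApplyL : C(K, E →L[ℝ] F) →L[ℝ] C(K, E) →L[ℝ] C(K, F) :=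
  LinearMap.mkContinuous₂
    (LinearMap.mk₂ ℝ (fun (A : C(K, E →L[ℝ] F)) (w : C(K, E)) =>
        (⟨fun t => A t (w t), by fun_prop⟩ : C(K, F)))
      (by intros; ext; simp) (by intros; ext; simp) (by intros; ext; simp)
      (by intros; ext; simp)) 1 (by
    intro A w
    rw [ContinuousMap.norm_le _ (by positivity)]
    intro t
    simp only [LinearMap.mk₂_apply, ContinuousMap.coe_mk, one_mul]
    exact (A t).le_of_opNorm_le_of_le (A.norm_coe_le_norm t) (w.norm_coe_le_norm t))

@[simp]
theorem pointwiseApplyL_apply (A : C(K, E →L[ℝ] F)) (w : C(K, E)) (t : K) :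
    pointwiseApplyL A w t = A t (w t) := rfl

theorem hasFDerivAt_comp_left {f : E → F} (hf : ContDiff ℝ 1 f) (u : C(K, E)) :
    HasFDerivAt (fun u : C(K, E) => (⟨f, hf.continuous⟩ : C(E, F)).comp u)
      (pointwiseApplyL ((⟨fderiv ℝ f, hf.continuous_fderiv (by simp)⟩ : C(E, E →L[ℝ] F)).comp u))
      u := by
  rw [hasFDerivAt_iff_isLittleO, Asymptotics.isLittleO_iff]
  intro c hc
  have hK : IsCompact (range u) := isCompact_range u.continuous
  have hunif := hK.uniformContinuousAt_of_continuousAt (fderiv ℝ f)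
    (fun a _ => (hf.continuous_fderiv (by simp)).continuousAt) (Metric.dist_mem_uniformity hc)
  obtain ⟨δ, hδ, hball⟩ := Metric.mem_uniformity_dist.1 hunif
  filter_upwards [Metric.ball_mem_nhds u hδ] with v hv
  rw [ContinuousMap.norm_le _ (by positivity)]
  intro t
  have hvt : v t ∈ Metric.ball (u t) δ := by
    rw [Metric.mem_ball] at hv ⊢
    exact (ContinuousMap.dist_apply_le_dist t).trans_lt hv
  have key := (convex_ball (u t) δ).norm_image_sub_le_of_norm_fderiv_le' (𝕜 := ℝ) (f := f)
    (φ := fderiv ℝ f (u t)) (C := c)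
    (fun x _ => hf.differentiable (by simp) x) (fun x hx => ?_)
    (Metric.mem_ball_self hδ) hvt
  · calc _ ≤ c * ‖v t - u t‖ := key
      _ ≤ c * ‖v - u‖ := by gcongr; exact (v - u).norm_coe_le_norm t
  · have := hball (a := u t) (b := x) (by rw [dist_comm]; exact hx) (mem_range_self t)
    rw [← dist_eq_norm, dist_comm]
    exact le_of_lt this

theorem contDiff_nat_comp_left (n : ℕ) {f : E → F} (hf : ContDiff ℝ ∞ f) :
    ContDiff ℝ n (fun u : C(K, E) => (⟨f, hf.continuous⟩ : C(E, F)).comp u) := by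
  induction n generalizing F with
  | zero => exact contDiff_zero.2 (ContinuousMap.continuous_postcomp _)
  | succ n ih =>
    have hf1 : ContDiff ℝ 1 f := hf.of_le (by simp)
    have hf' : ContDiff ℝ ∞ (fderiv ℝ f) := hf.fderiv_right (by simp)
    push_cast
    rw [contDiff_succ_iff_fderiv]
    refine ⟨fun u => (hasFDerivAt_comp_left hf1 u).differentiableAt, by simp, ?_⟩
    have heq : fderiv ℝ (fun u : C(K, E) => (⟨f, hf.continuous⟩ : C(E, F)).comp u) =
        fun u => pointwiseApplyL ((⟨fderiv ℝ f, hf'.continuous⟩ : C(E, E →L[ℝ] F)).comp u) :=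
      funext fun u => (hasFDerivAt_comp_left hf1 u).fderiv
    rw [heq]
    exact pointwiseApplyL.contDiff.comp (ih hf')

/-- Composition with a smooth map is a smooth operation on continuous maps from a compact
space. -/
theorem contDiff_comp_left {f : E → F} (hf : ContDiff ℝ ∞ f) :
    ContDiff ℝ ∞ (fun u : C(K, E) => (⟨f, hf.continuous⟩ : C(E, F)).comp u) :=
  contDiff_infty.2 fun n => contDiff_nat_comp_left n hf

end ContinuousMap

end Superposition

section Flow

universe u

variable {E : Type u} [NormedAddCommGroup E] [NormedSpace ℝ E]

namespace ContinuousMap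

/-- The primitive vanishing at `0` of a continuous map on the unit interval, as a continuous
linear map. -/
noncomputable def primitiveL [CompleteSpace E] : C(I, E) →L[ℝ] C(I, E) :=
  LinearMap.mkContinuous
    { toFun := fun u =>
        ⟨fun τ => ∫ t in (0 : ℝ)..τ, u (projIcc 0 1 zero_le_one t), by
          have hc : Continuous fun t => u (projIcc (0 : ℝ) 1 zero_le_one t) :=
            u.continuous.comp continuous_projIcc
          exact (intervalIntegral.continuous_primitive
            (fun a b => hc.intervalIntegrable a b) 0).comp continuous_subtype_val⟩
      map_add' := fun u v => by
        ext τ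
        have hc : ∀ u : C(I, E), Continuous fun t => u (projIcc (0 : ℝ) 1 zero_le_one t) :=
          fun u => u.continuous.comp continuous_projIcc
        exact intervalIntegral.integral_add ((hc u).intervalIntegrable _ _)
          ((hc v).intervalIntegrable _ _)
      map_smul' := fun c u => by
        ext τ
        exact intervalIntegral.integral_smul c _ }
    1 (by
      intro u
      rw [ContinuousMap.norm_le _ (by positivity)]
      intro τ
      refine (intervalIntegral.norm_integral_le_of_norm_le_const
        (fun t _ => u.norm_coe_le_norm _)).trans ?_
      rw [one_mul, sub_zero, abs_of_nonneg τ.2.1]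
      exact mul_le_of_le_one_right (norm_nonneg _) τ.2.2)

theorem primitiveL_apply [CompleteSpace E] (u : C(I, E)) (τ : I) :
    primitiveL u τ = ∫ t in (0 : ℝ)..τ, u (projIcc 0 1 zero_le_one t) := rfl

theorem hasDerivWithinAt_of_eq_const_add_primitiveL [CompleteSpace E] {u g : C(I, E)} {x : E}
    (h : u = ContinuousMap.const I x + primitiveL g) {τ : ℝ} (hτ : τ ∈ Icc (0 : ℝ) 1) :
    HasDerivWithinAt (fun t => u (projIcc 0 1 zero_le_one t)) (g (projIcc 0 1 zero_le_one τ))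
      (Icc 0 1) τ := by
  have hc : Continuous fun t => g (projIcc (0 : ℝ) 1 zero_le_one t) :=
    g.continuous.comp continuous_projIcc
  have hd : HasDerivAt (fun τ : ℝ => x + ∫ t in (0 : ℝ)..τ, g (projIcc 0 1 zero_le_one t))
      (g (projIcc 0 1 zero_le_one τ)) τ :=
    ((hc.integral_hasStrictDerivAt 0 τ).hasDerivAt).const_add x
  have heq : ∀ t ∈ Icc (0 : ℝ) 1, u (projIcc 0 1 zero_le_one t) =
      x + ∫ t in (0 : ℝ)..t, g (projIcc 0 1 zero_le_one t) := by
    intro t ht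
    rw [h, ContinuousMap.add_apply, ContinuousMap.const_apply, primitiveL_apply, projIcc_of_mem _ ht]
  exact hd.hasDerivWithinAt.congr heq (heq τ hτ)

end ContinuousMap

open ContinuousMap

/-- Smooth dependence of the solutions of an autonomous ordinary differential equation on the
initial value and on a time-scaling parameter `q.1`. -/
theorem exists_contDiffOn_integralCurve [CompleteSpace E] {X : E → E} (hX : ContDiff ℝ ∞ X)
    (x₀ : E) :
    ∃ V : Set (ℝ × E), IsOpen V ∧ (0, x₀) ∈ V ∧ ∃ Φ : ℝ × E → C(I, E),
      ContDiffOn ℝ ∞ Φ V ∧ Φ (0, x₀) = ContinuousMap.const I x₀ ∧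
      ∀ q ∈ V, Φ q = ContinuousMap.const I q.2 +
        primitiveL (q.1 • (⟨X, hX.continuous⟩ : C(E, E)).comp (Φ q)) := by
  set N : C(I, E) → C(I, E) := fun u => (⟨X, hX.continuous⟩ : C(E, E)).comp u with hN
  have hNs : ContDiff ℝ ∞ N := contDiff_comp_left hX
  let cst : E →L[ℝ] C(I, E) := ContinuousLinearMap.const ℝ I
  set u₀ : C(I, E) := cst x₀ with hu₀
  let Ψ : (ℝ × E) × C(I, E) → (ℝ × E) × C(I, E) :=
    fun z => (z.1, z.2 - cst z.1.2 - z.1.1 • primitiveL (N z.2))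
  have hΨ : ContDiff ℝ ∞ Ψ := by
    have h1 : ContDiff ℝ ∞ fun z : (ℝ × E) × C(I, E) => primitiveL (N z.2) :=
      primitiveL.contDiff.comp (hNs.comp contDiff_snd)
    have h2 : ContDiff ℝ ∞ fun z : (ℝ × E) × C(I, E) => cst z.1.2 :=
      cst.contDiff.comp (contDiff_snd.comp contDiff_fst)
    exact contDiff_fst.prodMk ((contDiff_snd.sub h2).sub
      ((contDiff_fst.comp contDiff_fst).smul h1))
  let T : ℝ × E →L[ℝ] C(I, E) :=
    -(cst.comp (ContinuousLinearMap.snd ℝ ℝ E)) -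
      (ContinuousLinearMap.fst ℝ ℝ E).smulRight (primitiveL (N u₀))
  let L : ((ℝ × E) × C(I, E)) ≃L[ℝ] ((ℝ × E) × C(I, E)) :=
    (ContinuousLinearEquiv.refl ℝ (ℝ × E)).skewProd (ContinuousLinearEquiv.refl ℝ C(I, E)) T
  have hL : fderiv ℝ Ψ ((0, x₀), u₀) = L := by
    have h1 : HasFDerivAt (fun z : (ℝ × E) × C(I, E) => primitiveL (N z.2))
        ((primitiveL.comp (fderiv ℝ N u₀)).comp (ContinuousLinearMap.snd ℝ (ℝ × E) C(I, E)))
        ((0, x₀), u₀) :=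
      HasFDerivAt.comp (g := fun u => primitiveL (N u)) ((0, x₀), u₀)
        ((primitiveL (E := E)).hasFDerivAt.comp u₀ (hNs.differentiable (by simp) u₀).hasFDerivAt)
        hasFDerivAt_snd
    have h2 : HasFDerivAt (fun z : (ℝ × E) × C(I, E) => cst z.1.2) _ ((0, x₀), u₀) :=
      ((cst.comp (ContinuousLinearMap.snd ℝ ℝ E)).comp
        (ContinuousLinearMap.fst ℝ (ℝ × E) C(I, E))).hasFDerivAt
    have h3 : HasFDerivAt (fun z : (ℝ × E) × C(I, E) => z.1.1) _ ((0, x₀), u₀) :=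
      ((ContinuousLinearMap.fst ℝ ℝ E).comp
        (ContinuousLinearMap.fst ℝ (ℝ × E) C(I, E))).hasFDerivAt
    have h4 := (hasFDerivAt_fst (𝕜 := ℝ) (p := (((0 : ℝ), x₀), u₀))).prodMk
      ((hasFDerivAt_snd.sub h2).sub (h3.smul h1))
    refine (HasFDerivAt.fderiv h4).trans ?_
    ext z <;> simp [L, T, cst]
  obtain ⟨e, hae, -, heΨ, hes⟩ := exists_openPartialHomeomorph_contDiffOn_symm
    isOpen_univ (mem_univ _) hΨ.contDiffOn L hL
  have hi : ContDiff ℝ ∞ fun q : ℝ × E => (q, (0 : C(I, E))) := contDiff_id.prodMk contDiff_const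
  have h0 : e ((0, x₀), u₀) = ((0, x₀), 0) := by
    rw [heΨ]; simp [Ψ, hu₀]
  refine ⟨(fun q : ℝ × E => (q, (0 : C(I, E)))) ⁻¹' e.target,
    e.open_target.preimage hi.continuous, ?_, fun q => (e.symm (q, 0)).2, ?_, ?_, ?_⟩
  · rw [mem_preimage, ← h0]
    exact e.map_source hae
  · exact contDiff_snd.comp_contDiffOn (hes.comp hi.contDiffOn fun q hq => hq)
  · show (e.symm ((0, x₀), 0)).2 = _
    rw [← h0, e.left_inv hae]
    rfl
  · intro q hq
    have h := e.right_inv hq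
    rw [heΨ] at h
    have h1 : (e.symm (q, 0)).1 = q := congrArg Prod.fst h
    have h2 := congrArg Prod.snd h
    simp only [Ψ, h1] at h2
    rw [map_smul]
    rw [sub_eq_zero, sub_eq_iff_eq_add'] at h2
    exact h2

end Flow

section Hamiltonian

universe u

variable {E : Type u} [NormedAddCommGroup E] [NormedSpace ℝ E]

theorem eq_of_hasDerivWithinAt_zero {f : ℝ → ℝ}
    (h : ∀ τ ∈ Icc (0 : ℝ) 1, HasDerivWithinAt f 0 (Icc 0 1) τ) :
    ∀ τ ∈ Icc (0 : ℝ) 1, f τ = f 0 :=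
  constant_of_derivWithin_zero (fun τ hτ => (h τ hτ).differentiableWithinAt) fun τ hτ =>
    (h τ (Ico_subset_Icc_self hτ)).derivWithin
      (uniqueDiffOn_Icc zero_lt_one τ (Ico_subset_Icc_self hτ))

open ContinuousMap

/-- The local Hamiltonian flow `φ (s, x)` of `p` with respect to an alternating bilinear form `B`:
it is smooth, preserves `p`, and pulls `B` back to `B + ds ∧ dp`. -/
theorem exists_hamiltonian_flow [CompleteSpace E] (B : E →L[ℝ] E →L[ℝ] ℝ)
    (hB : ∀ v w, B v w = -B w v) {p : E → ℝ} (hp : ContDiff ℝ ∞ p)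
    {X : E → E} (hX : ContDiff ℝ ∞ X) (hXp : ∀ x v, B (X x) v = fderiv ℝ p x v) (x₀ : E) :
    ∃ V : Set (ℝ × E), IsOpen V ∧ (0, x₀) ∈ V ∧ ∃ φ : ℝ × E → E,
      ContDiffOn ℝ ∞ φ V ∧ φ (0, x₀) = x₀ ∧ (∀ q ∈ V, p (φ q) = p q.2) ∧
      ∀ q ∈ V, ∀ a b : ℝ × E, B (fderiv ℝ φ q a) (fderiv ℝ φ q b) =
        B a.2 b.2 + a.1 * fderiv ℝ p q.2 b.2 - b.1 * fderiv ℝ p q.2 a.2 := by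
  obtain ⟨V, hVo, hV0, Φ, hΦ, hΦ0, hΦV⟩ := exists_contDiffOn_integralCurve hX x₀
  have hpd : Differentiable ℝ p := hp.differentiable (by simp)
  have hXd : Differentiable ℝ X := hX.differentiable (by simp)
  have hBX : ∀ x, B (X x) (X x) = 0 := fun x => by linarith [hB (X x) (X x)]
  have hBX' : ∀ v x, B v (X x) = -fderiv ℝ p x v := fun v x => by rw [hB, hXp]
  have hΦd : ∀ q ∈ V, HasFDerivAt Φ (fderiv ℝ Φ q) q := fun q hq =>
    ((hΦ.contDiffAt (hVo.mem_nhds hq)).differentiableAt (by simp)).hasFDerivAt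
  -- the linearised Hamiltonian vector field is infinitesimally symplectic
  have hinf : ∀ x v w, B (fderiv ℝ X x v) w + B v (fderiv ℝ X x w) = 0 := by
    intro x v w
    have hess : ∀ v w, B (fderiv ℝ X x v) w = fderiv ℝ (fderiv ℝ p) x v w := by
      intro v w
      have h1 : HasFDerivAt (fun y => B (X y)) (B.comp (fderiv ℝ X x)) x :=
        B.hasFDerivAt.comp x (hXd x).hasFDerivAt
      have h2 : (fun y => B (X y)) = fderiv ℝ p := by
        funext y; ext v; exact hXp y v
      rw [← h2, h1.fderiv]
      rfl
    have hsymm : IsSymmSndFDerivAt ℝ p x := hp.contDiffAt.isSymmSndFDerivAt (by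
      simpa using WithTop.coe_le_coe.2 (le_top : (2 : ℕ∞) ≤ ⊤))
    rw [hB v, hess, hess, hsymm.eq v w, add_neg_cancel]
  have hcurve : ∀ q ∈ V, ∀ τ ∈ Icc (0 : ℝ) 1,
      HasDerivWithinAt (fun t => Φ q (projIcc 0 1 zero_le_one t))
        (q.1 • X (Φ q (projIcc 0 1 zero_le_one τ))) (Icc 0 1) τ := fun q hq τ hτ =>
    hasDerivWithinAt_of_eq_const_add_primitiveL (hΦV q hq) hτ
  have hzero : ∀ q ∈ V, Φ q 0 = q.2 := by
    intro q hq
    rw [hΦV q hq, ContinuousMap.add_apply, primitiveL_apply]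
    simp
  have hpΦ : ∀ q ∈ V, ∀ τ : I, p (Φ q τ) = p q.2 := by
    intro q hq τ
    have h := eq_of_hasDerivWithinAt_zero
      (f := fun t => p (Φ q (projIcc 0 1 zero_le_one t))) (fun τ hτ => by
        have h := (hpd (Φ q (projIcc 0 1 zero_le_one τ))).hasFDerivAt.comp_hasDerivWithinAt τ
          (hcurve q hq τ hτ)
        rwa [map_smul, ← hXp, hBX, smul_zero] at h) τ τ.2
    simp only [projIcc_val, projIcc_left] at h
    rw [h]
    exact congrArg p (hzero q hq)
  have hev : ∀ q ∈ V, ∀ τ : I,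
      HasFDerivAt (fun q => Φ q τ) ((evalCLM ℝ τ).comp (fderiv ℝ Φ q)) q := fun q hq τ =>
    (evalCLM (M := E) ℝ τ).hasFDerivAt.comp q (hΦd q hq)
  have hdp : ∀ q ∈ V, ∀ (τ : I) (b : ℝ × E),
      fderiv ℝ p (Φ q τ) (fderiv ℝ Φ q b τ) = fderiv ℝ p q.2 b.2 := by
    intro q hq τ b
    have h1 : HasFDerivAt (fun q => p (Φ q τ)) _ q :=
      (hpd (Φ q τ)).hasFDerivAt.comp q (hev q hq τ)
    have h2 : HasFDerivAt (fun q : ℝ × E => p q.2) _ q :=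
      (hpd q.2).hasFDerivAt.comp q hasFDerivAt_snd
    have h3 := h1.unique (h2.congr_of_eventuallyEq
      ((hVo.eventually_mem hq).mono fun q hq => hpΦ q hq τ))
    exact DFunLike.congr_fun h3 b
  have hvar : ∀ q ∈ V, ∀ a : ℝ × E, fderiv ℝ Φ q a = ContinuousMap.const I a.2 +
      primitiveL (q.1 • pointwiseApplyL
          ((⟨fderiv ℝ X, hX.continuous_fderiv (by simp)⟩ : C(E, E →L[ℝ] E)).comp (Φ q))
          (fderiv ℝ Φ q a) +
        a.1 • (⟨X, hX.continuous⟩ : C(E, E)).comp (Φ q)) := by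
    intro q hq a
    have h1 := (hasFDerivAt_comp_left (K := I) (hX.of_le (by simp)) (Φ q)).comp q (hΦd q hq)
    have h2 : HasFDerivAt (fun q : ℝ × E => ContinuousMap.const I q.2 +
        primitiveL (q.1 • (⟨X, hX.continuous⟩ : C(E, E)).comp (Φ q))) _ q :=
      (((ContinuousLinearMap.const ℝ I).comp (ContinuousLinearMap.snd ℝ ℝ E)).hasFDerivAt).add
        ((primitiveL (E := E)).hasFDerivAt.comp q (hasFDerivAt_fst.smul h1))
    have h3 := (hΦd q hq).unique (h2.congr_of_eventuallyEq
      ((hVo.eventually_mem hq).mono fun q hq => hΦV q hq))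
    exact DFunLike.congr_fun h3 a
  refine ⟨V, hVo, hV0, fun q => Φ q 1, (evalCLM (M := E) ℝ (1 : I)).contDiff.comp_contDiffOn hΦ, ?_,
    fun q hq => hpΦ q hq 1, ?_⟩
  · exact DFunLike.congr_fun hΦ0 1
  intro q hq a b
  have hd1 : fderiv ℝ (fun q => Φ q 1) q = (evalCLM ℝ (1 : I)).comp (fderiv ℝ Φ q) :=
    (hev q hq 1).fderiv
  have hzero' : ∀ a, fderiv ℝ Φ q a 0 = a.2 := by
    intro a
    rw [hvar q hq a, ContinuousMap.add_apply, primitiveL_apply]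
    simp
  set c : ℝ := a.1 * fderiv ℝ p q.2 b.2 - b.1 * fderiv ℝ p q.2 a.2 with hc
  have hconst := eq_of_hasDerivWithinAt_zero
    (f := fun t => B (fderiv ℝ Φ q a (projIcc 0 1 zero_le_one t))
      (fderiv ℝ Φ q b (projIcc 0 1 zero_le_one t)) - t * c) (fun τ hτ => by
      have ha := hasDerivWithinAt_of_eq_const_add_primitiveL (hvar q hq a) hτ
      have hb := hasDerivWithinAt_of_eq_const_add_primitiveL (hvar q hq b) hτ
      have h := ((B.hasFDerivAt.comp_hasDerivWithinAt τ ha).clm_apply hb).sub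
        ((hasDerivWithinAt_id τ _).mul_const c)
      refine h.congr_deriv ?_
      simp only [ContinuousMap.add_apply, ContinuousMap.smul_apply, pointwiseApplyL_apply,
        ContinuousMap.comp_apply, ContinuousMap.coe_mk, map_add, map_smul,
        _root_.add_apply, _root_.smul_apply, smul_eq_mul, hXp,
        Function.comp_apply, hBX', hdp q hq, hc]
      linear_combination q.1 * hinf (Φ q (projIcc 0 1 zero_le_one τ)) (fderiv ℝ Φ q a _)
        (fderiv ℝ Φ q b _))
    1 (right_mem_Icc.2 zero_le_one)
  simp only [projIcc_right, projIcc_left, one_mul, zero_mul, sub_zero] at hconst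
  rw [hd1]
  have h01 : (⟨0, left_mem_Icc.2 zero_le_one⟩ : I) = 0 := rfl
  have h11 : (⟨1, right_mem_Icc.2 zero_le_one⟩ : I) = 1 := rfl
  rw [h01, h11, hzero', hzero'] at hconst
  show B (fderiv ℝ Φ q a 1) (fderiv ℝ Φ q b 1) = _
  linarith

end Hamiltonian

section Straightening

universe u

variable {E : Type u} [NormedAddCommGroup E] [NormedSpace ℝ E] [FiniteDimensional ℝ E]

theorem exists_continuousLinearEquiv_of_injective (L : E →L[ℝ] E) (hL : Function.Injective L) :
    ∃ e : E ≃L[ℝ] E, L = e :=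
  ⟨(LinearEquiv.ofInjectiveEndo L.toLinearMap hL).toContinuousLinearEquiv, by ext v; rfl⟩

/-- Near a point where `p` has nonzero derivative along `e`, the function `p` becomes the linear
function `B · e'` after changing a point along `e` only. -/
theorem exists_contDiffOn_comp_eq (B : E →L[ℝ] E →L[ℝ] ℝ) {p : E → ℝ} (hp : ContDiff ℝ ∞ p)
    {e e' : E} (hee' : B e e' = 1) {z₀ : E} (hz₀ : fderiv ℝ p z₀ e ≠ 0) :
    ∃ (W : Set E) (b : E) (h : E → E), IsOpen W ∧ b ∈ W ∧ ContDiffOn ℝ ∞ h W ∧ h b = z₀ ∧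
      (∀ z ∈ W, p (h z) = B z e') ∧ ∀ z ∈ W, ∀ v, ∃ c : ℝ, fderiv ℝ h z v = v + c • e := by
  let G : E → E := fun z => z + (p z - B z e') • e
  have hBe' : ContDiff ℝ ∞ fun z => B z e' := (B.flip e').contDiff
  have hG : ContDiff ℝ ∞ G := contDiff_id.add ((hp.sub hBe').smul contDiff_const)
  have hG' : ∀ v, fderiv ℝ G z₀ v = v + (fderiv ℝ p z₀ v - B v e') • e := by
    intro v
    have h1 : HasFDerivAt (fun z => p z - B z e') _ z₀ :=
      (hp.differentiable (by simp) z₀).hasFDerivAt.sub (B.flip e').hasFDerivAt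
    have h2 : HasFDerivAt G _ z₀ := (hasFDerivAt_id z₀).add (h1.smul_const e)
    rw [h2.fderiv]
    simp
  have hinj : Function.Injective (fderiv ℝ G z₀) := by
    rw [injective_iff_map_eq_zero]
    intro v hv
    rw [hG'] at hv
    have h1 := congrArg (fun x => fderiv ℝ p z₀ x) hv
    have h2 := congrArg (fun x => B x e') hv
    simp only [map_add, map_smul, _root_.add_apply, _root_.smul_apply, smul_eq_mul, hee', map_zero,
      _root_.zero_apply] at h1 h2
    have h3 : fderiv ℝ p z₀ v = 0 := by linarith
    rw [h3] at h1 hv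
    have h4 : B v e' = 0 := by
      rcases mul_eq_zero.1 (show B v e' * fderiv ℝ p z₀ e = 0 by linarith) with h | h
      · exact h
      · exact absurd h hz₀
    simpa [h4] using hv
  obtain ⟨L, hL⟩ := exists_continuousLinearEquiv_of_injective _ hinj
  obtain ⟨k, hk, -, hkG, hks⟩ := exists_openPartialHomeomorph_contDiffOn_symm
    isOpen_univ (mem_univ z₀) hG.contDiffOn L hL
  have hGk : ∀ z ∈ k.target, G (k.symm z) = z := fun z hz => by rw [← hkG, k.right_inv hz]
  have hpk : ∀ z ∈ k.target, p (k.symm z) = B z e' := by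
    intro z hz
    have h := congrArg (fun x => B x e') (hGk z hz)
    simp only [G, map_add, map_smul, _root_.add_apply, _root_.smul_apply, smul_eq_mul, hee'] at h
    linarith
  refine ⟨k.target, k z₀, k.symm, k.open_target, k.map_source hk, hks, k.left_inv hk, hpk, ?_⟩
  intro z hz v
  have hd : HasFDerivAt k.symm (fderiv ℝ k.symm z) z :=
    ((hks.contDiffAt (k.open_target.mem_nhds hz)).differentiableAt (by simp)).hasFDerivAt
  have h1 : HasFDerivAt (fun z => z + (B (k.symm z) e' - B z e') • e) _ z :=
    (hasFDerivAt_id z).add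
      ((((B.flip e').hasFDerivAt.comp z hd).sub (B.flip e').hasFDerivAt).smul_const e)
  have h2 : k.symm =ᶠ[𝓝 z] fun z => z + (B (k.symm z) e' - B z e') • e := by
    filter_upwards [k.open_target.mem_nhds hz] with y hy
    have h := hGk y hy
    simp only [G, hpk y hy] at h
    linear_combination (norm := module) h
  exact ⟨_, DFunLike.congr_fun (hd.unique (h1.congr_of_eventuallyEq h2)) v⟩

/-- A function with nonzero derivative along `e` is the linear coordinate `B · e'` in suitable
symplectic coordinates, if `B e e' = 1`. -/
theorem exists_symplectic_comp_eq_of_fderiv_ne_zero (B : E ≃L[ℝ] (E →L[ℝ] ℝ))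
    (hB : ∀ v w, B v w = -B w v) {p : E → ℝ} (hp : ContDiff ℝ ∞ p)
    {e e' : E} (hee' : B e e' = 1) {z₀ : E} (hz₀ : fderiv ℝ p z₀ e ≠ 0) :
    ∃ U : Set E, IsOpen U ∧ U.Nonempty ∧ ∃ f : E → E, ContDiffOn ℝ ∞ f U ∧
      (∀ z ∈ U, ∀ v w, B (fderiv ℝ f z v) (fderiv ℝ f z w) = B v w) ∧
      ∀ z ∈ U, p (f z) = B z e' := by
  let X : E → E := fun x => B.symm (fderiv ℝ p x)
  have hX : ContDiff ℝ ∞ X := B.symm.contDiff.comp (hp.fderiv_right (by simp))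
  have hXp : ∀ x v, B (X x) v = fderiv ℝ p x v := fun x v => by simp [X]
  obtain ⟨V, hVo, hV0, φ, hφ, -, hφp, hφB⟩ :=
    exists_hamiltonian_flow (B : E →L[ℝ] E →L[ℝ] ℝ) hB hp hX hXp z₀
  obtain ⟨W, b, h, hWo, hbW, hh, hhb, hph, hh'⟩ :=
    exists_contDiffOn_comp_eq (B : E →L[ℝ] E →L[ℝ] ℝ) hp hee' hz₀
  simp only [ContinuousLinearEquiv.coe_coe] at hφB hph
  have hself : ∀ v, B v v = 0 := fun v => by linarith [hB v v]
  let s : E → ℝ := fun z => B e b - B e z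
  let Q : E → E := fun z => z + s z • e'
  have hs : ContDiff ℝ ∞ s := contDiff_const.sub (B e).contDiff
  have hs' : ∀ z, HasFDerivAt s (-B e) z := fun z => (B e).hasFDerivAt.const_sub _
  have hQ : ContDiff ℝ ∞ Q := contDiff_id.add (hs.smul contDiff_const)
  have hQ' : ∀ z, HasFDerivAt Q (ContinuousLinearMap.id ℝ E + (-B e).smulRight e') z :=
    fun z => (hasFDerivAt_id z).add ((hs' z).smul_const e')
  have hQb : Q b = b := by simp [Q, s]
  let k : E → ℝ × E := fun z => (s z, h (Q z))
  have hk : ContDiffOn ℝ ∞ k (Q ⁻¹' W) :=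
    hs.contDiffOn.prodMk (hh.comp hQ.contDiffOn fun z hz => hz)
  have hWo' : IsOpen (Q ⁻¹' W) := hWo.preimage hQ.continuous
  refine ⟨Q ⁻¹' W ∩ k ⁻¹' V, hk.continuousOn.isOpen_inter_preimage hWo' hVo, ⟨b, ?_, ?_⟩,
    fun z => φ (k z), hφ.comp (hk.mono inter_subset_left) fun z hz => hz.2, ?_, ?_⟩
  · rwa [mem_preimage, hQb]
  · rw [mem_preimage]
    simpa only [k, hQb, hhb, s, sub_self] using hV0
  · rintro z ⟨hzW, hzV⟩ v w
    have hdh : HasFDerivAt h (fderiv ℝ h (Q z)) (Q z) :=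
      ((hh.contDiffAt (hWo.mem_nhds hzW)).differentiableAt (by simp)).hasFDerivAt
    have hdk : HasFDerivAt k _ z := (hs' z).prodMk (hdh.comp z (hQ' z))
    have hdφ : HasFDerivAt φ (fderiv ℝ φ (k z)) (k z) :=
      ((hφ.contDiffAt (hVo.mem_nhds hzV)).differentiableAt (by simp)).hasFDerivAt
    have hdp : ∀ v, fderiv ℝ p (k z).2 (fderiv ℝ h (Q z) (v - B e v • e')) = B v e' := by
      intro v
      have h1 : HasFDerivAt (fun y => p (h (Q y))) _ z :=
        HasFDerivAt.comp (g := p) (f := fun y => h (Q y)) z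
          (hp.differentiable (by simp) _).hasFDerivAt (hdh.comp z (hQ' z))
      have h2 : (fun y => p (h (Q y))) =ᶠ[𝓝 z]
          (B : E →L[ℝ] E →L[ℝ] ℝ).flip e' := by
        filter_upwards [hWo'.mem_nhds hzW] with y hy
        rw [hph _ hy]
        simp [Q, hself]
      have h3 := DFunLike.congr_fun
        (h1.unique (ContinuousLinearMap.hasFDerivAt _ |>.congr_of_eventuallyEq h2)) v
      simpa [← sub_eq_add_neg] using h3
    have hval : ∀ v, fderiv ℝ (fun z => φ (k z)) z v =
        fderiv ℝ φ (k z) (-B e v, fderiv ℝ h (Q z) (v - B e v • e')) := by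
      intro v
      have hdf : HasFDerivAt (fun z => φ (k z)) _ z := hdφ.comp z hdk
      rw [hdf.fderiv]
      simp [← sub_eq_add_neg]
    obtain ⟨c, hc⟩ := hh' _ hzW (v - B e v • e')
    obtain ⟨d, hd⟩ := hh' _ hzW (w - B e w • e')
    rw [hval, hval, hφB _ hzV, hdp, hdp, hc, hd]
    simp only [map_add, map_sub, map_smul, _root_.add_apply, _root_.sub_apply, _root_.smul_apply,
      smul_eq_mul, hself, hee', hB e' w, hB v e]
    rw [hB e' e, hee']
    ring
  · rintro z ⟨hzW, hzV⟩
    rw [hφp _ hzV, hph _ hzW]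
    simp [Q, hself]

/-- The Carathéodory–Jacobi–Lie theorem for a single function: a function with nonzero derivative
at some point is the linear coordinate `B · e'` in suitable symplectic coordinates. -/
theorem exists_symplectic_comp_eq (B : E ≃L[ℝ] (E →L[ℝ] ℝ))
    (hB : ∀ v w, B v w = -B w v) {p : E → ℝ} (hp : ContDiff ℝ ∞ p)
    {e e' : E} (hee' : B e e' = 1) {z₀ : E} (hz₀ : fderiv ℝ p z₀ ≠ 0) :
    ∃ U : Set E, IsOpen U ∧ U.Nonempty ∧ ∃ f : E → E, ContDiffOn ℝ ∞ f U ∧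
      (∀ z ∈ U, ∀ v w, B (fderiv ℝ f z v) (fderiv ℝ f z w) = B v w) ∧
      ∀ z ∈ U, p (f z) = B z e' := by
  have hself : ∀ v, B v v = 0 := fun v => by linarith [hB v v]
  obtain ⟨w, hw⟩ : ∃ w, fderiv ℝ p z₀ (e + B e w • w) ≠ 0 := by
    by_contra! hcon
    simp only [map_add, map_smul, smul_eq_mul] at hcon
    have h0 : fderiv ℝ p z₀ e = 0 := by simpa using hcon 0
    have h1 : fderiv ℝ p z₀ e' = 0 := by simpa [h0, hee'] using hcon e'
    refine hz₀ (ContinuousLinearMap.ext fun a => ?_)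
    have h2 := hcon a
    have h3 := hcon (a + e')
    simp only [map_add, h0, h1, hee', zero_add, add_zero] at h2 h3
    simp only [_root_.zero_apply]
    linarith
  -- the symplectic transvection with direction `w`
  let T : E →L[ℝ] E :=
    ContinuousLinearMap.id ℝ E + ((B : E →L[ℝ] E →L[ℝ] ℝ).flip w).smulRight w
  have hT : ∀ v, T v = v + B v w • w := fun v => by simp [T]
  have hTB : ∀ u v, B (T u) (T v) = B u v := by
    intro u v
    simp only [hT, map_add, map_smul, _root_.add_apply, _root_.smul_apply, smul_eq_mul, hself]
    rw [hB w v]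
    ring
  have hTz : T (z₀ - B z₀ w • w) = z₀ := by
    simp [hT, hself]
  have hpT : fderiv ℝ (fun z => p (T z)) (z₀ - B z₀ w • w) e ≠ 0 := by
    have h : HasFDerivAt (fun z => p (T z)) _ (z₀ - B z₀ w • w) :=
      HasFDerivAt.comp (g := p) (z₀ - B z₀ w • w)
        (hp.differentiable (by simp) _).hasFDerivAt T.hasFDerivAt
    rw [h.fderiv, hTz]
    simpa [hT] using hw
  obtain ⟨U, hU, hne, f, hf, hfB, hfp⟩ :=
    exists_symplectic_comp_eq_of_fderiv_ne_zero B hB (hp.comp T.contDiff) hee' hpT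
  refine ⟨U, hU, hne, fun z => T (f z), T.contDiff.comp_contDiffOn hf, fun z hz v w => ?_, hfp⟩
  have hd : HasFDerivAt f (fderiv ℝ f z) z :=
    ((hf.contDiffAt (hU.mem_nhds hz)).differentiableAt (by simp)).hasFDerivAt
  have hd' : fderiv ℝ (fun z => T (f z)) z = T.comp (fderiv ℝ f z) :=
    (T.hasFDerivAt.comp z hd).fderiv
  rw [hd', ContinuousLinearMap.comp_apply, ContinuousLinearMap.comp_apply, hTB, hfB z hz]

end Straightening

section StandardForm

variable {n : ℕ}

theorem stdSymplMatrix_transpose : (stdSymplMatrix n)ᵀ = -stdSymplMatrix n := by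
  simp [stdSymplMatrix, fromBlocks_transpose, fromBlocks_neg]

theorem stdSymplMatrix_mul_self : stdSymplMatrix n * stdSymplMatrix n = -1 := by
  simp [stdSymplMatrix, fromBlocks_multiply, ← fromBlocks_one, fromBlocks_neg]

/-- The standard symplectic form, as an isomorphism of `ℝ^(2n)` with its dual. -/
theorem exists_stdSymplForm : ∃ B : (Fin n ⊕ Fin n → ℝ) ≃L[ℝ] ((Fin n ⊕ Fin n → ℝ) →L[ℝ] ℝ),
    ∀ v w, B v w = v ⬝ᵥ stdSymplMatrix n *ᵥ w := by
  let B₀ : (Fin n ⊕ Fin n → ℝ) →ₗ[ℝ] ((Fin n ⊕ Fin n → ℝ) →L[ℝ] ℝ) :=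
    LinearMap.toContinuousLinearMap.toLinearMap ∘ₗ Matrix.toBilin' (stdSymplMatrix n)
  have hB₀ : ∀ v w, B₀ v w = v ⬝ᵥ stdSymplMatrix n *ᵥ w := fun v w =>
    Matrix.toBilin'_apply' _ v w
  have hinj : Function.Injective B₀ := by
    rw [injective_iff_map_eq_zero]
    intro v hv
    have h := hB₀ v (-(stdSymplMatrix n *ᵥ v))
    rw [hv, mulVec_neg, mulVec_mulVec, stdSymplMatrix_mul_self, neg_mulVec, neg_neg,
      one_mulVec] at h
    exact dotProduct_self_eq_zero.1 h.symm
  have hdim : Module.finrank ℝ (Fin n ⊕ Fin n → ℝ) =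
      Module.finrank ℝ ((Fin n ⊕ Fin n → ℝ) →L[ℝ] ℝ) :=
    (Subspace.dual_finrank_eq (K := ℝ)).symm.trans
      (LinearMap.toContinuousLinearMap (𝕜 := ℝ) (E := Fin n ⊕ Fin n → ℝ) (F' := ℝ)).finrank_eq
  exact ⟨(LinearEquiv.ofInjectiveOfFinrankEq B₀ hinj hdim).toContinuousLinearEquiv, hB₀⟩

theorem transpose_mul_stdSymplMatrix_mul {L : (Fin n ⊕ Fin n → ℝ) →ₗ[ℝ] (Fin n ⊕ Fin n → ℝ)}
    (hL : ∀ v w, L v ⬝ᵥ stdSymplMatrix n *ᵥ L w = v ⬝ᵥ stdSymplMatrix n *ᵥ w) :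
    (LinearMap.toMatrix' L)ᵀ * stdSymplMatrix n * LinearMap.toMatrix' L = stdSymplMatrix n := by
  apply Matrix.toBilin'.injective
  refine LinearMap.ext₂ fun v w => ?_
  rw [Matrix.toBilin'_apply', Matrix.toBilin'_apply', ← hL, ← mulVec_mulVec, ← mulVec_mulVec,
    dotProduct_mulVec, vecMul_transpose, LinearMap.toMatrix'_mulVec, LinearMap.toMatrix'_mulVec]

end StandardForm

/-- If `p : ℝ^(2n) → ℝ` is smooth with nonvanishing gradient at some point, then there
is an open set `U` and a symplectomorphism onto its image `f : U → ℝ^(2n)` such that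
`p ∘ f = x₁` on `U`. -/
theorem darboux_corollary (n : ℕ) (hn : 0 < n)
    (p : (Fin n ⊕ Fin n → ℝ) → ℝ) (hp : ContDiff ℝ (⊤ : ℕ∞) p)
    (hgrad : ∃ z, fderiv ℝ p z ≠ 0) :
    ∃ U : Set (Fin n ⊕ Fin n → ℝ), IsOpen U ∧ U.Nonempty ∧
      ∃ f : (Fin n ⊕ Fin n → ℝ) → (Fin n ⊕ Fin n → ℝ),
        ContDiffOn ℝ (⊤ : ℕ∞) f U ∧ IsOpen (f '' U) ∧
        (∃ g, ContDiffOn ℝ (⊤ : ℕ∞) g (f '' U) ∧ Set.InvOn g f U (f '' U)) ∧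
        (∀ z ∈ U, (jacMatrix f z)ᵀ * stdSymplMatrix n * jacMatrix f z = stdSymplMatrix n) ∧
        (∀ z ∈ U, p (f z) = z (Sum.inl ⟨0, hn⟩)) := by
  obtain ⟨z₀, hz₀⟩ := hgrad
  obtain ⟨B, hB⟩ := exists_stdSymplForm (n := n)
  have hanti : ∀ v w, B v w = -B w v := by
    intro v w
    rw [hB, hB, dotProduct_mulVec, ← mulVec_transpose, stdSymplMatrix_transpose, neg_mulVec,
      neg_dotProduct, dotProduct_comm]
  have hcoord : ∀ z, B z (Pi.single (Sum.inr ⟨0, hn⟩) 1) = z (Sum.inl ⟨0, hn⟩) := by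
    intro z
    rw [hB, mulVec_single_one, dotProduct, Fintype.sum_sum_type]
    simp [stdSymplMatrix, Matrix.one_apply]
  obtain ⟨U, hU, ⟨z₁, hz₁⟩, f, hf, hfB, hfp⟩ := exists_symplectic_comp_eq B hanti hp
    (e := Pi.single (Sum.inl ⟨0, hn⟩) 1) (by rw [hcoord, Pi.single_eq_same]) hz₀
  have hinj : Function.Injective (fderiv ℝ f z₁) := by
    rw [injective_iff_map_eq_zero]
    intro v hv
    apply B.injective
    ext w
    rw [← hfB z₁ hz₁, hv, map_zero, _root_.zero_apply, _root_.zero_apply]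
  obtain ⟨L, hL⟩ := exists_continuousLinearEquiv_of_injective _ hinj
  obtain ⟨e, hez₁, heU, hef, hes⟩ := exists_openPartialHomeomorph_contDiffOn_symm hU hz₁ hf L hL
  have hef' : (e : (Fin n ⊕ Fin n → ℝ) → (Fin n ⊕ Fin n → ℝ)) = f := funext hef
  have himage : f '' e.source = e.target := by rw [← hef', e.image_source_eq_target]
  refine ⟨e.source, e.open_source, ⟨z₁, hez₁⟩, f, hf.mono heU, ?_, ⟨e.symm, ?_, ?_⟩, ?_, ?_⟩
  · rw [himage]; exact e.open_target
  · rw [himage]; exact hes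
  · rw [himage, ← hef']; exact e.invOn
  · intro z hz
    exact transpose_mul_stdSymplMatrix_mul fun v w =>
      (hB _ _).symm.trans ((hfB z (heU hz) v w).trans (hB v w))
  · intro z hz
    rw [hfp z (heU hz), hcoord]
end

section
/- Let n ≥ 1, S : ℝⁿ × ℝⁿ → ℝ a C² function such that the mixed Hessian matrix (∂²S/∂xᵢ∂yⱼ(x,y)) is invertible at every point (x,y), and let S₀(x,y) = ⟨x,y⟩ be the standard inner product. Assume the C¹ distance from S to S₀ is finite, i.e. sup over (x,y) of |S(x,y) − S₀(x,y)| + |∇S(x,y) − ∇S₀(x,y)| < ∞. Then for every fixed x ∈ ℝⁿ, the map y ↦ ∇ₓS(x,y) (the gradient of S in the x-variables, evaluated at (x,y)) is a global diffeomorphism of ℝⁿ; consequently the generating relation (x, ∇ₓS(x,y)) ↦ (∇_y S(x,y), y) is well-defined on all of ℝ^(2n) and defines a global symplectomorphism φ_S of ℝ^(2n) (a diffeomorphism whose Jacobian matrix M satisfies Mᵀ J M = J everywhere, J the standard symplectic matrix). -/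
open Set

open scoped RealInnerProductSpace

/-- The standard symplectic form on `ℝⁿ × ℝⁿ`: `ω((a,b),(c,d)) = ⟪a,d⟫ - ⟪b,c⟫`,
i.e. `Σᵢ dxᵢ ∧ dyᵢ`. -/
noncomputable def stdSymplForm {n : ℕ}
    (u v : EuclideanSpace ℝ (Fin n) × EuclideanSpace ℝ (Fin n)) : ℝ :=
  ⟪u.1, v.2⟫ - ⟪u.2, v.1⟫

open Topology Filter

theorem IsCoveringMap.injective_of_simplyConnectedSpace {X Y : Type*} [TopologicalSpace X]
    [TopologicalSpace Y] [PreconnectedSpace X] [SimplyConnectedSpace Y]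
    [LocallyPathConnectedSpace Y] {f : X → Y} (hf : IsCoveringMap f) : Function.Injective f := by
  intro a b hab
  obtain ⟨g, ⟨hga, hfg⟩, -⟩ := hf.existsUnique_continuousMap_lifts (ContinuousMap.id Y) (f a) a rfl
  have hgf : g ∘ f = id := by
    refine hf.eq_of_comp_eq (g.continuous.comp hf.continuous) continuous_id ?_ a hga
    rw [← Function.comp_assoc, hfg]
    rfl
  calc a = g (f a) := (congrFun hgf a).symm
    _ = g (f b) := by rw [hab]
    _ = b := congrFun hgf b

/-- A proper local homeomorphism from a connected space to a simply connected one is bijective. -/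
theorem IsLocalHomeomorph.bijective_of_isProperMap {X Y : Type*} [TopologicalSpace X]
    [TopologicalSpace Y] [T2Space X] [T1Space Y] [ConnectedSpace X] [SimplyConnectedSpace Y]
    [LocallyPathConnectedSpace Y] {f : X → Y} (hf : IsLocalHomeomorph f) (hp : IsProperMap f) :
    Function.Bijective f := by
  have hcov : IsCoveringMap f := by
    rw [isCoveringMap_iff_isCoveringMapOn_univ]
    refine hp.isClosedMap.isCoveringMapOn_of_isLocalHomeomorphOn (fun y _ ↦ ?_)
      (hf.isLocalHomeomorphOn.mono (subset_univ _))
    refine (hp.isCompact_preimage isCompact_singleton).finite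
      (.of_openPartialHomeomorph f (x := y) subset_rfl fun e _ ↦ ?_)
    obtain ⟨φ, he, rfl⟩ := hf e
    exact ⟨φ, he, rfl⟩
  refine ⟨hcov.injective_of_simplyConnectedSpace, range_eq_univ.mp ?_⟩
  exact IsClopen.eq_univ ⟨hp.isClosedMap.isClosed_range, hf.isOpenMap.isOpen_range⟩
    (range_nonempty f)

theorem tendsto_cocompact_of_norm_sub_le {V : Type*} [NormedAddCommGroup V] [ProperSpace V]
    {f : V → V} {L : ℝ} (hL : ∀ x, ‖f x - x‖ ≤ L) : Tendsto f (cocompact V) (cocompact V) := by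
  rw [← Metric.cobounded_eq_cocompact, ← tendsto_norm_atTop_iff_cobounded]
  refine tendsto_atTop_mono (f := fun x ↦ ‖x‖ - L) (fun x ↦ ?_)
    (tendsto_atTop_add_const_right _ (-L) tendsto_norm_cobounded_atTop)
  have h₁ := norm_sub_norm_le x (f x)
  rw [norm_sub_rev] at h₁
  linarith [hL x]

/-- A `C¹` local diffeomorphism of a finite-dimensional space at bounded distance from the
identity is a global diffeomorphism. -/
theorem exists_equiv_contDiff_of_norm_sub_le {V : Type*} [NormedAddCommGroup V]
    [NormedSpace ℝ V] [FiniteDimensional ℝ V] {f : V → V} (hf : ContDiff ℝ 1 f)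
    (hf' : ∀ x, Function.Injective (fderiv ℝ f x)) {L : ℝ} (hL : ∀ x, ‖f x - x‖ ≤ L) :
    ∃ e : V ≃ V, ⇑e = f ∧ ContDiff ℝ 1 e.symm := by
  have : ProperSpace V := FiniteDimensional.proper_real V
  have : CompleteSpace V := FiniteDimensional.complete ℝ V
  let f' (x : V) : V ≃L[ℝ] V :=
    (LinearEquiv.ofInjectiveEndo (fderiv ℝ f x : V →ₗ[ℝ] V) (hf' x)).toContinuousLinearEquiv
  have hff' (x : V) : HasFDerivAt f (f' x : V →L[ℝ] V) x := by
    have h : (f' x : V →L[ℝ] V) = fderiv ℝ f x := by ext; rfl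
    rw [h]
    exact (hf.differentiable one_ne_zero x).hasFDerivAt
  have hloc : IsLocalHomeomorph f := fun x ↦
    ⟨hf.contDiffAt.toOpenPartialHomeomorph f (hff' x) one_ne_zero,
      hf.contDiffAt.mem_toOpenPartialHomeomorph_source (hff' x) one_ne_zero, rfl⟩
  have hprop : IsProperMap f :=
    isProperMap_iff_tendsto_cocompact.mpr ⟨hf.continuous, tendsto_cocompact_of_norm_sub_le hL⟩
  let e : V ≃ₜ V := hloc.toHomeomorphOfBijective (hloc.bijective_of_isProperMap hprop)
  exact ⟨e.toEquiv, rfl, e.contDiff_symm (f₀' := f') hff' hf⟩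

section PartialGradient

variable {E F : Type*} [NormedAddCommGroup E] [InnerProductSpace ℝ E]
  [NormedAddCommGroup F] [InnerProductSpace ℝ F] {S : E × F → ℝ}

/-- The gradient of `S` in its first variable. -/
noncomputable def fstGradient [CompleteSpace E] (S : E × F → ℝ) (p : E × F) : E :=
  gradient (fun x ↦ S (x, p.2)) p.1

/-- The gradient of `S` in its second variable. -/
noncomputable def sndGradient [CompleteSpace F] (S : E × F → ℝ) (p : E × F) : F :=
  gradient (fun y ↦ S (p.1, y)) p.2

theorem fstGradient_eq [CompleteSpace E] (hS : Differentiable ℝ S) :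
    fstGradient S = fun p ↦ (InnerProductSpace.toDual ℝ E).symm
      ((fderiv ℝ S p).comp (ContinuousLinearMap.inl ℝ E F)) := by
  ext1 p
  unfold fstGradient gradient
  congr 1
  exact ((hS (p.1, p.2)).hasFDerivAt.comp p.1 (hasFDerivAt_prodMk_left p.1 p.2)).fderiv

theorem sndGradient_eq [CompleteSpace F] (hS : Differentiable ℝ S) :
    sndGradient S = fun p ↦ (InnerProductSpace.toDual ℝ F).symm
      ((fderiv ℝ S p).comp (ContinuousLinearMap.inr ℝ E F)) := by
  ext1 p
  unfold sndGradient gradient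
  congr 1
  exact ((hS (p.1, p.2)).hasFDerivAt.comp p.2 (hasFDerivAt_prodMk_right p.1 p.2)).fderiv

theorem inner_fstGradient [CompleteSpace E] (hS : Differentiable ℝ S) (p : E × F) (w : E) :
    ⟪fstGradient S p, w⟫ = fderiv ℝ S p (w, 0) := by
  simp [fstGradient_eq hS]

theorem inner_sndGradient [CompleteSpace F] (hS : Differentiable ℝ S) (p : E × F) (w : F) :
    ⟪sndGradient S p, w⟫ = fderiv ℝ S p (0, w) := by
  simp [sndGradient_eq hS]

theorem contDiff_fstGradient [CompleteSpace E] (hS : ContDiff ℝ 2 S) :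
    ContDiff ℝ 1 (fstGradient S) := by
  rw [fstGradient_eq (hS.differentiable two_ne_zero)]
  exact (InnerProductSpace.toDual ℝ E).symm.toContinuousLinearEquiv.contDiff.comp
    ((hS.fderiv_right (by norm_num)).clm_comp contDiff_const)

theorem contDiff_sndGradient [CompleteSpace F] (hS : ContDiff ℝ 2 S) :
    ContDiff ℝ 1 (sndGradient S) := by
  rw [sndGradient_eq (hS.differentiable two_ne_zero)]
  exact (InnerProductSpace.toDual ℝ F).symm.toContinuousLinearEquiv.contDiff.comp
    ((hS.fderiv_right (by norm_num)).clm_comp contDiff_const)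

theorem inner_fderiv_fstGradient [CompleteSpace E] (hS : ContDiff ℝ 2 S) (p u : E × F) (w : E) :
    ⟪fderiv ℝ (fstGradient S) p u, w⟫ = fderiv ℝ (fderiv ℝ S) p u (w, 0) := by
  have hS' : ContDiff ℝ 1 (fderiv ℝ S) := hS.fderiv_right (by norm_num)
  have h := ((contDiff_fstGradient hS).differentiable one_ne_zero p).hasFDerivAt.inner ℝ
    (hasFDerivAt_const w p)
  simp only [inner_fstGradient (hS.differentiable two_ne_zero)] at h
  have h' := (hS'.differentiable one_ne_zero p).hasFDerivAt.clm_apply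
    (hasFDerivAt_const ((w, 0) : E × F) p)
  simpa using DFunLike.congr_fun (h.unique h') u

theorem inner_fderiv_sndGradient [CompleteSpace F] (hS : ContDiff ℝ 2 S) (p u : E × F) (w : F) :
    ⟪fderiv ℝ (sndGradient S) p u, w⟫ = fderiv ℝ (fderiv ℝ S) p u (0, w) := by
  have hS' : ContDiff ℝ 1 (fderiv ℝ S) := hS.fderiv_right (by norm_num)
  have h := ((contDiff_sndGradient hS).differentiable one_ne_zero p).hasFDerivAt.inner ℝ
    (hasFDerivAt_const w p)
  simp only [inner_sndGradient (hS.differentiable two_ne_zero)] at h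
  have h' := (hS'.differentiable one_ne_zero p).hasFDerivAt.clm_apply
    (hasFDerivAt_const ((0, w) : E × F) p)
  simpa using DFunLike.congr_fun (h.unique h') u

theorem fderiv_fderiv_comm (hS : ContDiff ℝ 2 S) (p u v : E × F) :
    fderiv ℝ (fderiv ℝ S) p u v = fderiv ℝ (fderiv ℝ S) p v u :=
  hS.contDiffAt.isSymmSndFDerivAt (by simp) u v

theorem fderiv_fstGradient_zero_mk [CompleteSpace E] (hS : ContDiff ℝ 2 S) (x : E) (y w : F) :
    fderiv ℝ (fun y' ↦ gradient (fun x' ↦ S (x', y')) x) y w =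
      fderiv ℝ (fstGradient S) (x, y) (0, w) := by
  have h := ((contDiff_fstGradient hS).differentiable one_ne_zero (x, y)).hasFDerivAt.comp y
    (hasFDerivAt_prodMk_right x y)
  change fderiv ℝ (fstGradient S ∘ fun y' ↦ (x, y')) y w = _
  rw [h.fderiv]
  simp

end PartialGradient

section Generating

variable {E : Type*} [NormedAddCommGroup E] [InnerProductSpace ℝ E] {S : E × E → ℝ}

theorem fderiv_inner_prod_apply (p u : E × E) :
    fderiv ℝ (fun q : E × E ↦ (⟪q.1, q.2⟫ : ℝ)) p u = ⟪p.1, u.2⟫ + ⟪u.1, p.2⟫ := by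
  rw [fderiv_inner_apply ℝ differentiableAt_fst differentiableAt_snd]
  simp [fderiv_fst, fderiv_snd]

theorem norm_le_opNorm_of_inner_self_eq {V : Type*} [NormedAddCommGroup V] [NormedSpace ℝ V]
    {A : V →L[ℝ] ℝ} {v : E} {w : V} (hw : ‖w‖ ≤ ‖v‖) (h : ⟪v, v⟫ = A w) : ‖v‖ ≤ ‖A‖ := by
  have hle : ‖v‖ * ‖v‖ ≤ ‖A‖ * ‖v‖ := by
    rw [← real_inner_self_eq_norm_mul_norm, h]
    exact (le_abs_self _).trans (A.le_opNorm_of_le hw)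
  rcases (norm_nonneg v).eq_or_lt with h0 | h0
  · exact h0 ▸ norm_nonneg A
  · exact le_of_mul_le_mul_right hle h0

theorem norm_fstGradient_sub_le [CompleteSpace E] (hS : Differentiable ℝ S) (p : E × E) :
    ‖fstGradient S p - p.2‖ ≤
      ‖fderiv ℝ S p - fderiv ℝ (fun q : E × E ↦ (⟪q.1, q.2⟫ : ℝ)) p‖ := by
  refine norm_le_opNorm_of_inner_self_eq (w := (fstGradient S p - p.2, 0)) (by simp) ?_
  rw [inner_sub_left, inner_fstGradient hS, sub_apply, fderiv_inner_prod_apply,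
    inner_zero_right, zero_add, real_inner_comm]

theorem norm_sndGradient_sub_le [CompleteSpace E] (hS : Differentiable ℝ S) (p : E × E) :
    ‖sndGradient S p - p.1‖ ≤
      ‖fderiv ℝ S p - fderiv ℝ (fun q : E × E ↦ (⟪q.1, q.2⟫ : ℝ)) p‖ := by
  refine norm_le_opNorm_of_inner_self_eq (w := (0, sndGradient S p - p.1)) (by simp) ?_
  rw [inner_sub_left, inner_sndGradient hS, sub_apply, fderiv_inner_prod_apply,
    inner_zero_left, add_zero]

theorem hasFDerivAt_prodMk_fstGradient [CompleteSpace E] (hS : ContDiff ℝ 2 S) (p : E × E) :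
    HasFDerivAt (fun q ↦ (q.1, fstGradient S q))
      ((ContinuousLinearMap.fst ℝ E E).prod (fderiv ℝ (fstGradient S) p)) p :=
  hasFDerivAt_fst.prodMk ((contDiff_fstGradient hS).differentiable one_ne_zero p).hasFDerivAt

theorem hasFDerivAt_sndGradient_prodMk [CompleteSpace E] (hS : ContDiff ℝ 2 S) (p : E × E) :
    HasFDerivAt (fun q ↦ (sndGradient S q, q.2))
      ((fderiv ℝ (sndGradient S) p).prod (ContinuousLinearMap.snd ℝ E E)) p :=
  ((contDiff_sndGradient hS).differentiable one_ne_zero p).hasFDerivAt.prodMk hasFDerivAt_snd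

theorem injective_fderiv_prodMk_fstGradient [CompleteSpace E] (hS : ContDiff ℝ 2 S) (p : E × E)
    (h : Function.Injective fun w ↦ fderiv ℝ (fstGradient S) p (0, w)) :
    Function.Injective (fderiv ℝ (fun q ↦ (q.1, fstGradient S q)) p) := by
  rw [(hasFDerivAt_prodMk_fstGradient hS p).fderiv, injective_iff_map_eq_zero]
  rintro ⟨a, b⟩ hab
  obtain ⟨rfl, hb⟩ : a = 0 ∧ fderiv ℝ (fstGradient S) p (a, b) = 0 := by simpa using hab
  rw [h (a₁ := b) (a₂ := 0) (by simpa [Prod.mk_zero_zero] using hb)]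
  rfl

theorem injective_fderiv_sndGradient_prodMk [CompleteSpace E] (hS : ContDiff ℝ 2 S) (p : E × E)
    (h : Function.Surjective fun w ↦ fderiv ℝ (fstGradient S) p (0, w)) :
    Function.Injective (fderiv ℝ (fun q ↦ (sndGradient S q, q.2)) p) := by
  rw [(hasFDerivAt_sndGradient_prodMk hS p).fderiv, injective_iff_map_eq_zero]
  rintro ⟨a, b⟩ hab
  obtain ⟨ha, rfl⟩ : fderiv ℝ (sndGradient S) p (a, b) = 0 ∧ b = 0 := by simpa using hab
  obtain ⟨w, hw : fderiv ℝ (fstGradient S) p (0, w) = a⟩ := h a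
  have : ⟪a, a⟫ = 0 := by
    nth_rw 1 [← hw]
    rw [inner_fderiv_fstGradient hS, fderiv_fderiv_comm hS, ← inner_fderiv_sndGradient hS, ha,
      inner_zero_left]
  rw [inner_self_eq_zero.mp this]
  rfl

end Generating

theorem stdSymplForm_fderiv_sndGradient_prodMk {n : ℕ}
    {S : EuclideanSpace ℝ (Fin n) × EuclideanSpace ℝ (Fin n) → ℝ} (hS : ContDiff ℝ 2 S)
    (p u v : EuclideanSpace ℝ (Fin n) × EuclideanSpace ℝ (Fin n)) :
    stdSymplForm (fderiv ℝ (fun q ↦ (sndGradient S q, q.2)) p u)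
        (fderiv ℝ (fun q ↦ (sndGradient S q, q.2)) p v) =
      stdSymplForm (fderiv ℝ (fun q ↦ (q.1, fstGradient S q)) p u)
        (fderiv ℝ (fun q ↦ (q.1, fstGradient S q)) p v) := by
  rw [(hasFDerivAt_prodMk_fstGradient hS p).fderiv, (hasFDerivAt_sndGradient_prodMk hS p).fderiv]
  simp only [stdSymplForm, ContinuousLinearMap.prod_apply, ContinuousLinearMap.coe_fst',
    ContinuousLinearMap.coe_snd']
  rw [real_inner_comm _ u.2, real_inner_comm _ u.1]
  simp only [inner_fderiv_fstGradient hS, inner_fderiv_sndGradient hS]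
  have split (a b : EuclideanSpace ℝ (Fin n) × EuclideanSpace ℝ (Fin n)) :
      fderiv ℝ (fderiv ℝ S) p a b =
        fderiv ℝ (fderiv ℝ S) p a (b.1, 0) + fderiv ℝ (fderiv ℝ S) p a (0, b.2) := by
    rw [← map_add]
    simp
  linarith [fderiv_fderiv_comm hS p u v, split u v, split v u]

/-- **Generating functions with finite `C¹` distance to `⟨x,y⟩` generate global
symplectomorphisms.**  If `S : ℝⁿ × ℝⁿ → ℝ` is `C²` with everywhere invertible mixed
Hessian, and the `C¹` distance from `S` to `S₀(x,y) = ⟪x,y⟫` is finite, then for each `x`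
the map `y ↦ ∇ₓS(x,y)` is a global diffeomorphism of `ℝⁿ`, and the generating relation
`(x, ∇ₓS(x,y)) ↦ (∇_yS(x,y), y)` defines a global symplectomorphism of `ℝ²ⁿ`. -/
theorem generating_function_global (n : ℕ) (hn : 1 ≤ n)
    (S : EuclideanSpace ℝ (Fin n) × EuclideanSpace ℝ (Fin n) → ℝ)
    (hS : ContDiff ℝ 2 S)
    (hmix : ∀ x y : EuclideanSpace ℝ (Fin n),
      Function.Bijective (fderiv ℝ (fun y' => gradient (fun x' => S (x', y')) x) y))
    (hdist : ∃ L : ℝ, ∀ p : EuclideanSpace ℝ (Fin n) × EuclideanSpace ℝ (Fin n),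
      |S p - ⟪p.1, p.2⟫| +
        ‖fderiv ℝ S p - fderiv ℝ (fun q : EuclideanSpace ℝ (Fin n) × EuclideanSpace ℝ (Fin n)
          => (⟪q.1, q.2⟫ : ℝ)) p‖ ≤ L) :
    (∀ x : EuclideanSpace ℝ (Fin n),
      ∃ e : EuclideanSpace ℝ (Fin n) ≃ EuclideanSpace ℝ (Fin n),
        (∀ y, e y = gradient (fun x' => S (x', y)) x) ∧
        ContDiff ℝ 1 ⇑e ∧ ContDiff ℝ 1 ⇑e.symm) ∧
    ∃ φ : EuclideanSpace ℝ (Fin n) × EuclideanSpace ℝ (Fin n) →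
        EuclideanSpace ℝ (Fin n) × EuclideanSpace ℝ (Fin n),
      Function.Bijective φ ∧ ContDiff ℝ 1 φ ∧
      (∃ ψ, ContDiff ℝ 1 ψ ∧ Function.LeftInverse ψ φ ∧ Function.RightInverse ψ φ) ∧
      (∀ x y : EuclideanSpace ℝ (Fin n),
        φ (x, gradient (fun x' => S (x', y)) x) = (gradient (fun y' => S (x, y')) y, y)) ∧
      (∀ p u v, stdSymplForm (fderiv ℝ φ p u) (fderiv ℝ φ p v) = stdSymplForm u v) := by
  obtain ⟨L, hL⟩ := hdist
  have hS1 : Differentiable ℝ S := hS.differentiable two_ne_zero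
  have hL' (p : EuclideanSpace ℝ (Fin n) × EuclideanSpace ℝ (Fin n)) :=
    (le_add_of_nonneg_left (abs_nonneg _)).trans (hL p)
  have hbij (p : EuclideanSpace ℝ (Fin n) × EuclideanSpace ℝ (Fin n)) :
      Function.Bijective fun w ↦ fderiv ℝ (fstGradient S) p (0, w) := by
    simpa only [← fderiv_fstGradient_zero_mk hS] using hmix p.1 p.2
  have hF : ContDiff ℝ 1 fun p ↦ (p.1, fstGradient S p) :=
    contDiff_fst.prodMk (contDiff_fstGradient hS)
  have hG : ContDiff ℝ 1 fun p ↦ (sndGradient S p, p.2) :=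
    (contDiff_sndGradient hS).prodMk contDiff_snd
  obtain ⟨eF, heF, heF'⟩ := exists_equiv_contDiff_of_norm_sub_le hF
    (fun p ↦ injective_fderiv_prodMk_fstGradient hS p (hbij p).1) (L := L) fun p ↦ by
      simpa [Prod.norm_def] using (norm_fstGradient_sub_le hS1 p).trans (hL' p)
  obtain ⟨eG, heG, heG'⟩ := exists_equiv_contDiff_of_norm_sub_le hG
    (fun p ↦ injective_fderiv_sndGradient_prodMk hS p (hbij p).2) (L := L) fun p ↦ by
      simpa [Prod.norm_def] using (norm_sndGradient_sub_le hS1 p).trans (hL' p)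
  have heF_apply (x y : EuclideanSpace ℝ (Fin n)) :
      eF (x, y) = (x, fstGradient S (x, y)) := congrFun heF (x, y)
  rw [← heF] at hF
  rw [← heG] at hG
  constructor
  · intro x
    have hfst (v : EuclideanSpace ℝ (Fin n)) : (eF.symm (x, v)).1 = x := by
      have h := heF_apply (eF.symm (x, v)).1 (eF.symm (x, v)).2
      rw [Prod.mk.eta, eF.apply_symm_apply] at h
      exact (congrArg Prod.fst h).symm
    refine ⟨⟨fun y ↦ (eF (x, y)).2, fun v ↦ (eF.symm (x, v)).2, fun y ↦ ?_, fun v ↦ ?_⟩,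
      fun y ↦ congrArg Prod.snd (heF_apply x y), ?_, ?_⟩
    · have h : (x, (eF (x, y)).2) = eF (x, y) := by rw [heF_apply]
      simp only [h, eF.symm_apply_apply]
    · have h : (x, (eF.symm (x, v)).2) = eF.symm (x, v) := Prod.ext (hfst v).symm rfl
      simp only [h, eF.apply_symm_apply]
    · exact contDiff_snd.comp (hF.comp (contDiff_prodMk_right x))
    · exact contDiff_snd.comp (heF'.comp (contDiff_prodMk_right x))
  · let φ := eF.symm.trans eG
    have hφ : ContDiff ℝ 1 φ := hG.comp heF'
    refine ⟨φ, φ.bijective, hφ, ⟨φ.symm, hF.comp heG', φ.left_inv, φ.right_inv⟩,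
      fun x y ↦ ?_, fun p u v ↦ ?_⟩
    · change eG (eF.symm (x, fstGradient S (x, y))) = _
      rw [← heF_apply, eF.symm_apply_apply, heG]
      rfl
    · obtain ⟨q, rfl⟩ := eF.surjective p
      have hcomp : fderiv ℝ eG q = (fderiv ℝ φ (eF q)).comp (fderiv ℝ eF q) := by
        rw [← fderiv_comp q (hφ.differentiable one_ne_zero _) (hF.differentiable one_ne_zero _)]
        congr 1
        ext1 r
        simp [φ]
      have hsurj : Function.Surjective (fderiv ℝ eF q) := by
        rw [heF]
        exact LinearMap.injective_iff_surjective
          (f := (fderiv ℝ (fun p ↦ (p.1, fstGradient S p)) q).toLinearMap) |>.mp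
          (injective_fderiv_prodMk_fstGradient hS q (hbij q).1)
      obtain ⟨a, rfl⟩ := hsurj u
      obtain ⟨b, rfl⟩ := hsurj v
      have h := stdSymplForm_fderiv_sndGradient_prodMk hS q a b
      rw [← heF, ← heG, hcomp] at h
      exact h
end

section
/- Let n ≥ 1 and k ≥ 1 be integers. Let U ⊂ ℝⁿ be a bounded connected open set whose boundary ∂U is connected and is a C^∞ (smooth) embedded (n−1)-dimensional submanifold of ℝⁿ. Let f, g : ℝⁿ → ℝ be C^k functions with f(x) > 0 and g(x) > 0 for all x. Set λ = (∫_U f dx)/(∫_U g dx). Then there exists a C^k diffeomorphism φ : ℝⁿ → ℝⁿ such that det(Dφ(x)) · f(φ(x)) = λ · g(x) for all x in some open neighborhood of the closure of U, and φ(x) = x for every x ∈ ∂U. -/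
open Set MeasureTheory

/-- A set `M ⊆ ℝⁿ` is a `C^∞` embedded hypersurface if near each of its points it is the
zero set of a smooth function with nonvanishing derivative. -/
def IsSmoothHypersurface {n : ℕ} (M : Set (Fin n → ℝ)) : Prop :=
  ∀ x ∈ M, ∃ V : Set (Fin n → ℝ), IsOpen V ∧ x ∈ V ∧
    ∃ F : (Fin n → ℝ) → ℝ, ContDiff ℝ (⊤ : ℕ∞) F ∧ (∀ y ∈ V, fderiv ℝ F y ≠ 0) ∧
      M ∩ V = {y ∈ V | F y = 0}

open Filter Function Topology

/-- The integral over `[0, 1]` of a `C^k` family is a `C^k` function of the parameter. -/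
theorem contDiff_integral_zero_one {E : Type} [NormedAddCommGroup E] [NormedSpace ℝ E]
    [FiniteDimensional ℝ E] (k : ℕ) :
    ∀ {F : Type} [NormedAddCommGroup F] [NormedSpace ℝ F] [CompleteSpace F] {G : E → ℝ → F},
      ContDiff ℝ k (uncurry G) → ContDiff ℝ k fun x => ∫ s in (0 : ℝ)..1, G x s := by
  induction k with
  | zero =>
    intro F _ _ _ G hG
    have hG' : Continuous (uncurry G) := hG.continuous
    exact contDiff_zero.2
      (intervalIntegral.continuous_parametric_intervalIntegral_of_continuous' hG' 0 1)
  | succ k ih =>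
    intro F _ _ _ G hG
    have hG1 : Continuous (uncurry G) := hG.continuous
    have hdiff : Differentiable ℝ (uncurry G) := hG.differentiable (by simp)
    set G' : E → ℝ → (E →L[ℝ] F) := fun x s =>
      (fderiv ℝ (uncurry G) (x, s)).comp (ContinuousLinearMap.inl ℝ E ℝ) with hG'
    have hG'c : ContDiff ℝ k (uncurry G') := by
      have h1 : ContDiff ℝ k (fderiv ℝ (uncurry G)) := hG.fderiv_right (by norm_cast)
      exact h1.clm_comp contDiff_const
    have hder : ∀ x s, HasFDerivAt (fun x => G x s) (G' x s) x := fun x s =>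
      HasFDerivAt.comp (f := fun y : E => (y, s)) (g := uncurry G) x
        (hdiff (x, s)).hasFDerivAt (hasFDerivAt_prodMk_left x s)
    push_cast
    rw [contDiff_succ_iff_hasFDerivAt]
    refine ⟨_, ih hG'c, fun x => ?_⟩
    obtain ⟨C, hC⟩ := ((isCompact_closedBall x 1).prod
      (isCompact_Icc (a := (0 : ℝ)) (b := 1))).exists_bound_of_continuousOn
        hG'c.continuous.continuousOn
    refine intervalIntegral.hasFDerivAt_integral_of_dominated_of_fderiv_le (bound := fun _ => C)
      (Metric.closedBall_mem_nhds x one_pos) (Eventually.of_forall fun y => ?_) ?_ ?_ ?_ ?_ ?_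
    · exact (hG1.comp (Continuous.prodMk_right y)).aestronglyMeasurable
    · exact (hG1.comp (Continuous.prodMk_right x)).intervalIntegrable 0 1
    · exact (hG'c.continuous.comp (Continuous.prodMk_right x)).aestronglyMeasurable
    · refine Eventually.of_forall fun t ht y hy => hC (y, t) ⟨hy, ?_⟩
      rw [uIoc_of_le zero_le_one] at ht
      exact ⟨ht.1.le, ht.2⟩
    · exact intervalIntegrable_const
    · exact Eventually.of_forall fun t _ y _ => hder y t

section Coordinates

variable {n : ℕ}

/-- The partial derivative of `v` in the direction of the `i`-th coordinate is `D`. -/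
def HasPartialDeriv (i : Fin n) (v D : (Fin n → ℝ) → ℝ) : Prop :=
  ∀ x, HasDerivAt (fun t => v (update x i t)) (D x) (x i)

theorem HasPartialDeriv.hasDerivAt_line {i : Fin n} {v D : (Fin n → ℝ) → ℝ}
    (h : HasPartialDeriv i v D) (x : Fin n → ℝ) (t : ℝ) :
    HasDerivAt (fun t => v (update x i t)) (D (update x i t)) t := by
  simpa using h (update x i t)

theorem HasPartialDeriv.add {i : Fin n} {v w D E : (Fin n → ℝ) → ℝ}
    (h : HasPartialDeriv i v D) (h' : HasPartialDeriv i w E) :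
    HasPartialDeriv i (v + w) (D + E) := fun x => (h x).add (h' x)

theorem HasPartialDeriv.const_smul {i : Fin n} {v D : (Fin n → ℝ) → ℝ}
    (h : HasPartialDeriv i v D) (c : ℝ) : HasPartialDeriv i (c • v) (c • D) :=
  fun x => (h x).const_mul c

theorem HasPartialDeriv.eq_fderiv {i : Fin n} {v D : (Fin n → ℝ) → ℝ}
    (h : HasPartialDeriv i v D) (hv : Differentiable ℝ v) (x : Fin n → ℝ) :
    D x = fderiv ℝ v x (Pi.single i 1) := by
  have h1 := (hv (update x i (x i))).hasFDerivAt.comp_hasDerivAt (x i)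
    (hasDerivAt_update x i (x i))
  rw [update_eq_self] at h1
  exact (h x).unique h1

theorem Differentiable.hasPartialDeriv {v : (Fin n → ℝ) → ℝ} (hv : Differentiable ℝ v)
    (i : Fin n) : HasPartialDeriv i v fun x => fderiv ℝ v x (Pi.single i 1) := fun x => by
  have h1 := (hv (update x i (x i))).hasFDerivAt.comp_hasDerivAt (x i)
    (hasDerivAt_update x i (x i))
  rw [update_eq_self] at h1
  exact h1

theorem contDiff_update_comp {m : WithTop ℕ∞} {E : Type*} [NormedAddCommGroup E] [NormedSpace ℝ E]
    {p : E → Fin n → ℝ} {t : E → ℝ} (i : Fin n) (hp : ContDiff ℝ m p) (ht : ContDiff ℝ m t) :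
    ContDiff ℝ m fun y => update (p y) i (t y) := by
  rw [contDiff_pi]
  intro j
  rcases eq_or_ne j i with rfl | hj
  · simpa using ht
  · simpa [hj] using (contDiff_pi.1 hp) j

/-- The primitive of `H` along the `i`-th coordinate, based at the hyperplane `x i = a`. -/
noncomputable def primitive (i : Fin n) (a : ℝ) (H : (Fin n → ℝ) → ℝ) (x : Fin n → ℝ) : ℝ :=
  ∫ s in a..x i, H (update x i s)

theorem contDiff_primitive {k : ℕ} (i : Fin n) (a : ℝ) {H : (Fin n → ℝ) → ℝ}
    (hH : ContDiff ℝ k H) : ContDiff ℝ k (primitive i a H) := by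
  have heq : primitive i a H =
      fun x => ∫ s in (0 : ℝ)..1, (x i - a) * H (update x i (a + (x i - a) * s)) := by
    funext x
    rw [intervalIntegral.integral_const_mul, ← smul_eq_mul,
      intervalIntegral.smul_integral_comp_add_mul (fun s => H (update x i s))]
    simp [primitive]
  rw [heq]
  refine contDiff_integral_zero_one k ?_
  have hi : ContDiff ℝ k fun p : (Fin n → ℝ) × ℝ => p.1 i :=
    (contDiff_apply ℝ ℝ i).comp contDiff_fst
  refine (hi.sub contDiff_const).mul (hH.comp (contDiff_update_comp i contDiff_fst ?_))
  exact contDiff_const.add ((hi.sub contDiff_const).mul contDiff_snd)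

theorem primitive_update (i : Fin n) (a : ℝ) (H : (Fin n → ℝ) → ℝ) (x : Fin n → ℝ) (t : ℝ) :
    primitive i a H (update x i t) = ∫ s in a..t, H (update x i s) := by
  simp [primitive]

theorem continuous_line {H : (Fin n → ℝ) → ℝ} (hH : Continuous H) (i : Fin n) (x : Fin n → ℝ) :
    Continuous fun s => H (update x i s) :=
  hH.comp (continuous_const.update i continuous_id)

theorem hasPartialDeriv_primitive (i : Fin n) (a : ℝ) {H : (Fin n → ℝ) → ℝ}
    (hH : Continuous H) : HasPartialDeriv i (primitive i a H) H := by
  intro x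
  simp only [primitive_update]
  have hc := continuous_line hH i x
  have := intervalIntegral.integral_hasDerivAt_right (hc.intervalIntegrable a (x i))
    (hc.stronglyMeasurableAtFilter _ _) hc.continuousAt
  simpa using this

/-- The derivative of `x ↦ update x i (F x)` when `F` has derivative `L`. -/
noncomputable def updateCLM (i : Fin n) (L : (Fin n → ℝ) →L[ℝ] ℝ) :
    (Fin n → ℝ) →L[ℝ] (Fin n → ℝ) :=
  ContinuousLinearMap.pi fun j => if j = i then L else ContinuousLinearMap.proj j

theorem hasFDerivAt_update_self {i : Fin n} {F : (Fin n → ℝ) → ℝ} {L : (Fin n → ℝ) →L[ℝ] ℝ}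
    {x : Fin n → ℝ} (h : HasFDerivAt F L x) :
    HasFDerivAt (fun y => update y i (F y)) (updateCLM i L) x := by
  refine hasFDerivAt_pi.2 fun j => ?_
  rcases eq_or_ne j i with rfl | hj
  · simpa using h
  · simpa [hj] using hasFDerivAt_apply j x

theorem det_updateCLM (i : Fin n) (L : (Fin n → ℝ) →L[ℝ] ℝ) :
    LinearMap.det (updateCLM i L).toLinearMap = L (Pi.single i 1) := by
  have h : LinearMap.toMatrix' (updateCLM i L).toLinearMap =
      (Matrix.updateCol (1 : Matrix (Fin n) (Fin n) ℝ) i fun j => L (Pi.single j 1)).transpose := by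
    ext a b
    rcases eq_or_ne a i with rfl | ha
    · simp [updateCLM, LinearMap.toMatrix'_apply]
    · simp [updateCLM, LinearMap.toMatrix'_apply, ha, Matrix.one_apply, Pi.single_apply, eq_comm (a := a)]
  rw [← LinearMap.det_toMatrix', h, Matrix.det_transpose, ← Matrix.cramer_apply, Matrix.cramer_one]
  rfl

/-- A function with partial derivative bounded below by a positive constant gives a diffeomorphism
of `ℝⁿ` which only moves the `i`-th coordinate. -/
theorem exists_homeomorph_update {k : ℕ} (hk : 1 ≤ k) {i : Fin n} {F f : (Fin n → ℝ) → ℝ}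
    (hF : ContDiff ℝ k F) (hFf : HasPartialDeriv i F f) {c : ℝ} (hc : 0 < c)
    (hf : ∀ x, c ≤ f x) :
    ∃ Φ : (Fin n → ℝ) ≃ₜ (Fin n → ℝ), (∀ x, Φ x = update x i (F x)) ∧ ContDiff ℝ k Φ.symm := by
  have hk0 : (k : WithTop ℕ∞) ≠ 0 := by norm_cast; omega
  have hmono : ∀ x, StrictMono fun t => F (update x i t) := fun x =>
    strictMono_of_deriv_pos fun t => by
      rw [(hFf.hasDerivAt_line x t).deriv]; exact hc.trans_le (hf _)
  have hmono' : ∀ x, Monotone fun t => F (update x i t) - c * t := fun x => by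
    have h : ∀ t, HasDerivAt (fun t => F (update x i t) - c * t) (f (update x i t) - c * 1) t :=
      fun t => (hFf.hasDerivAt_line x t).sub ((hasDerivAt_id t).const_mul c)
    refine monotone_of_deriv_nonneg (fun t => (h t).differentiableAt) fun t => ?_
    rw [(h t).deriv]
    linarith [hf (update x i t)]
  have hinj : Injective fun x => update x i (F x) := by
    intro x y hxy
    have hj : ∀ j, j ≠ i → y j = x j := fun j hj => by
      have := congrFun hxy j
      simpa [hj] using this.symm
    have hyx : y = update x i (y i) := by
      ext j
      rcases eq_or_ne j i with rfl | h
      · simp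
      · simp [h, hj j h]
    have h1 : F (update x i (x i)) = F (update x i (y i)) := by
      rw [← hyx, update_eq_self]
      simpa using congrFun hxy i
    rw [hyx, ← (hmono x).injective h1, update_eq_self]
  have hsurj : Surjective fun x => update x i (F x) := by
    intro y
    obtain ⟨t, ht⟩ : ∃ t, F (update y i t) = y i := by
      refine Continuous.surjective (f := fun t => F (update y i t))
        (continuous_line hF.continuous i y) ?_ ?_ (y i)
      · refine tendsto_atTop_mono' atTop (f₁ := fun t => F (update y i 0) + c * t) ?_
          (tendsto_atTop_add_const_left _ _ (tendsto_id.const_mul_atTop hc))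
        filter_upwards [eventually_ge_atTop 0] with t ht
        have := hmono' y ht
        simp only [mul_zero, sub_zero] at this
        linarith
      · refine tendsto_atBot_mono' atBot (f₁ := fun t => F (update y i 0) + c * t) ?_
          (tendsto_atBot_add_const_left _ _ (tendsto_id.const_mul_atBot hc))
        filter_upwards [eventually_le_atBot 0] with t ht
        have := hmono' y ht
        simp only [mul_zero, sub_zero] at this
        linarith
    exact ⟨update y i t, by simp [ht]⟩
  have hcd : ContDiff ℝ k fun x => update x i (F x) := contDiff_update_comp i contDiff_id hF
  have hdet : ∀ x, (updateCLM i (fderiv ℝ F x)).det ≠ 0 := fun x => by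
    have h := det_updateCLM i (fderiv ℝ F x)
    rw [← hFf.eq_fderiv (hF.differentiable hk0)] at h
    exact h.trans_ne (hc.trans_le (hf x)).ne'
  have hder : ∀ x, HasFDerivAt (fun x => update x i (F x)) (updateCLM i (fderiv ℝ F x)) x :=
    fun x => hasFDerivAt_update_self (hF.differentiable hk0 x).hasFDerivAt
  have hder' : ∀ x, HasFDerivAt (fun x => update x i (F x))
      ((ContinuousLinearMap.toContinuousLinearEquivOfDetNeZero _ (hdet x) :
        (Fin n → ℝ) ≃L[ℝ] (Fin n → ℝ)) : (Fin n → ℝ) →L[ℝ] (Fin n → ℝ)) x := fun x => by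
    rw [ContinuousLinearMap.coe_toContinuousLinearEquivOfDetNeZero]; exact hder x
  have hopen : IsOpenMap fun x => update x i (F x) :=
    isOpenMap_of_hasStrictFDerivAt_equiv fun x =>
      hcd.contDiffAt.hasStrictFDerivAt' (hder' x) hk0
  let Φ : (Fin n → ℝ) ≃ₜ (Fin n → ℝ) :=
    (Equiv.ofBijective _ ⟨hinj, hsurj⟩).toHomeomorphOfContinuousOpen hcd.continuous hopen
  exact ⟨Φ, fun x => rfl, Φ.contDiff_symm hder' hcd⟩

end Coordinates

section DensityEquiv

variable {n k : ℕ} {U : Set (Fin n → ℝ)}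

theorem eq_update_of_update_eq {i : Fin n} {x y : Fin n → ℝ} {a b : ℝ}
    (h : update y i a = update x i b) : y = update x i (y i) ∧ a = b := by
  refine ⟨funext fun j => ?_, by simpa using congrFun h i⟩
  rcases eq_or_ne j i with rfl | hj
  · simp
  · simpa [hj] using congrFun h j

/-- The densities `f` and `g` correspond to each other under a `C^k` diffeomorphism of `ℝⁿ` which
fixes the boundary of `U` pointwise and preserves `U`. -/
def DensityEquiv (k : ℕ) (U : Set (Fin n → ℝ)) (f g : (Fin n → ℝ) → ℝ) : Prop :=
  ∃ φ ψ : (Fin n → ℝ) → (Fin n → ℝ), ContDiff ℝ k φ ∧ ContDiff ℝ k ψ ∧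
    LeftInverse ψ φ ∧ RightInverse ψ φ ∧
    (∀ x, LinearMap.det (fderiv ℝ φ x).toLinearMap * f (φ x) = g x) ∧
    (∀ x ∈ frontier U, φ x = x) ∧ MapsTo φ U U ∧ MapsTo ψ U U

theorem DensityEquiv.refl (f : (Fin n → ℝ) → ℝ) : DensityEquiv k U f f :=
  ⟨id, id, contDiff_id, contDiff_id, fun _ => rfl, fun _ => rfl, by simp, by simp,
    mapsTo_id _, mapsTo_id _⟩

theorem DensityEquiv.trans (hk : 1 ≤ k) {f g h : (Fin n → ℝ) → ℝ} (hfg : DensityEquiv k U f g)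
    (hgh : DensityEquiv k U g h) : DensityEquiv k U f h := by
  have hk0 : (k : WithTop ℕ∞) ≠ 0 := by norm_cast; omega
  obtain ⟨φ, ψ, hφ, hψ, hl, hr, hd, hfix, hU, hU'⟩ := hfg
  obtain ⟨φ', ψ', hφ', hψ', hl', hr', hd', hfix', hV, hV'⟩ := hgh
  refine ⟨φ ∘ φ', ψ' ∘ ψ, hφ.comp hφ', hψ'.comp hψ, hl.comp hl', hr.comp hr', fun x => ?_,
    fun x hx => by simp [hfix' x hx, hfix x hx], hU.comp hV, hV'.comp hU'⟩
  rw [fderiv_comp x (hφ.differentiable hk0 _) (hφ'.differentiable hk0 _),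
    ContinuousLinearMap.toLinearMap_comp, LinearMap.det_comp, ← hd' x, ← hd (φ' x)]
  simp only [comp_apply]
  ring

theorem DensityEquiv.setIntegral_eq (hk : 1 ≤ k) (hU : IsOpen U) {f g : (Fin n → ℝ) → ℝ}
    (h : DensityEquiv k U f g) (hf : ∀ x, 0 < f x) (hg : ∀ x, 0 < g x) :
    ∫ x in U, f x = ∫ x in U, g x := by
  have hk0 : (k : WithTop ℕ∞) ≠ 0 := by norm_cast; omega
  obtain ⟨φ, ψ, hφ, hψ, hl, hr, hd, hfix, hm, hm'⟩ := h
  have himg : φ '' U = U :=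
    hm.image_subset.antisymm fun x hx => ⟨ψ x, hm' hx, hr x⟩
  have := integral_image_eq_integral_abs_det_fderiv_smul volume hU.measurableSet
    (fun x _ => (hφ.differentiable hk0 x).hasFDerivAt.hasFDerivWithinAt) hl.injective.injOn f
  rw [himg] at this
  rw [this]
  congr 1 with x
  have hpos : 0 < (fderiv ℝ φ x).det :=
    pos_of_mul_pos_left ((hg x).trans_eq (hd x).symm) (hf _).le
  rw [abs_of_pos hpos, smul_eq_mul]
  exact hd x

theorem update_mem_of_strictMono_of_eqOn_frontier (hU : IsOpen U) {i : Fin n}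
    {F G : (Fin n → ℝ) → ℝ} (hF : ∀ x, StrictMono fun t => F (update x i t))
    (hG : ∀ x, StrictMono fun t => G (update x i t)) (hFG : ∀ x ∈ frontier U, F x = G x)
    {x : Fin n → ℝ} (hx : x ∈ U) {s : ℝ} (hs : F (update x i s) = G x) : update x i s ∈ U := by
  have hseg : IsPreconnected (update x i '' uIcc (x i) s) :=
    isPreconnected_uIcc.image _ (contDiff_update (𝕜 := ℝ) 0 x i).continuous.continuousOn
  refine hseg.subset_of_closure_inter_subset hU
    ⟨x, ⟨x i, left_mem_uIcc, update_eq_self i x⟩, hx⟩ ?_ (mem_image_of_mem _ right_mem_uIcc)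
  rintro _ ⟨hyU, t, ht, rfl⟩
  by_contra hy
  have hfr : update x i t ∈ frontier U := by rw [hU.frontier_eq]; exact ⟨hyU, hy⟩
  have hGx : G (update x i (x i)) = F (update x i s) := by rw [update_eq_self, hs]
  have hFt := hFG _ hfr
  suffices h : x i = t by
    rw [← h, update_eq_self] at hy
    exact hy hx
  rcases mem_uIcc.1 ht with ⟨h1, h2⟩ | ⟨h1, h2⟩
  · have h3 := (hF x).monotone h2
    exact le_antisymm h1 ((hG x).le_iff_le.1 (by linarith))
  · have h3 := (hF x).monotone h1
    exact le_antisymm ((hG x).le_iff_le.1 (by linarith)) h2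

theorem densityEquiv_of_hasPartialDeriv (hk : 1 ≤ k) (hU : IsOpen U) {i : Fin n}
    {v D f : (Fin n → ℝ) → ℝ} (hv : ContDiff ℝ k v) (hf : ContDiff ℝ k f)
    (hvD : HasPartialDeriv i v D) (hv0 : ∀ x ∈ frontier U, v x = 0) {c : ℝ} (hc : 0 < c)
    (hfc : ∀ x, c ≤ f x) (hfDc : ∀ x, c ≤ (f + D) x) : DensityEquiv k U f (f + D) := by
  have hk0 : (k : WithTop ℕ∞) ≠ 0 := by norm_cast; omega
  set F := primitive i 0 f with hF_def
  have hF : ContDiff ℝ k F := contDiff_primitive i 0 hf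
  have hFf : HasPartialDeriv i F f := hasPartialDeriv_primitive i 0 hf.continuous
  have hG : ContDiff ℝ k (F + v) := hF.add hv
  have hGf : HasPartialDeriv i (F + v) (f + D) := hFf.add hvD
  have hmono : ∀ {H h : (Fin n → ℝ) → ℝ}, HasPartialDeriv i H h → (∀ x, c ≤ h x) →
      ∀ x, StrictMono fun t => H (update x i t) := fun hH hh x =>
    strictMono_of_deriv_pos fun t => by
      rw [(hH.hasDerivAt_line x t).deriv]; exact hc.trans_le (hh _)
  have hFm := hmono hFf hfc
  have hGm := hmono hGf hfDc
  have hFG : ∀ x ∈ frontier U, F x = (F + v) x := fun x hx => by simp [hv0 x hx]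
  obtain ⟨Φ, hΦ, hΦs⟩ := exists_homeomorph_update hk hF hFf hc hfc
  obtain ⟨Ψ, hΨ, hΨs⟩ := exists_homeomorph_update hk hG hGf hc hfDc
  have hΦc : ContDiff ℝ k Φ := by
    rw [show (Φ : (Fin n → ℝ) → (Fin n → ℝ)) = _ from funext hΦ]
    exact contDiff_update_comp i contDiff_id hF
  have hΨc : ContDiff ℝ k Ψ := by
    rw [show (Ψ : (Fin n → ℝ) → (Fin n → ℝ)) = _ from funext hΨ]
    exact contDiff_update_comp i contDiff_id hG
  have hφ : ContDiff ℝ k fun x => Φ.symm (Ψ x) := hΦs.comp hΨc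
  have hdet : ∀ {H h : (Fin n → ℝ) → ℝ} {Θ : (Fin n → ℝ) ≃ₜ (Fin n → ℝ)}, ContDiff ℝ k H →
      HasPartialDeriv i H h → (∀ x, Θ x = update x i (H x)) →
      ∀ x, LinearMap.det (fderiv ℝ Θ x).toLinearMap = h x := fun hH hh hΘ x => by
    rw [show (_ : (Fin n → ℝ) → (Fin n → ℝ)) = _ from funext hΘ,
      (hasFDerivAt_update_self (hH.differentiable hk0 x).hasFDerivAt).fderiv, det_updateCLM,
      hh.eq_fderiv (hH.differentiable hk0)]
  have hmem : ∀ {H H' : (Fin n → ℝ) → ℝ} {Θ Θ' : (Fin n → ℝ) ≃ₜ (Fin n → ℝ)},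
      (∀ x, Θ x = update x i (H x)) → (∀ x, Θ' x = update x i (H' x)) →
      (∀ x, StrictMono fun t => H (update x i t)) → (∀ x, StrictMono fun t => H' (update x i t)) →
      (∀ x ∈ frontier U, H x = H' x) → MapsTo (fun x => Θ.symm (Θ' x)) U U := by
    intro H H' Θ Θ' hΘ hΘ' hH hH' hHH' x hx
    obtain ⟨y, hy⟩ : ∃ y, y = Θ.symm (Θ' x) := ⟨_, rfl⟩
    have h1 : Θ y = Θ' x := by rw [hy, Θ.apply_symm_apply]
    rw [hΘ, hΘ'] at h1
    obtain ⟨h2, h3⟩ := eq_update_of_update_eq h1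
    simp only [← hy]
    rw [h2]
    exact update_mem_of_strictMono_of_eqOn_frontier hU hH hH' hHH' hx (by rw [← h2, h3])
  refine ⟨fun x => Φ.symm (Ψ x), fun x => Ψ.symm (Φ x), hφ, hΨs.comp hΦc,
    fun x => by simp, fun x => by simp, fun x => ?_, fun x hx => ?_,
    hmem hΦ hΨ hFm hGm hFG, hmem hΨ hΦ hGm hFm fun x hx => (hFG x hx).symm⟩
  · have h1 : (Ψ : (Fin n → ℝ) → (Fin n → ℝ)) = Φ ∘ fun x => Φ.symm (Ψ x) := by ext; simp
    have h2 := hdet hG hGf hΨ x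
    rw [h1, fderiv_comp x (hΦc.differentiable hk0 _) (hφ.differentiable hk0 _),
      ContinuousLinearMap.toLinearMap_comp, LinearMap.det_comp, hdet hF hFf hΦ] at h2
    rw [← h2, mul_comm]
  · rw [Homeomorph.symm_apply_eq, hΦ, hΨ, hFG x hx]

/-- The span of the `C^k` partial derivatives of compactly supported `C^k` functions vanishing on
the boundary of `U`. -/
def divergences (k : ℕ) (U : Set (Fin n → ℝ)) : Submodule ℝ ((Fin n → ℝ) → ℝ) :=
  Submodule.span ℝ {D | ContDiff ℝ k D ∧ ∃ i v, ContDiff ℝ k v ∧ HasCompactSupport v ∧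
    (∀ x ∈ frontier U, v x = 0) ∧ HasPartialDeriv i v D}

theorem mem_divergences {i : Fin n} {v D : (Fin n → ℝ) → ℝ} (hD : ContDiff ℝ k D)
    (hv : ContDiff ℝ k v) (hvc : HasCompactSupport v) (hv0 : ∀ x ∈ frontier U, v x = 0)
    (hvD : HasPartialDeriv i v D) : D ∈ divergences k U :=
  Submodule.subset_span ⟨hD, i, v, hv, hvc, hv0, hvD⟩

theorem contDiff_of_mem_divergences {D : (Fin n → ℝ) → ℝ} (hD : D ∈ divergences k U) :
    ContDiff ℝ k D := by
  induction hD using Submodule.span_induction with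
  | mem D h => exact h.1
  | zero => exact contDiff_const
  | add D E _ _ h h' => exact h.add h'
  | smul a D _ h => exact h.const_smul a

theorem HasPartialDeriv.hasCompactSupport {i : Fin n} {v D : (Fin n → ℝ) → ℝ}
    (h : HasPartialDeriv i v D) (hv : Differentiable ℝ v) (hvc : HasCompactSupport v) :
    HasCompactSupport D := by
  rw [funext (h.eq_fderiv hv)]
  exact hvc.fderiv_apply ℝ _

theorem hasCompactSupport_of_mem_divergences (hk : 1 ≤ k) {D : (Fin n → ℝ) → ℝ}
    (hD : D ∈ divergences k U) : HasCompactSupport D := by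
  have hk0 : (k : WithTop ℕ∞) ≠ 0 := by norm_cast; omega
  induction hD using Submodule.span_induction with
  | mem D h =>
    obtain ⟨-, i, v, hv, hvc, -, hvD⟩ := h
    exact hvD.hasCompactSupport (hv.differentiable hk0) hvc
  | zero => exact HasCompactSupport.zero
  | add D E _ _ h h' => exact h.add h'
  | smul a D _ h => exact HasCompactSupport.smul_left (f := fun _ => a) h

theorem exists_bound_of_mem_divergences (hk : 1 ≤ k) {D : (Fin n → ℝ) → ℝ}
    (hD : D ∈ divergences k U) : ∃ M, 0 < M ∧ ∀ x, |D x| ≤ M := by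
  obtain ⟨M, hM⟩ := (hasCompactSupport_of_mem_divergences hk hD).exists_bound_of_continuous
    (contDiff_of_mem_divergences hD).continuous
  exact ⟨max M 1, by positivity, fun x => (hM x).trans (le_max_left _ _)⟩

theorem densityEquiv_add_small_smul (hk : 1 ≤ k) (hU : IsOpen U) {D : (Fin n → ℝ) → ℝ}
    (hD : D ∈ divergences k U) : ∀ c > 0, ∃ ε > 0, ∀ f, ContDiff ℝ k f → (∀ x, c ≤ f x) →
      ∀ t : ℝ, |t| ≤ ε → DensityEquiv k U f (f + t • D) := by
  have key : ∀ {D : (Fin n → ℝ) → ℝ}, D ∈ divergences k U → ∀ c > 0, ∃ ε > 0, ∀ t : ℝ, |t| ≤ ε →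
      ∀ f : (Fin n → ℝ) → ℝ, (∀ x, c ≤ f x) → ∀ x, c / 2 ≤ (f + t • D) x := by
    intro D hD c hc
    obtain ⟨M, hM0, hM⟩ := exists_bound_of_mem_divergences hk hD
    refine ⟨c / 2 / M, by positivity, fun t ht f hf x => ?_⟩
    have h1 : |t * D x| ≤ c / 2 := by
      rw [abs_mul]
      calc |t| * |D x| ≤ c / 2 / M * M := by gcongr; exact hM x
        _ = c / 2 := by field_simp
    have := (abs_le.1 h1).1
    have := hf x
    simp only [Pi.add_apply, Pi.smul_apply, smul_eq_mul]
    linarith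
  induction hD using Submodule.span_induction with
  | mem D h =>
    intro c hc
    obtain ⟨ε, hε, hεD⟩ := key (Submodule.subset_span h) c hc
    obtain ⟨hD, i, v, hv, hvc, hv0, hvD⟩ := h
    refine ⟨ε, hε, fun f hf hfc t ht => ?_⟩
    exact densityEquiv_of_hasPartialDeriv hk hU (hv.const_smul t) hf (hvD.const_smul t)
      (fun x hx => by simp [hv0 x hx]) (half_pos hc) (fun x => by linarith [hfc x])
      (hεD t ht f hfc)
  | zero => exact fun c _ => ⟨1, one_pos, fun f _ _ t _ => by simpa using DensityEquiv.refl f⟩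
  | add D E hD _ h h' =>
    intro c hc
    obtain ⟨ε₀, hε₀, hεD⟩ := key hD c hc
    obtain ⟨ε₁, hε₁, h₁⟩ := h c hc
    obtain ⟨ε₂, hε₂, h₂⟩ := h' (c / 2) (half_pos hc)
    refine ⟨min ε₀ (min ε₁ ε₂), by positivity, fun f hf hfc t ht => ?_⟩
    simp only [le_min_iff] at ht
    have h3 := h₂ (f + t • D) (hf.add ((contDiff_of_mem_divergences hD).const_smul t))
      (hεD t ht.1 f hfc) t ht.2.2
    rw [smul_add, ← add_assoc]
    exact (h₁ f hf hfc t ht.2.1).trans hk h3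
  | smul a D _ h =>
    intro c hc
    obtain ⟨ε, hε, hε'⟩ := h c hc
    refine ⟨ε / (|a| + 1), by positivity, fun f hf hfc t ht => ?_⟩
    rw [smul_smul]
    refine hε' f hf hfc _ ?_
    rw [le_div_iff₀ (by positivity)] at ht
    rw [abs_mul]
    nlinarith [abs_nonneg t]

theorem densityEquiv_add (hk : 1 ≤ k) (hU : IsOpen U) {D f : (Fin n → ℝ) → ℝ}
    (hD : D ∈ divergences k U) (hf : ContDiff ℝ k f) {c : ℝ} (hc : 0 < c) (hfc : ∀ x, c ≤ f x)
    (hfDc : ∀ x, c ≤ (f + D) x) : DensityEquiv k U f (f + D) := by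
  obtain ⟨ε, hε, h⟩ := densityEquiv_add_small_smul hk hU hD c hc
  obtain ⟨N, hN⟩ := exists_nat_gt (1 / ε)
  have hN0 : (0 : ℝ) < N := (by positivity : 0 < 1 / ε).trans hN
  have hstep : ∀ m : ℕ, m ≤ N → DensityEquiv k U f (f + ((m : ℝ) / N) • D) := by
    intro m
    induction m with
    | zero => intro _; simpa using DensityEquiv.refl f
    | succ m ih =>
      intro hm
      have h1 := h (f + ((m : ℝ) / N) • D)
        (hf.add ((contDiff_of_mem_divergences hD).const_smul ((m : ℝ) / N))) (fun x => ?_) (1 / N) ?_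
      · rw [add_assoc, ← add_smul, ← add_div] at h1
        exact_mod_cast (ih (by omega)).trans hk h1
      · have h2 := hfc x
        have h3 := hfDc x
        have h4 : (m : ℝ) / N ≤ 1 := by
          rw [div_le_one hN0]; exact_mod_cast (by omega : m ≤ N)
        have h5 : 0 ≤ (m : ℝ) / N := by positivity
        simp only [Pi.add_apply, Pi.smul_apply, smul_eq_mul] at h3 ⊢
        nlinarith
      · rw [abs_of_pos (by positivity), div_le_iff₀ hN0]
        rw [div_lt_iff₀ hε] at hN
        linarith
  have := hstep N le_rfl
  rwa [div_self hN0.ne', one_smul] at this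

theorem setIntegral_eq_zero_of_mem_divergences (hk : 1 ≤ k) (hU : IsOpen U)
    (hUb : Bornology.IsBounded U) {D : (Fin n → ℝ) → ℝ} (hD : D ∈ divergences k U) :
    ∫ x in U, D x = 0 := by
  obtain ⟨M, hM0, hM⟩ := exists_bound_of_mem_divergences hk hD
  have h1 : ∀ x, 1 ≤ ((fun _ => M + 1 : (Fin n → ℝ) → ℝ) + D) x := fun x => by
    have := (abs_le.1 (hM x)).1
    simp only [Pi.add_apply]
    linarith
  have h := (densityEquiv_add hk hU hD contDiff_const one_pos (fun x => by linarith)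
    h1).setIntegral_eq hk hU (fun x => by linarith) (fun x => one_pos.trans_le (h1 x))
  have hDi : Integrable D := (contDiff_of_mem_divergences hD).continuous.integrable_of_hasCompactSupport
    (hasCompactSupport_of_mem_divergences hk hD)
  have hci : IntegrableOn (fun _ => M + 1 : (Fin n → ℝ) → ℝ) U :=
    integrableOn_const hUb.measure_lt_top.ne
  simp only [Pi.add_apply] at h
  rw [integral_add hci hDi.integrableOn] at h
  linarith

end DensityEquiv

section Local

variable {n k : ℕ} {U : Set (Fin n → ℝ)}

/-- Every `C^k` function with compact support in `N` belongs to `W`. -/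
def ContainsSupportedIn (k : ℕ) (W : Submodule ℝ ((Fin n → ℝ) → ℝ)) (N : Set (Fin n → ℝ)) : Prop :=
  ∀ H, ContDiff ℝ k H → HasCompactSupport H → tsupport H ⊆ N → H ∈ W

theorem containsSupportedIn_of_locally {W : Submodule ℝ ((Fin n → ℝ) → ℝ)} {K : Set (Fin n → ℝ)}
    (hK : IsCompact K) (h : ∀ p ∈ K, ∃ N, IsOpen N ∧ p ∈ N ∧ ContainsSupportedIn k W N) :
    ContainsSupportedIn k W K := by
  intro H hH hHc hHK
  choose! N hNo hpN hN using h
  obtain ⟨t, ht⟩ := hK.elim_finite_subcover (fun p : K => N p) (fun p => hNo p p.2)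
    fun p hp => mem_iUnion.2 ⟨⟨p, hp⟩, hpN p hp⟩
  obtain ⟨f, hf⟩ := SmoothPartitionOfUnity.exists_isSubordinate
    (modelWithCornersSelf ℝ (Fin n → ℝ)) hK.isClosed (fun p : t => N p.1) (fun p => hNo _ p.1.2)
    (fun x hx => by simpa using ht hx)
  have hsum : H = ∑ p : t, fun x => f p x * H x := by
    funext x
    rw [Finset.sum_apply, ← Finset.sum_mul]
    by_cases hx : x ∈ K
    · rw [← finsum_eq_sum_of_fintype, f.sum_eq_one hx, one_mul]
    · rw [image_eq_zero_of_notMem_tsupport fun h => hx (hHK h), mul_zero]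
  rw [hsum]
  refine W.sum_mem fun p _ => hN p.1 p.1.2 _ ?_ ?_ ?_
  · exact ((f p).contMDiff.contDiff.of_le (by exact_mod_cast le_top)).mul hH
  · exact hHc.mul_left (f := f p)
  · exact tsupport_mul_subset_left.trans (hf p)

/-- The integral of `H` over the segment `a ≤ x i ≤ b` of the line through `x` in direction `i`. -/
noncomputable def lineIntegral (i : Fin n) (a b : ℝ) (H : (Fin n → ℝ) → ℝ) (x : Fin n → ℝ) : ℝ :=
  ∫ s in a..b, H (update x i s)

theorem contDiff_lineIntegral (i : Fin n) (a b : ℝ) {H : (Fin n → ℝ) → ℝ} (hH : ContDiff ℝ k H) :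
    ContDiff ℝ k (lineIntegral i a b H) := by
  have : lineIntegral i a b H = fun x => primitive i a H (update x i b) := by
    funext x; rw [primitive_update]; rfl
  rw [this]
  exact (contDiff_primitive i a hH).comp (contDiff_update_comp i contDiff_id contDiff_const)

theorem abs_sub_le_of_update_ne_zero {H : (Fin n → ℝ) → ℝ} {p x : Fin n → ℝ} {r : ℝ} {i : Fin n}
    {s : ℝ} (hH : support H ⊆ Metric.closedBall p r) (h : H (update x i s) ≠ 0) :
    |s - p i| ≤ r ∧ ∀ j ≠ i, |x j - p j| ≤ r := by
  have h1 := hH h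
  have h2 : ∀ j, |update x i s j - p j| ≤ r := fun j =>
    (dist_le_pi_dist (update x i s) p j).trans h1
  exact ⟨by simpa using h2 i, fun j hj => by simpa [hj] using h2 j⟩

theorem exists_update_ne_zero_of_integral_ne_zero {H : (Fin n → ℝ) → ℝ} {x : Fin n → ℝ} {i : Fin n}
    {a b : ℝ} (h : ∫ s in a..b, H (update x i s) ≠ 0) : ∃ s ∈ uIcc a b, H (update x i s) ≠ 0 := by
  by_contra! h'
  exact h (intervalIntegral.integral_zero_ae (Eventually.of_forall fun s hs =>
    h' s (uIoc_subset_uIcc hs)))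

theorem support_mul_lineIntegral_subset {p : Fin n → ℝ} {r : ℝ} (hr : 0 ≤ r) {i : Fin n}
    {ρ : ℝ → ℝ} (hρ : support ρ ⊆ Metric.closedBall (p i) r) {H : (Fin n → ℝ) → ℝ}
    (hH : support H ⊆ Metric.closedBall p r) (a b : ℝ) :
    support (fun x => ρ (x i) * lineIntegral i a b H x) ⊆ Metric.closedBall p r := by
  intro x hx
  rw [mem_support, mul_ne_zero_iff] at hx
  obtain ⟨s, -, hs⟩ := exists_update_ne_zero_of_integral_ne_zero hx.2
  rw [Metric.mem_closedBall, dist_pi_le_iff hr]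
  intro j
  rcases eq_or_ne j i with rfl | hj
  · exact hρ hx.1
  · exact (abs_sub_le_of_update_ne_zero hH hs).2 j hj

/-- Replacing a function by its average along a coordinate direction, spread out with a bump
function, does not change its class modulo divergences. -/
theorem sub_mul_lineIntegral_mem_divergences {p : Fin n → ℝ} {r r' : ℝ} (hr' : 0 ≤ r') (hr : r' < r)
    (hU : Disjoint (Metric.ball p r) (frontier U)) {i : Fin n} {ρ : ℝ → ℝ} (hρ : ContDiff ℝ k ρ)
    (hρs : support ρ ⊆ Metric.closedBall (p i) r') (hρ1 : ∫ t in (p i - r)..(p i + r), ρ t = 1)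
    {H : (Fin n → ℝ) → ℝ} (hH : ContDiff ℝ k H) (hHs : support H ⊆ Metric.closedBall p r') :
    (H - fun x => ρ (x i) * lineIntegral i (p i - r) (p i + r) H x) ∈ divergences k U := by
  set A := lineIntegral i (p i - r) (p i + r) H with hA
  have hAu : ∀ x s, A (update x i s) = A x := fun x s => by simp [hA, lineIntegral]
  set D := H - fun x => ρ (x i) * A x with hD
  have hDs : support D ⊆ Metric.closedBall p r' :=
    (support_sub _ _).trans
      (union_subset hHs (support_mul_lineIntegral_subset hr' hρs hHs _ _))
  have hDc : ContDiff ℝ k D := hH.sub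
    ((hρ.comp (contDiff_apply ℝ ℝ i)).mul (contDiff_lineIntegral i _ _ hH))
  have hzero : ∀ x a b, (∀ s ∈ uIcc a b, r' < |s - p i|) → ∫ s in a..b, D (update x i s) = 0 := by
    intro x a b h
    by_contra h0
    obtain ⟨s, hs, hs0⟩ := exists_update_ne_zero_of_integral_ne_zero h0
    exact (h s hs).not_ge (abs_sub_le_of_update_ne_zero hDs hs0).1
  have hcont : ∀ x, Continuous fun s => D (update x i s) := continuous_line hDc.continuous i
  have htotal : ∀ x, ∫ s in (p i - r)..(p i + r), D (update x i s) = 0 := by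
    intro x
    have h1 : ∀ s, D (update x i s) = H (update x i s) - ρ s * A x := fun s => by
      simp [hD, hAu]
    have h2 : Continuous fun s => ρ s * A x := hρ.continuous.mul continuous_const
    simp only [h1]
    rw [intervalIntegral.integral_sub
      ((continuous_line hH.continuous i x).intervalIntegrable _ _) (h2.intervalIntegrable _ _),
      intervalIntegral.integral_mul_const, hρ1, one_mul]
    exact sub_self _
  have hvs : support (primitive i (p i - r) D) ⊆ Metric.closedBall p r' := by
    intro x hx
    have hx' : ∫ s in (p i - r)..x i, D (update x i s) ≠ 0 := hx
    obtain ⟨s, -, hs⟩ := exists_update_ne_zero_of_integral_ne_zero hx'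
    rw [Metric.mem_closedBall, dist_pi_le_iff hr']
    intro j
    rcases eq_or_ne j i with rfl | hj
    · rw [Real.dist_eq]
      by_contra! hlt
      rcases lt_abs.1 hlt with hlt | hlt
      · refine hx' ?_
        rw [← intervalIntegral.integral_add_adjacent_intervals
          ((hcont x).intervalIntegrable _ (p j + r)) ((hcont x).intervalIntegrable _ _),
          htotal, zero_add]
        refine hzero x _ _ fun s hs => lt_abs.2 (Or.inl ?_)
        rcases mem_uIcc.1 hs with h | h <;> linarith [h.1, h.2]
      · refine hx' (hzero x _ _ fun s hs => lt_abs.2 (Or.inr ?_))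
        rcases mem_uIcc.1 hs with h | h <;> linarith [h.1, h.2]
    · exact (abs_sub_le_of_update_ne_zero hDs hs).2 j hj
  refine mem_divergences hDc (contDiff_primitive i (p i - r) hDc)
    (HasCompactSupport.of_support_subset_isCompact (isCompact_closedBall p r') hvs)
    (fun x hx => ?_) (hasPartialDeriv_primitive i _ hDc.continuous)
  by_contra h
  exact disjoint_left.1 hU (Metric.closedBall_subset_ball hr (hvs h)) hx

/-- On a box disjoint from the boundary, all compactly supported functions are multiples of a single
bump function modulo divergences. -/
theorem exists_bump_containsSupportedIn_ball (k : ℕ) {p : Fin n → ℝ} {r : ℝ} (hr : 0 < r)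
    (hU : Disjoint (Metric.ball p r) (frontier U)) :
    ∃ b : (Fin n → ℝ) → ℝ, ContDiff ℝ k b ∧ HasCompactSupport b ∧ tsupport b ⊆ Metric.ball p r ∧
      0 < ∫ x, b x ∧
      ContainsSupportedIn k (divergences k U ⊔ Submodule.span ℝ {b}) (Metric.ball p r) := by
  let β : ∀ i, ContDiffBump (p i) := fun i => ⟨r / 4, r / 2, by positivity, by linarith⟩
  let ρ : Fin n → ℝ → ℝ := fun i => (β i).normed volume
  have hρ : ∀ i, ContDiff ℝ k (ρ i) := fun i => (β i).contDiff_normed (n := (k : ℕ∞))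
  have hρs : ∀ i, support (ρ i) = Metric.ball (p i) (r / 2) := fun i => (β i).support_normed_eq
  have hρ1 : ∀ i, ∫ t in (p i - r)..(p i + r), ρ i t = 1 := fun i => by
    rw [intervalIntegral.integral_eq_integral_of_support_subset]
    · exact (β i).integral_normed
    · rw [hρs, Real.ball_eq_Ioo]
      exact fun x hx => ⟨by linarith [hx.1], by linarith [hx.2]⟩
  let b : (Fin n → ℝ) → ℝ := fun x => ∏ i, ρ i (x i)
  have hprod : ∀ s : Finset (Fin n), ContDiff ℝ k fun x : Fin n → ℝ => ∏ i ∈ s, ρ i (x i) :=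
    fun s => contDiff_prod fun i _ => (hρ i).comp (contDiff_apply ℝ ℝ i)
  have hb : ContDiff ℝ k b := hprod _
  have hbs : support b ⊆ Metric.closedBall p (r / 2) := by
    intro x hx
    rw [Metric.mem_closedBall, dist_pi_le_iff (by positivity)]
    intro j
    have h1 : ρ j (x j) ≠ 0 := Finset.prod_ne_zero_iff.1 hx j (Finset.mem_univ j)
    have h2 : x j ∈ support (ρ j) := h1
    rw [hρs] at h2
    exact (Metric.mem_ball.1 h2).le
  have hbc : HasCompactSupport b :=
    HasCompactSupport.of_support_subset_isCompact (isCompact_closedBall p _) hbs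
  refine ⟨b, hb, hbc, ?_, ?_, ?_⟩
  · exact (closure_minimal hbs Metric.isClosed_closedBall).trans
      (Metric.closedBall_subset_ball (by linarith))
  · refine hb.continuous.integral_pos_of_hasCompactSupport_nonneg_nonzero (x := p) hbc
      (fun x => Finset.prod_nonneg fun i _ => (β i).nonneg_normed _)
      (Finset.prod_ne_zero_iff.2 fun i _ => ?_)
    have : p i ∈ support (ρ i) := by
      rw [hρs]; exact Metric.mem_ball_self (by positivity)
    exact this
  intro H hH hHc hHs
  obtain ⟨r₀, hr₀, hHr₀⟩ := exists_lt_subset_ball (isClosed_tsupport H) hHs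
  set r' := max (r / 2) r₀ with hr'_def
  have hr' : r' < r := max_lt (by linarith) hr₀
  have hr'0 : 0 ≤ r' := le_max_of_le_left (by positivity)
  have hHr' : support H ⊆ Metric.closedBall p r' := (subset_tsupport H).trans
    (hHr₀.trans (Metric.ball_subset_closedBall.trans
      (Metric.closedBall_subset_closedBall (le_max_right _ _))))
  have hρs' : ∀ i, support (ρ i) ⊆ Metric.closedBall (p i) r' := fun i => by
    rw [hρs]
    exact Metric.ball_subset_closedBall.trans (Metric.closedBall_subset_closedBall (le_max_left _ _))
  have key : ∀ s : Finset (Fin n), ∃ G : (Fin n → ℝ) → ℝ, ContDiff ℝ k G ∧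
      (∀ x y, (∀ j ∉ s, x j = y j) → G x = G y) ∧
      support (fun x => (∏ i ∈ s, ρ i (x i)) * G x) ⊆ Metric.closedBall p r' ∧
      (H - fun x => (∏ i ∈ s, ρ i (x i)) * G x) ∈ divergences k U := by
    intro s
    induction s using Finset.induction_on with
    | empty =>
      refine ⟨H, hH, fun x y h => by rw [show x = y from funext fun j => h j (by simp)],
        by simpa using hHr', ?_⟩
      convert (divergences k U).zero_mem
      ext x
      simp
    | insert i s hi ih =>
      obtain ⟨G, hG, hGs, hGr, hGD⟩ := ih
      have heq : (fun x : Fin n → ℝ => (∏ j ∈ insert i s, ρ j (x j)) *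
            lineIntegral i (p i - r) (p i + r) G x) =
          fun x => ρ i (x i) * lineIntegral i (p i - r) (p i + r)
            (fun x => (∏ j ∈ s, ρ j (x j)) * G x) x := by
        funext x
        have : ∀ t, ∏ j ∈ s, ρ j (update x i t j) = ∏ j ∈ s, ρ j (x j) := fun t =>
          Finset.prod_congr rfl fun j hj => by rw [update_of_ne (ne_of_mem_of_not_mem hj hi)]
        simp only [lineIntegral, this, intervalIntegral.integral_const_mul]
        rw [Finset.prod_insert hi, mul_assoc]
      refine ⟨lineIntegral i (p i - r) (p i + r) G, contDiff_lineIntegral i _ _ hG,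
        fun x y h => ?_, ?_, ?_⟩
      · refine intervalIntegral.integral_congr fun t _ => hGs _ _ fun j hj => ?_
        rcases eq_or_ne j i with rfl | hji
        · simp
        · simpa [hji] using h j (by simp [hji, hj])
      · rw [heq]
        exact support_mul_lineIntegral_subset hr'0 (hρs' i) hGr _ _
      · rw [heq]
        have := (divergences k U).add_mem hGD
          (sub_mul_lineIntegral_mem_divergences hr'0 hr' hU (hρ i) (hρs' i) (hρ1 i)
            ((hprod s).mul hG) hGr)
        rwa [sub_add_sub_cancel] at this
  obtain ⟨G, -, hG, -, hD⟩ := key Finset.univ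
  have hGb : (fun x : Fin n → ℝ => (∏ i, ρ i (x i)) * G x) = G p • b := by
    funext x
    simp only [Pi.smul_apply, smul_eq_mul]
    rw [hG x p (by simp), mul_comm]
  rw [hGb] at hD
  rw [← sub_add_cancel H (G p • b)]
  exact Submodule.add_mem_sup hD (Submodule.smul_mem _ _ (Submodule.mem_span_singleton_self b))

theorem setIntegral_eq_integral_of_tsupport_subset {b : (Fin n → ℝ) → ℝ} {V : Set (Fin n → ℝ)}
    (hb : tsupport b ⊆ V) : ∫ x in V, b x = ∫ x, b x :=
  setIntegral_eq_integral_of_forall_compl_eq_zero fun _ hx =>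
    image_eq_zero_of_notMem_tsupport fun h => hx (hb h)

theorem ContainsSupportedIn.mono {W W' : Submodule ℝ ((Fin n → ℝ) → ℝ)} {N N' : Set (Fin n → ℝ)}
    (h : ContainsSupportedIn k W N) (hW : W ≤ W') (hN : N' ⊆ N) : ContainsSupportedIn k W' N' :=
  fun H hH hHc hHs => hW (h H hH hHc (hHs.trans hN))

/-- On a connected open set, all compactly supported functions are multiples of a single bump
function modulo divergences. -/
theorem exists_bump_containsSupportedIn (hk : 1 ≤ k) (hU : IsOpen U) (hUc : IsConnected U)
    (hUb : Bornology.IsBounded U) :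
    ∃ b : (Fin n → ℝ) → ℝ, ContDiff ℝ k b ∧ HasCompactSupport b ∧ tsupport b ⊆ U ∧
      0 < ∫ x in U, b x ∧ ContainsSupportedIn k (divergences k U ⊔ Submodule.span ℝ {b}) U := by
  have hball : ∀ p ∈ U, ∃ r > 0, Metric.ball p r ⊆ U ∧
      Disjoint (Metric.ball p r) (frontier U) := by
    intro p hp
    obtain ⟨r, hr, hrU⟩ := Metric.isOpen_iff.1 hU p hp
    refine ⟨r, hr, hrU, disjoint_left.2 fun x hx hx' => ?_⟩
    rw [hU.frontier_eq] at hx'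
    exact hx'.2 (hrU hx)
  obtain ⟨p₀, hp₀⟩ := hUc.nonempty
  obtain ⟨r₀, hr₀, hrU₀, hd₀⟩ := hball p₀ hp₀
  obtain ⟨b, hb, hbc, hbs, hbpos, hbW⟩ := exists_bump_containsSupportedIn_ball k hr₀ hd₀
  refine ⟨b, hb, hbc, hbs.trans hrU₀, ?_, ?_⟩
  · rwa [setIntegral_eq_integral_of_tsupport_subset (hbs.trans hrU₀)]
  set W := divergences k U ⊔ Submodule.span ℝ {b} with hW
  set S := {p | ∃ N, IsOpen N ∧ p ∈ N ∧ ContainsSupportedIn k W N} with hS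
  suffices h : U ⊆ S by
    intro H hH hHc hHs
    exact containsSupportedIn_of_locally hHc.isCompact (fun p hp => h (hHs hp)) H hH hHc le_rfl
  have hSo : IsOpen S := by
    refine isOpen_iff_mem_nhds.2 fun p ⟨N, hN, hpN, h⟩ => ?_
    filter_upwards [hN.mem_nhds hpN] with q hq using ⟨N, hN, hq, h⟩
  refine hUc.isPreconnected.subset_of_closure_inter_subset hSo
    ⟨p₀, hp₀, _, Metric.isOpen_ball, Metric.mem_ball_self hr₀, hbW⟩ ?_
  rintro p ⟨hpS, hpU⟩
  obtain ⟨r, hr, hrU, hd⟩ := hball p hpU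
  obtain ⟨b₁, hb₁, hbc₁, hbs₁, hbpos₁, hbW₁⟩ := exists_bump_containsSupportedIn_ball k hr hd
  obtain ⟨q, hq, N, hN, hqN, hNW⟩ :=
    mem_closure_iff.1 hpS _ Metric.isOpen_ball (Metric.mem_ball_self hr)
  obtain ⟨δ, hδ, hδN⟩ := Metric.isOpen_iff.1 (hN.inter Metric.isOpen_ball) q ⟨hqN, hq⟩
  obtain ⟨b₂, hb₂, hbc₂, hbs₂, hbpos₂, -⟩ :=
    exists_bump_containsSupportedIn_ball k hδ
      (hd.mono_left (hδN.trans inter_subset_right) : Disjoint (Metric.ball q δ) (frontier U))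
  have hW₂ : b₂ ∈ W := hNW b₂ hb₂ hbc₂ (hbs₂.trans (hδN.trans inter_subset_left))
  have hball₂ : tsupport b₂ ⊆ Metric.ball p r := hbs₂.trans (hδN.trans inter_subset_right)
  obtain ⟨D, hD, y, hy, hDb⟩ := Submodule.mem_sup.1 (hbW₁ b₂ hb₂ hbc₂ hball₂)
  obtain ⟨c, rfl⟩ := Submodule.mem_span_singleton.1 hy
  have hc : c ≠ 0 := by
    rintro rfl
    rw [zero_smul, add_zero] at hDb
    have h1 := setIntegral_eq_zero_of_mem_divergences hk hU hUb hD
    rw [hDb, setIntegral_eq_integral_of_tsupport_subset (hball₂.trans hrU)] at h1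
    exact hbpos₂.ne' h1
  have hb₁W : b₁ ∈ W := by
    have h1 : c • b₁ ∈ W := by
      rw [eq_sub_of_add_eq' hDb]
      exact W.sub_mem hW₂ (Submodule.mem_sup_left hD)
    simpa [smul_smul, inv_mul_cancel₀ hc] using W.smul_mem c⁻¹ h1
  refine ⟨_, Metric.isOpen_ball, Metric.mem_ball_self hr, hbW₁.mono (sup_le le_sup_left ?_) le_rfl⟩
  rwa [Submodule.span_singleton_le_iff_mem]

end Local

section Boundary

variable {n k : ℕ} {U : Set (Fin n → ℝ)}

/-- A smooth hypersurface is locally contained in the graph of a function of all coordinates but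
one. -/
theorem IsSmoothHypersurface.exists_graph {M : Set (Fin n → ℝ)} (hM : IsSmoothHypersurface M)
    (hk : 1 ≤ k) {p : Fin n → ℝ} (hp : p ∈ M) :
    ∃ (i : Fin n) (γ : (Fin n → ℝ) → ℝ) (W : Set (Fin n → ℝ)), IsOpen W ∧ p ∈ W ∧
      (∀ x ∈ W, ContDiffAt ℝ k γ x) ∧ (∀ x ∈ W, x ∈ M → x i = γ x) ∧
      ∀ x t, γ (update x i t) = γ x := by
  have hk0 : (k : WithTop ℕ∞) ≠ 0 := by norm_cast; omega
  obtain ⟨V, hV, hpV, F, hF, hF', hMV⟩ := hM p hp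
  have hFk : ContDiff ℝ k F := hF.of_le (by exact_mod_cast le_top)
  have hF0 : ∀ x ∈ V, x ∈ M → F x = 0 := fun x hx hxM =>
    (hMV.subset ⟨hxM, hx⟩ : x ∈ {y ∈ V | F y = 0}).2
  obtain ⟨i, hi⟩ : ∃ i, fderiv ℝ F p (Pi.single i 1) ≠ 0 := by
    by_contra! h
    exact hF' p hpV (ContinuousLinearMap.coe_injective
      (LinearMap.pi_ext' fun i => LinearMap.ext_ring (h i)))
  have hΨ : ContDiff ℝ k fun x => update x i (F x) := contDiff_update_comp i contDiff_id hFk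
  have hdet : (updateCLM i (fderiv ℝ F p)).det ≠ 0 := (det_updateCLM i _).trans_ne hi
  have hder : HasFDerivAt (fun x => update x i (F x))
      ((ContinuousLinearMap.toContinuousLinearEquivOfDetNeZero _ hdet :
        (Fin n → ℝ) ≃L[ℝ] (Fin n → ℝ)) : (Fin n → ℝ) →L[ℝ] (Fin n → ℝ)) p := by
    rw [ContinuousLinearMap.coe_toContinuousLinearEquivOfDetNeZero]
    exact hasFDerivAt_update_self (hFk.differentiable hk0 p).hasFDerivAt
  obtain ⟨Θ, hΘ⟩ : ∃ Θ, Θ = hΨ.contDiffAt.localInverse hder hk0 := ⟨_, rfl⟩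
  have hΘk : ContDiffAt ℝ k Θ (update p i 0) := by
    have h := hΨ.contDiffAt.to_localInverse hder hk0
    rwa [hF0 p hpV hp, ← hΘ] at h
  have hΘl : ∀ᶠ x in 𝓝 p, Θ (update x i (F x)) = x := by
    rw [hΘ]
    exact (hΨ.contDiffAt.hasStrictFDerivAt' hder hk0).eventually_left_inverse
  have hγ : ContDiffAt ℝ k (fun x => Θ (update x i 0) i) p :=
    (contDiffAt_pi.1 hΘk i).comp p (contDiff_update_comp i contDiff_id contDiff_const).contDiffAt
  obtain ⟨W, hW, hWo, hpW⟩ := eventually_nhds_iff.1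
    ((hγ.eventually (by simp)).and (hΘl.and (hV.mem_nhds hpV)))
  refine ⟨i, fun x => Θ (update x i 0) i, W, hWo, hpW, fun x hx => (hW x hx).1,
    fun x hx hxM => ?_, fun x t => by simp⟩
  obtain ⟨-, h1, h2⟩ := hW x hx
  rw [hF0 x h2 hxM] at h1
  simp only [h1]

/-- The functions vanishing in a neighborhood of the boundary of `U`. -/
def vanishingNearFrontier (U : Set (Fin n → ℝ)) : Submodule ℝ ((Fin n → ℝ) → ℝ) where
  carrier := {H | ∀ x ∈ frontier U, H =ᶠ[𝓝 x] 0}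
  zero_mem' _ _ := EventuallyEq.rfl
  add_mem' h h' x hx := by simpa using (h x hx).add (h' x hx)
  smul_mem' c _ h x hx := by simpa using (h x hx).const_smul c

theorem ContDiff.of_contDiffAt_of_tsupport {f : (Fin n → ℝ) → ℝ} (h : ∀ x ∈ tsupport f,
    ContDiffAt ℝ k f x) : ContDiff ℝ k f :=
  contDiff_iff_contDiffAt.2 fun x => by
    by_cases hx : x ∈ tsupport f
    · exact h x hx
    · exact contDiffAt_const.congr_of_eventuallyEq (notMem_tsupport_iff_eventuallyEq.1 hx)

/-- Near a boundary point, every function agrees near the boundary with the divergence of a vector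
field vanishing on the boundary. -/
theorem exists_containsSupportedIn_of_mem_frontier (hU : IsSmoothHypersurface (frontier U))
    (hk : 1 ≤ k) {p : Fin n → ℝ} (hp : p ∈ frontier U) :
    ∃ N, IsOpen N ∧ p ∈ N ∧
      ContainsSupportedIn k (divergences k U ⊔ vanishingNearFrontier U) N := by
  have hk0 : (k : WithTop ℕ∞) ≠ 0 := by norm_cast; omega
  obtain ⟨i, γ, W, hWo, hpW, hγ, hγU, hγu⟩ := hU.exists_graph hk hp
  obtain ⟨R, hR, hRW⟩ := Metric.nhds_basis_closedBall.mem_iff.1 (hWo.mem_nhds hpW)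
  let η : ContDiffBump p := ⟨R / 2, R, by positivity, by linarith⟩
  have hηc : ContDiff ℝ (⊤ : ℕ∞) η := η.contDiff
  have hηk : ContDiff ℝ k η := η.contDiff
  have hηW : tsupport η ⊆ W := η.tsupport_eq.trans_subset hRW
  have hη' : ContDiff ℝ k fun x => fderiv ℝ η x (Pi.single i 1) :=
    (hηc.fderiv_right (m := k) (by exact_mod_cast le_top)).clm_apply contDiff_const
  have hη's : tsupport (fun x => fderiv ℝ η x (Pi.single i 1)) ⊆ tsupport η :=
    tsupport_fderiv_apply_subset ℝ _
  refine ⟨Metric.ball p (R / 2), Metric.isOpen_ball, Metric.mem_ball_self (by positivity), ?_⟩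
  intro H hH hHc hHs
  set w := primitive i 0 H with hw_def
  have hw : ContDiff ℝ k w := contDiff_primitive i 0 hH
  set u : (Fin n → ℝ) → ℝ := fun x => w x - w (update x i (γ x)) with hu_def
  have hu : ∀ x ∈ W, ContDiffAt ℝ k u x := fun x hx => by
    refine hw.contDiffAt.sub (hw.contDiffAt.comp x (contDiffAt_pi.2 fun j => ?_))
    rcases eq_or_ne j i with rfl | hj
    · simpa using hγ x hx
    · simpa [hj] using (contDiff_apply ℝ ℝ j).contDiffAt
  have hu0 : ∀ x ∈ W, x ∈ frontier U → u x = 0 := fun x hx hxU => by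
    simp [hu_def, ← hγU x hx hxU]
  set v : (Fin n → ℝ) → ℝ := fun x => η x * u x with hv_def
  set D : (Fin n → ℝ) → ℝ := fun x => fderiv ℝ η x (Pi.single i 1) * u x + η x * H x with hD_def
  have hvs : tsupport v ⊆ tsupport η := tsupport_mul_subset_left
  have hDs : tsupport D ⊆ tsupport η :=
    (tsupport_add _ _).trans (union_subset (tsupport_mul_subset_left.trans hη's)
      tsupport_mul_subset_left)
  have hv : ContDiff ℝ k v := ContDiff.of_contDiffAt_of_tsupport fun x hx =>
    hηk.contDiffAt.mul (hu x (hηW (hvs hx)))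
  have hD : ContDiff ℝ k D := ContDiff.of_contDiffAt_of_tsupport fun x hx =>
    (hη'.contDiffAt.mul (hu x (hηW (hDs hx)))).add (hηk.contDiffAt.mul hH.contDiffAt)
  have hvD : HasPartialDeriv i v D := fun x => by
    have h1 := (hηk.differentiable hk0).hasPartialDeriv i x
    have h2 : HasDerivAt (fun t => u (update x i t)) (H x) (x i) := by
      simp only [hu_def, hγu, update_idem]
      exact (hasPartialDeriv_primitive i 0 hH.continuous x).sub_const _
    have h3 := h1.mul h2
    simp only [update_eq_self] at h3
    exact h3
  have hDdiv : D ∈ divergences k U := by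
    refine mem_divergences hD hv η.hasCompactSupport.mul_right (fun x hx => ?_) hvD
    by_cases hxW : x ∈ W
    · simp [hv_def, hu0 x hxW hx]
    · simp [hv_def, image_eq_zero_of_notMem_tsupport fun h => hxW (hηW h)]
  rw [← add_sub_cancel D H]
  refine Submodule.add_mem_sup hDdiv fun x hx => ?_
  suffices h : H =ᶠ[𝓝 x] D by
    filter_upwards [h] with y hy
    simp [hy]
  by_cases hxH : x ∈ tsupport H
  · have h1 := η.eventuallyEq_one_of_mem_ball (hHs hxH)
    filter_upwards [h1, h1.fderiv (𝕜 := ℝ)] with y hy hy'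
    simp [hD_def, hy, hy', Pi.one_def]
  have hH0 := notMem_tsupport_iff_eventuallyEq.1 hxH
  by_cases hxW : x ∈ W
  · obtain ⟨δ, hδ, hδH⟩ := Metric.eventually_nhds_iff_ball.1 hH0
    have hγx := hγU x hxW hx
    have hγc : ∀ᶠ y in 𝓝 x, γ y ∈ Metric.ball (x i) δ :=
      (hγ x hxW).continuousAt.eventually (by rw [← hγx]; exact Metric.ball_mem_nhds _ hδ)
    filter_upwards [Metric.ball_mem_nhds x hδ, hγc] with y hy hyγ
    have huy : u y = 0 := by
      have hc := continuous_line hH.continuous i y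
      have h1 : u y = ∫ s in γ y..y i, H (update y i s) := by
        simp only [hu_def, hw_def, primitive_update]
        exact intervalIntegral.integral_interval_sub_left (hc.intervalIntegrable _ _)
          (hc.intervalIntegrable _ _)
      rw [h1]
      have hyi : y i ∈ Metric.ball (x i) δ := (dist_le_pi_dist y x i).trans_lt hy
      have hsub : uIcc (γ y) (y i) ⊆ Metric.ball (x i) δ :=
        (convex_ball (x i) δ).ordConnected.uIcc_subset hyγ hyi
      refine intervalIntegral.integral_zero_ae (Eventually.of_forall fun s hs => hδH _ ?_)
      refine Metric.mem_ball.2 ((dist_pi_lt_iff hδ).2 fun j => ?_)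
      rcases eq_or_ne j i with rfl | hj
      · simpa using hsub (uIoc_subset_uIcc hs)
      · simpa [hj] using (dist_le_pi_dist y x j).trans_lt hy
    simp [hD_def, huy, hδH y hy]
  · filter_upwards [hH0, notMem_tsupport_iff_eventuallyEq.1 fun h => hxW (hηW (hDs h))] with y hy hy'
    rw [hy, hy']

theorem exists_containsSupportedIn_vanishingNearFrontier (hU : IsSmoothHypersurface (frontier U))
    (hk : 1 ≤ k) (p : Fin n → ℝ) :
    ∃ N, IsOpen N ∧ p ∈ N ∧
      ContainsSupportedIn k (divergences k U ⊔ vanishingNearFrontier U) N := by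
  by_cases hp : p ∈ frontier U
  · exact exists_containsSupportedIn_of_mem_frontier hU hk hp
  · exact ⟨_, isClosed_frontier.isOpen_compl, hp, fun H _ _ hHs => Submodule.mem_sup_right
      fun x hx => notMem_tsupport_iff_eventuallyEq.1 fun h => hHs h hx⟩

end Boundary

section Main

variable {n k : ℕ} {U : Set (Fin n → ℝ)}

theorem exists_contDiff_cutoff (k : ℕ) {K O : Set (Fin n → ℝ)} (hK : IsCompact K) (hO : IsOpen O)
    (hKO : K ⊆ O) : ∃ χ : (Fin n → ℝ) → ℝ, ContDiff ℝ k χ ∧ HasCompactSupport χ ∧ tsupport χ ⊆ O ∧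
      (∀ᶠ x in 𝓝ˢ K, χ x = 1) ∧ ∀ x, χ x ∈ Icc 0 1 := by
  obtain ⟨L, hL, hKL, hLO⟩ := exists_compact_between hK hO hKO
  obtain ⟨χ, h1, h0, h01⟩ := exists_contMDiffMap_one_nhds_of_subset_interior (n := (k : ℕ∞))
    (modelWithCornersSelf ℝ (Fin n → ℝ)) hK.isClosed hKL
  have hs : tsupport χ ⊆ L := closure_minimal (fun x hx => by_contra fun h => hx (h0 x h))
    hL.isClosed
  exact ⟨χ, χ.contMDiff.contDiff, hL.of_isClosed_subset (isClosed_tsupport _) hs, hs.trans hLO, h1,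
    h01⟩

/-- A function with vanishing integral over `U` agrees near the closure of `U` with the divergence
of a vector field vanishing on the boundary. -/
theorem exists_mem_divergences_eventuallyEq (hk : 1 ≤ k) (hU : IsOpen U) (hUc : IsConnected U)
    (hUb : Bornology.IsBounded U) (hUs : IsSmoothHypersurface (frontier U)) {h : (Fin n → ℝ) → ℝ}
    (hh : ContDiff ℝ k h) (hh0 : ∫ x in U, h x = 0) :
    ∃ D ∈ divergences k U, ∀ᶠ x in 𝓝ˢ (closure U), D x = h x := by
  have hcl : IsCompact (closure U) := hUb.isCompact_closure
  obtain ⟨χ, hχ, hχc, -, hχ1, -⟩ := exists_contDiff_cutoff k hcl isOpen_univ (subset_univ _)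
  have hH : ContDiff ℝ k fun x => χ x * h x := hχ.mul hh
  have hHc : HasCompactSupport fun x => χ x * h x := hχc.mul_right
  obtain ⟨D₁, hD₁, Z, hZ, hDZ⟩ := Submodule.mem_sup.1
    (containsSupportedIn_of_locally hHc.isCompact
      (fun p _ => exists_containsSupportedIn_vanishingNearFrontier hUs hk p) _ hH hHc le_rfl)
  have hZk : ContDiff ℝ k Z := by
    rw [eq_sub_of_add_eq' hDZ]
    exact hH.sub (contDiff_of_mem_divergences hD₁)
  have hRZ : ∀ x ∈ closure U, U.indicator Z =ᶠ[𝓝 x] Z := fun x hx => by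
    by_cases hxU : x ∈ U
    · filter_upwards [hU.mem_nhds hxU] with y hy using indicator_of_mem hy _
    · filter_upwards [hZ x (by rw [hU.frontier_eq]; exact ⟨hx, hxU⟩)] with y hy
      by_cases hyU : y ∈ U
      · exact indicator_of_mem hyU _
      · rw [indicator_of_notMem hyU, hy, Pi.zero_apply]
  have hRc : tsupport (U.indicator Z) ⊆ closure U := closure_mono support_indicator_subset
  have hRU : tsupport (U.indicator Z) ⊆ U := fun x hx => by
    by_contra hxU
    refine notMem_tsupport_iff_eventuallyEq.2 ?_ hx
    exact (hRZ x (hRc hx)).trans (hZ x (by rw [hU.frontier_eq]; exact ⟨hRc hx, hxU⟩))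
  have hR : ContDiff ℝ k (U.indicator Z) := ContDiff.of_contDiffAt_of_tsupport fun x hx =>
    hZk.contDiffAt.congr_of_eventuallyEq (hRZ x (hRc hx))
  obtain ⟨b, hb, hbc, -, hbpos, hbW⟩ := exists_bump_containsSupportedIn hk hU hUc hUb
  obtain ⟨D₂, hD₂, y, hy, hDb⟩ := Submodule.mem_sup.1
    (hbW _ hR (hcl.of_isClosed_subset (isClosed_tsupport _) hRc) hRU)
  obtain ⟨c, rfl⟩ := Submodule.mem_span_singleton.1 hy
  have hD := (divergences k U).add_mem hD₁ hD₂
  have heq : ∀ x ∈ closure U, ∀ᶠ y in 𝓝 x, (D₁ + D₂) y = h y - c * b y := fun x hx => by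
    filter_upwards [hRZ x hx, hχ1.filter_mono (nhds_le_nhdsSet hx)] with y hy hy1
    have h1 := congrFun hDZ y
    have h2 := congrFun hDb y
    simp only [Pi.add_apply, Pi.smul_apply, smul_eq_mul, hy1, one_mul] at h1 h2 ⊢
    linarith
  have hc : c = 0 := by
    have h1 := setIntegral_eq_zero_of_mem_divergences hk hU hUb hD
    have hhi : IntegrableOn h U :=
      (hh.continuous.continuousOn.integrableOn_compact hcl).mono_set subset_closure
    have hbi : IntegrableOn (fun x => c * b x) U :=
      ((hb.continuous.integrable_of_hasCompactSupport hbc).const_mul c).integrableOn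
    rw [setIntegral_congr_fun hU.measurableSet
      fun x hx => (heq x (subset_closure hx)).self_of_nhds, integral_sub hhi hbi, hh0,
      integral_const_mul, zero_sub, neg_eq_zero] at h1
    exact (mul_eq_zero.1 h1).resolve_right hbpos.ne'
  refine ⟨D₁ + D₂, hD, eventually_nhdsSet_iff_forall.2 fun x hx => ?_⟩
  simpa [hc] using heq x hx

theorem setIntegral_pos_of_continuous (hU : IsOpen U) (hUn : U.Nonempty)
    (hUb : Bornology.IsBounded U) {f : (Fin n → ℝ) → ℝ} (hf : Continuous f) (hpos : ∀ x, 0 < f x) :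
    0 < ∫ x in U, f x := by
  have hfi : IntegrableOn f U :=
    (hf.continuousOn.integrableOn_compact hUb.isCompact_closure).mono_set subset_closure
  rw [setIntegral_pos_iff_support_of_nonneg_ae (ae_of_all _ fun x => (hpos x).le) hfi,
    show support f = univ from eq_univ_of_forall fun x => (hpos x).ne', univ_inter]
  exact hU.measure_pos _ hUn

/-- Two positive densities with the same mass on `U` correspond to each other near the closure of
`U` under a diffeomorphism fixing the boundary. -/
theorem exists_diffeomorph_of_setIntegral_eq (hk : 1 ≤ k) (hU : IsOpen U) (hUc : IsConnected U)
    (hUb : Bornology.IsBounded U) (hUs : IsSmoothHypersurface (frontier U))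
    {f g : (Fin n → ℝ) → ℝ} (hf : ContDiff ℝ k f) (hg : ContDiff ℝ k g) (hfpos : ∀ x, 0 < f x)
    (hgpos : ∀ x, 0 < g x) (hfg : ∫ x in U, f x = ∫ x in U, g x) :
    ∃ φ ψ : (Fin n → ℝ) → (Fin n → ℝ), ContDiff ℝ k φ ∧ ContDiff ℝ k ψ ∧
      LeftInverse ψ φ ∧ RightInverse ψ φ ∧
      (∃ V, IsOpen V ∧ closure U ⊆ V ∧
        ∀ x ∈ V, LinearMap.det (fderiv ℝ φ x).toLinearMap * f (φ x) = g x) ∧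
      ∀ x ∈ frontier U, φ x = x := by
  have hcl : IsCompact (closure U) := hUb.isCompact_closure
  have hInt : ∀ {f : (Fin n → ℝ) → ℝ}, ContDiff ℝ k f → IntegrableOn f U := fun hf =>
    (hf.continuous.continuousOn.integrableOn_compact hcl).mono_set subset_closure
  obtain ⟨D, hD, hDh⟩ := exists_mem_divergences_eventuallyEq hk hU hUc hUb hUs (hg.sub hf)
    (by simp only [integral_sub (hInt hg) (hInt hf), hfg, sub_self])
  obtain ⟨W, hW, hUW, hDW⟩ := eventually_nhdsSet_iff_exists.1 hDh
  obtain ⟨ζ, hζ, hζc, hζW, hζ1, hζ01⟩ := exists_contDiff_cutoff k hcl hW hUW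
  obtain ⟨W', hW', hUW', hζW'⟩ := eventually_nhdsSet_iff_exists.1 (hζ1.and hDh)
  obtain ⟨M, -, hM⟩ := exists_bound_of_mem_divergences hk hD
  have hbelow : ∀ {f : (Fin n → ℝ) → ℝ}, ContDiff ℝ k f → (∀ x, 0 < f x) →
      ∃ c > 0, ∀ x ∈ tsupport ζ, c ≤ f x := fun {f} hf hpos =>
    hζc.isCompact.exists_forall_le' hf.continuous.continuousOn fun x _ => hpos x
  obtain ⟨a, ha, haf⟩ := hbelow hf hfpos
  obtain ⟨a', ha', hag⟩ := hbelow hg hgpos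
  set c := min 1 (min a a') with hc_def
  have hc : 0 < c := by positivity
  have hM0 : ∀ x, 0 ≤ M + D x := fun x => by linarith [(abs_le.1 (hM x)).1]
  have hM0' : 0 ≤ M := (abs_nonneg _).trans (hM 0)
  set f' : (Fin n → ℝ) → ℝ := fun x => ζ x * f x + (1 - ζ x) * (M + 1) with hf'_def
  have hf' : ContDiff ℝ k f' := (hζ.mul hf).add ((contDiff_const.sub hζ).mul contDiff_const)
  have hconv : ∀ {t p q : ℝ}, t ∈ Icc (0 : ℝ) 1 → c ≤ p → c ≤ q → c ≤ t * p + (1 - t) * q :=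
    fun ht hp hq => by
      nlinarith [mul_le_mul_of_nonneg_left hp ht.1, mul_le_mul_of_nonneg_left hq (sub_nonneg.2 ht.2)]
  have hc1 : c ≤ 1 := min_le_left _ _
  have hf'c : ∀ x, c ≤ f' x := fun x => by
    by_cases hx : x ∈ tsupport ζ
    · exact hconv (hζ01 x) (((min_le_right _ _).trans (min_le_left _ _)).trans (haf x hx))
        (by linarith)
    · simp only [hf'_def, image_eq_zero_of_notMem_tsupport hx]
      linarith
  have hf'Dc : ∀ x, c ≤ (f' + D) x := fun x => by
    by_cases hx : x ∈ tsupport ζ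
    · have h1 : (f' + D) x = ζ x * g x + (1 - ζ x) * (M + D x + 1) := by
        have := hDW x (hζW hx)
        simp only [hf'_def, Pi.add_apply, this]
        ring
      rw [h1]
      exact hconv (hζ01 x) (((min_le_right _ _).trans (min_le_right _ _)).trans (hag x hx))
        (by linarith [hM0 x])
    · simp only [hf'_def, Pi.add_apply, image_eq_zero_of_notMem_tsupport hx]
      linarith [hM0 x]
  obtain ⟨φ, ψ, hφ, hψ, hl, hr, hdet, hfix, hφU, -⟩ := densityEquiv_add hk hU hD hf' hc hf'c hf'Dc
  refine ⟨φ, ψ, hφ, hψ, hl, hr, ⟨W' ∩ φ ⁻¹' W', hW'.inter (hW'.preimage hφ.continuous),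
    fun x hx => ⟨hUW' hx, hUW' (hφU.closure hφ.continuous hx)⟩, fun x hx => ?_⟩, hfix⟩
  have h1 := hdet x
  simp only [hf'_def, Pi.add_apply, (hζW' x hx.1).1, (hζW' x hx.1).2, (hζW' _ hx.2).1] at h1
  simpa using h1

end Main

/-- **An ambient Dacarogna–Moser theorem.**  Let `U ⊂ ℝⁿ` be a bounded connected open set
with connected `C^∞` boundary, and let `f, g : ℝⁿ → ℝ` be positive `C^k` functions.  With
`λ = (∫_U f)/(∫_U g)`, there is a `C^k` diffeomorphism `φ` of `ℝⁿ` with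
`det(Dφ) · (f ∘ φ) = λ g` on a neighborhood of `closure U` and `φ = id` on `∂U`. -/
theorem ambient_dacarogna_moser (n k : ℕ) (hn : 1 ≤ n) (hk : 1 ≤ k)
    (U : Set (Fin n → ℝ)) (hUopen : IsOpen U) (hUconn : IsConnected U)
    (hUbdd : Bornology.IsBounded U)
    (hbconn : IsConnected (frontier U)) (hbsmooth : IsSmoothHypersurface (frontier U))
    (f g : (Fin n → ℝ) → ℝ) (hf : ContDiff ℝ (k : ℕ∞) f) (hg : ContDiff ℝ (k : ℕ∞) g)
    (hfpos : ∀ x, 0 < f x) (hgpos : ∀ x, 0 < g x) :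
    ∃ φ : (Fin n → ℝ) → (Fin n → ℝ),
      ContDiff ℝ (k : ℕ∞) φ ∧
      (∃ ψ, ContDiff ℝ (k : ℕ∞) ψ ∧ Function.LeftInverse ψ φ ∧ Function.RightInverse ψ φ) ∧
      (∃ V : Set (Fin n → ℝ), IsOpen V ∧ closure U ⊆ V ∧
        ∀ x ∈ V, LinearMap.det (fderiv ℝ φ x).toLinearMap * f (φ x)
          = ((∫ y in U, f y) / (∫ y in U, g y)) * g x) ∧
      (∀ x ∈ frontier U, φ x = x) := by
  have hf' : ContDiff ℝ k f := by exact_mod_cast hf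
  have hg' : ContDiff ℝ k g := by exact_mod_cast hg
  have hfi := setIntegral_pos_of_continuous hUopen hUconn.nonempty hUbdd hf.continuous hfpos
  have hgi := setIntegral_pos_of_continuous hUopen hUconn.nonempty hUbdd hg.continuous hgpos
  obtain ⟨φ, ψ, hφ, hψ, hl, hr, hV, hfix⟩ := exists_diffeomorph_of_setIntegral_eq hk hUopen hUconn
    hUbdd hbsmooth hf' (contDiff_const.mul hg') hfpos
    (fun x => mul_pos (div_pos hfi hgi) (hgpos x))
    (by rw [integral_const_mul, div_mul_cancel₀ _ hgi.ne'])
  exact ⟨φ, by exact_mod_cast hφ, ⟨ψ, by exact_mod_cast hψ, hl, hr⟩, hV, hfix⟩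
end

section
/- Let k ≥ 1 be an integer, B = [0,1]² ⊂ ℝ², and let f be a C^k function defined on (a neighborhood of) B with f > 0, such that f equals 1 at each of the four corners (ε₁, ε₂) with ε₁, ε₂ ∈ {0,1}. Then there exists a C^k diffeomorphism v : ℝ² → ℝ² such that det(Dv(x)) = f(x) for all x ∈ ∂B and v(x) = x for all x ∈ ∂B. -/
open Set

/-- The lift to `ℝ` of the action of `diag(1, l)` on directions in the plane: the angle of
`(cos θ, l * sin θ)`, normalised to lie within `π / 2` of `θ`. -/
noncomputable def stretchAngle (l θ : ℝ) : ℝ :=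
  θ + Real.arctan ((l - 1) * Real.sin θ * Real.cos θ / (Real.cos θ ^ 2 + l * Real.sin θ ^ 2))

theorem cos_sq_add_mul_sin_sq_pos {l : ℝ} (hl : 0 < l) (θ : ℝ) :
    0 < Real.cos θ ^ 2 + l * Real.sin θ ^ 2 := by
  have h := Real.sin_sq_add_cos_sq θ
  rcases eq_or_ne (Real.sin θ) 0 with h0 | h0
  · rw [h0] at h ⊢
    nlinarith
  · positivity

theorem stretchAngle_one (θ : ℝ) : stretchAngle 1 θ = θ := by
  simp [stretchAngle]

theorem exists_cos_sin_stretchAngle {l : ℝ} (hl : 0 < l) (θ : ℝ) :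
    ∃ r : ℝ, 0 < r ∧ Real.cos (stretchAngle l θ) = r * Real.cos θ ∧
      Real.sin (stretchAngle l θ) = r * (l * Real.sin θ) := by
  have hd := cos_sq_add_mul_sin_sq_pos hl θ
  have h1 := Real.sin_sq_add_cos_sq θ
  set c := Real.cos θ
  set s := Real.sin θ
  set q := (l - 1) * s * c / (c ^ 2 + l * s ^ 2) with hq
  have hsq : 0 < √(1 + q ^ 2) := Real.sqrt_pos.2 (by positivity)
  have hqd : q * (c ^ 2 + l * s ^ 2) = (l - 1) * s * c := by
    rw [hq]; field_simp
  have hqs : stretchAngle l θ = θ + Real.arctan q := rfl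
  clear_value q
  refine ⟨(c ^ 2 + l * s ^ 2)⁻¹ * (√(1 + q ^ 2))⁻¹, by positivity, ?_, ?_⟩
  · rw [hqs, Real.cos_add, Real.cos_arctan, Real.sin_arctan]
    change c * (1 / √(1 + q ^ 2)) - s * (q / √(1 + q ^ 2)) = _
    have e : c - s * q = c / (c ^ 2 + l * s ^ 2) := by
      rw [eq_div_iff hd.ne']
      linear_combination (-s) * hqd + c * h1
    linear_combination (√(1 + q ^ 2))⁻¹ * e
  · rw [hqs, Real.sin_add, Real.cos_arctan, Real.sin_arctan]
    change s * (1 / √(1 + q ^ 2)) + c * (q / √(1 + q ^ 2)) = _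
    have e : s + c * q = l * s / (c ^ 2 + l * s ^ 2) := by
      rw [eq_div_iff hd.ne']
      linear_combination c * hqd + (s * l) * h1
    linear_combination (√(1 + q ^ 2))⁻¹ * e

theorem stretchAngle_inv_stretchAngle {l : ℝ} (hl : 0 < l) (θ : ℝ) :
    stretchAngle l⁻¹ (stretchAngle l θ) = θ := by
  obtain ⟨r, hr, hc, hs⟩ := exists_cos_sin_stretchAngle hl θ
  have hd := cos_sq_add_mul_sin_sq_pos hl θ
  rw [stretchAngle, hc, hs]
  have : (l⁻¹ - 1) * (r * (l * Real.sin θ)) * (r * Real.cos θ) /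
      ((r * Real.cos θ) ^ 2 + l⁻¹ * (r * (l * Real.sin θ)) ^ 2) =
      -((l - 1) * Real.sin θ * Real.cos θ / (Real.cos θ ^ 2 + l * Real.sin θ ^ 2)) := by
    have e : (r * Real.cos θ) ^ 2 + l⁻¹ * (r * (l * Real.sin θ)) ^ 2 =
        r ^ 2 * (Real.cos θ ^ 2 + l * Real.sin θ ^ 2) := by
      field_simp
    rw [e]
    field_simp
    ring
  rw [this, Real.arctan_neg, stretchAngle]
  ring

theorem hasDerivAt_stretchAngle_of_sin_eq_zero {l θ : ℝ} (h : Real.sin θ = 0) :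
    HasDerivAt (stretchAngle l) l θ := by
  have hc : Real.cos θ ^ 2 = 1 := by nlinarith [Real.sin_sq_add_cos_sq θ]
  have hd : Real.cos θ ^ 2 + l * Real.sin θ ^ 2 ≠ 0 := by simp [h, hc]
  have hn := ((Real.hasDerivAt_sin θ).const_mul (l - 1)).mul (Real.hasDerivAt_cos θ)
  have hm := ((Real.hasDerivAt_cos θ).pow 2).add (((Real.hasDerivAt_sin θ).pow 2).const_mul l)
  refine ((hasDerivAt_id θ).add (hn.div hm hd).arctan).congr_deriv ?_
  simp [h, hc]
  linear_combination (l - 1) * hc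

theorem hasDerivAt_stretchAngle_of_cos_eq_zero {l θ : ℝ} (hl : l ≠ 0) (h : Real.cos θ = 0) :
    HasDerivAt (stretchAngle l) l⁻¹ θ := by
  have hs : Real.sin θ ^ 2 = 1 := by nlinarith [Real.sin_sq_add_cos_sq θ]
  have hd : Real.cos θ ^ 2 + l * Real.sin θ ^ 2 ≠ 0 := by simp [h, hs, hl]
  have hn := ((Real.hasDerivAt_sin θ).const_mul (l - 1)).mul (Real.hasDerivAt_cos θ)
  have hm := ((Real.hasDerivAt_cos θ).pow 2).add (((Real.hasDerivAt_sin θ).pow 2).const_mul l)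
  refine ((hasDerivAt_id θ).add (hn.div hm hd).arctan).congr_deriv ?_
  simp [h, hs]
  field_simp
  linear_combination (1 - l) * hs

theorem ContDiff.stretchAngle {E : Type*} [NormedAddCommGroup E] [NormedSpace ℝ E]
    {n : WithTop ℕ∞} {l θ : E → ℝ} (hl : ContDiff ℝ n l) (hpos : ∀ x, 0 < l x)
    (hθ : ContDiff ℝ n θ) : ContDiff ℝ n (fun x ↦ stretchAngle (l x) (θ x)) := by
  have hd : ∀ x, Real.cos (θ x) ^ 2 + l x * Real.sin (θ x) ^ 2 ≠ 0 :=
    fun x ↦ (cos_sq_add_mul_sin_sq_pos (hpos x) _).ne'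
  unfold _root_.stretchAngle
  exact hθ.add (Real.contDiff_arctan.comp ((((hl.sub contDiff_const).mul hθ.sin).mul hθ.cos).div
    ((hθ.cos.pow 2).add (hl.mul (hθ.sin.pow 2))) hd))

/-- The conjugate of `stretchAngle l` by multiplication by `s`. -/
noncomputable def scaledStretch (s l x : ℝ) : ℝ := stretchAngle l (s * x) / s

theorem scaledStretch_one {s : ℝ} (hs : s ≠ 0) (x : ℝ) : scaledStretch s 1 x = x := by
  rw [scaledStretch, stretchAngle_one]
  field_simp

theorem scaledStretch_inv_scaledStretch {s l : ℝ} (hs : s ≠ 0) (hl : 0 < l) (x : ℝ) :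
    scaledStretch s l⁻¹ (scaledStretch s l x) = x := by
  rw [scaledStretch, scaledStretch, mul_div_cancel₀ _ hs, stretchAngle_inv_stretchAngle hl]
  field_simp

theorem scaledStretch_eq_self {s x : ℝ} (hs : s ≠ 0) (h : Real.sin (s * x) * Real.cos (s * x) = 0)
    (l : ℝ) : scaledStretch s l x = x := by
  rw [scaledStretch, stretchAngle, mul_assoc, h]
  simp
  field_simp

theorem HasDerivAt.scaledStretch {s l m x : ℝ} (hs : s ≠ 0)
    (h : HasDerivAt (stretchAngle l) m (s * x)) : HasDerivAt (scaledStretch s l) m x := by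
  refine ((h.comp x ((hasDerivAt_id x).const_mul s)).div_const s).congr_deriv ?_
  field_simp

theorem ContDiff.scaledStretch {E : Type*} [NormedAddCommGroup E] [NormedSpace ℝ E]
    {n : WithTop ℕ∞} {l θ : E → ℝ} (s : ℝ) (hl : ContDiff ℝ n l) (hpos : ∀ x, 0 < l x)
    (hθ : ContDiff ℝ n θ) : ContDiff ℝ n (fun x ↦ scaledStretch s (l x) (θ x)) :=
  (ContDiff.stretchAngle hl hpos (contDiff_const.mul hθ)).div_const s

/-- There is a family of diffeomorphisms of `ℝ` fixing `0` and `1` whose derivatives at these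
points are prescribed positive functions of the parameter. -/
theorem exists_diffeo_family {n : WithTop ℕ∞} {a b : ℝ → ℝ} (ha : ContDiff ℝ n a)
    (hb : ContDiff ℝ n b) (ha0 : ∀ t, 0 < a t) (hb0 : ∀ t, 0 < b t) :
    ∃ φ ψ : ℝ → ℝ → ℝ, ContDiff ℝ n (Function.uncurry φ) ∧ ContDiff ℝ n (Function.uncurry ψ) ∧
      (∀ t, Function.LeftInverse (ψ t) (φ t)) ∧ (∀ t, Function.RightInverse (ψ t) (φ t)) ∧
      (∀ t, φ t 0 = 0) ∧ (∀ t, φ t 1 = 1) ∧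
      (∀ t, HasDerivAt (φ t) (a t) 0) ∧ (∀ t, HasDerivAt (φ t) (b t) 1) ∧
      (∀ t, a t = 1 → b t = 1 → φ t = id) := by
  have hπ := Real.pi_ne_zero
  have hπ2 : Real.pi / 2 ≠ 0 := by positivity
  have hm0 : ∀ t, 0 < √(a t * b t) := fun t ↦ Real.sqrt_pos.2 (mul_pos (ha0 t) (hb0 t))
  have hl0 : ∀ t, 0 < √(a t / b t) := fun t ↦ Real.sqrt_pos.2 (div_pos (ha0 t) (hb0 t))
  have hm : ContDiff ℝ n fun t ↦ √(a t * b t) :=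
    (ha.mul hb).sqrt fun t ↦ (mul_pos (ha0 t) (hb0 t)).ne'
  have hl : ContDiff ℝ n fun t ↦ √(a t / b t) :=
    (ha.div hb fun t ↦ (hb0 t).ne').sqrt fun t ↦ (div_pos (ha0 t) (hb0 t)).ne'
  have hm' := hm.inv fun t ↦ (hm0 t).ne'
  have hl' := hl.inv fun t ↦ (hl0 t).ne'
  have fix0 : ∀ s l : ℝ, s ≠ 0 → scaledStretch s l 0 = 0 :=
    fun s l hs ↦ scaledStretch_eq_self hs (by simp) l
  have fix1 : ∀ l : ℝ, scaledStretch (Real.pi / 2) l 1 = 1 :=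
    fun l ↦ scaledStretch_eq_self hπ2 (by simp) l
  have fix1' : ∀ l : ℝ, scaledStretch Real.pi l 1 = 1 :=
    fun l ↦ scaledStretch_eq_self hπ (by simp) l
  have der0 : ∀ s l : ℝ, s ≠ 0 → HasDerivAt (scaledStretch s l) l 0 := fun s l hs ↦
    (hasDerivAt_stretchAngle_of_sin_eq_zero (by simp)).scaledStretch hs
  refine ⟨fun t x ↦ scaledStretch Real.pi √(a t * b t)
      (scaledStretch (Real.pi / 2) √(a t / b t) x),
    fun t x ↦ scaledStretch (Real.pi / 2) (√(a t / b t))⁻¹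
      (scaledStretch Real.pi (√(a t * b t))⁻¹ x), ?_, ?_, ?_, ?_, ?_, ?_, ?_, ?_, ?_⟩
  · exact (hm.comp contDiff_fst).scaledStretch _ (fun p ↦ hm0 p.1)
      ((hl.comp contDiff_fst).scaledStretch _ (fun p ↦ hl0 p.1) contDiff_snd)
  · exact (hl'.comp contDiff_fst).scaledStretch _ (fun p ↦ inv_pos.2 (hl0 p.1))
      ((hm'.comp contDiff_fst).scaledStretch _ (fun p ↦ inv_pos.2 (hm0 p.1)) contDiff_snd)
  · intro t x
    simp only
    rw [scaledStretch_inv_scaledStretch hπ (hm0 t), scaledStretch_inv_scaledStretch hπ2 (hl0 t)]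
  · intro t x
    have h1 := scaledStretch_inv_scaledStretch hπ (inv_pos.2 (hm0 t)) x
    have h2 := scaledStretch_inv_scaledStretch hπ2 (inv_pos.2 (hl0 t))
    rw [inv_inv] at h1 h2
    simp only
    rw [h2, h1]
  · intro t
    simp only [fix0 _ _ hπ, fix0 _ _ hπ2]
  · intro t
    simp only [fix1, fix1']
  · intro t
    have h : HasDerivAt (scaledStretch Real.pi √(a t * b t)) √(a t * b t)
        (scaledStretch (Real.pi / 2) √(a t / b t) 0) := by
      rw [fix0 _ _ hπ2]; exact der0 _ _ hπ
    refine (h.comp 0 (der0 _ _ hπ2)).congr_deriv ?_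
    rw [← Real.sqrt_mul (mul_pos (ha0 t) (hb0 t)).le, Real.sqrt_eq_iff_mul_self_eq_of_pos (ha0 t)]
    have := (hb0 t).ne'
    field_simp
  · intro t
    have h : HasDerivAt (scaledStretch Real.pi √(a t * b t)) √(a t * b t)
        (scaledStretch (Real.pi / 2) √(a t / b t) 1) := by
      rw [fix1]
      exact (hasDerivAt_stretchAngle_of_sin_eq_zero (by simp)).scaledStretch hπ
    have h' : HasDerivAt (scaledStretch (Real.pi / 2) √(a t / b t)) (√(a t / b t))⁻¹ 1 :=
      (hasDerivAt_stretchAngle_of_cos_eq_zero (hl0 t).ne' (by simp)).scaledStretch hπ2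
    refine (h.comp 1 h').congr_deriv ?_
    rw [← Real.sqrt_inv, ← Real.sqrt_mul (mul_pos (ha0 t) (hb0 t)).le,
      Real.sqrt_eq_iff_mul_self_eq_of_pos (hb0 t)]
    have := (ha0 t).ne'
    field_simp
  · intro t h1 h2
    ext x
    simp [h1, h2, scaledStretch_one hπ, scaledStretch_one hπ2]

/-- A positive `C^n` function near a closed set agrees on this set with a positive `C^n` function
defined everywhere. -/
theorem exists_contDiff_pos_eqOn {E : Type*} [NormedAddCommGroup E] [NormedSpace ℝ E]
    [FiniteDimensional ℝ E] {n : ℕ∞} {f : E → ℝ} {K V : Set E} (hK : IsClosed K) (hV : IsOpen V)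
    (hKV : K ⊆ V) (hf : ContDiffOn ℝ n f V) (hpos : ∀ x ∈ V, 0 < f x) :
    ∃ g : E → ℝ, ContDiff ℝ n g ∧ (∀ x, 0 < g x) ∧ EqOn g f K := by
  obtain ⟨χ, h0, h1, hχ⟩ := exists_contMDiffMap_zero_one_nhds_of_isClosed (n := n)
    (modelWithCornersSelf ℝ E) hV.isClosed_compl hK (disjoint_compl_left_iff_subset.2 hKV)
  have hχd : ContDiff ℝ n χ := χ.contMDiff.contDiff
  refine ⟨fun x ↦ 1 + χ x * (f x - 1), ?_, ?_, ?_⟩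
  · rw [contDiff_iff_contDiffAt]
    intro x
    by_cases hx : x ∈ V
    · exact contDiffAt_const.add (hχd.contDiffAt.mul
        ((hf.contDiffAt (hV.mem_nhds hx)).sub contDiffAt_const))
    · refine (contDiffAt_const (c := (1 : ℝ))).congr_of_eventuallyEq ?_
      filter_upwards [h0.filter_mono (nhds_le_nhdsSet hx)] with y hy
      simp [hy]
  · intro x
    by_cases hx : x ∈ V
    · have := hpos x hx
      nlinarith [mul_nonneg (hχ x).1 this.le, (hχ x).1, (hχ x).2, mul_pos this this]
    · simp [h0.self_of_nhdsSet x hx]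
  · intro x hx
    simp [h1.self_of_nhdsSet x hx]

/-- The map of the plane acting on the `i`-th coordinate by `φ t`, where `t` is the
`j`-th coordinate. -/
def coordMap (i j : Fin 2) (φ : ℝ → ℝ → ℝ) (p : Fin 2 → ℝ) : Fin 2 → ℝ :=
  Function.update p i (φ (p j) (p i))

theorem contDiff_coordMap {n : WithTop ℕ∞} {i j : Fin 2} {φ : ℝ → ℝ → ℝ}
    (hφ : ContDiff ℝ n (Function.uncurry φ)) : ContDiff ℝ n (coordMap i j φ) := by
  rw [contDiff_pi]
  intro m
  by_cases hm : m = i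
  · subst hm
    simpa [coordMap, Function.comp_def] using hφ.comp ((contDiff_apply ℝ ℝ j).prodMk (contDiff_apply ℝ ℝ m))
  · simpa [coordMap, hm] using contDiff_apply ℝ ℝ m

theorem leftInverse_coordMap {i j : Fin 2} (hij : i ≠ j) {φ ψ : ℝ → ℝ → ℝ}
    (h : ∀ t, Function.LeftInverse (ψ t) (φ t)) :
    Function.LeftInverse (coordMap i j ψ) (coordMap i j φ) := by
  intro p
  simp [coordMap, hij.symm, h (p j) (p i)]

theorem det_fderiv_coordMap {i j : Fin 2} (hij : i ≠ j) {φ : ℝ → ℝ → ℝ} {p : Fin 2 → ℝ} {c : ℝ}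
    (hd : DifferentiableAt ℝ (coordMap i j φ) p) (hc : HasDerivAt (φ (p j)) c (p i)) :
    LinearMap.det (fderiv ℝ (coordMap i j φ) p).toLinearMap = c := by
  have entry : ∀ m l, fderiv ℝ (coordMap i j φ) p (Pi.single l 1) m =
      fderiv ℝ (fun q ↦ coordMap i j φ q m) p (Pi.single l 1) := by
    intro m l
    rw [fderiv_pi (fun m ↦ differentiableAt_pi.1 hd m)]
    rfl
  have hj : ∀ l, fderiv ℝ (coordMap i j φ) p (Pi.single l 1) j = (Pi.single l 1 : Fin 2 → ℝ) j := by
    intro l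
    rw [entry]
    have : (fun q ↦ coordMap i j φ q j) = (ContinuousLinearMap.proj j : (Fin 2 → ℝ) →L[ℝ] ℝ) := by
      ext q; simp [coordMap, hij.symm]
    rw [this, ContinuousLinearMap.fderiv]
    rfl
  have hi : fderiv ℝ (coordMap i j φ) p (Pi.single i 1) i = c := by
    have h1 : HasDerivAt (Function.update p i) (Pi.single i (1 : ℝ)) (p i) := hasDerivAt_update p i _
    have h2 : HasFDerivAt (coordMap i j φ) (fderiv ℝ (coordMap i j φ) p)
        (Function.update p i (p i)) := by
      simpa using hd.hasFDerivAt
    have h3 := hasDerivAt_pi.1 (h2.comp_hasDerivAt (p i) h1) i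
    refine h3.unique (hc.congr_of_eventuallyEq (.of_forall fun x ↦ ?_))
    simp [coordMap, hij.symm]
  rw [← LinearMap.det_toMatrix', Matrix.det_fin_two]
  simp only [LinearMap.toMatrix'_apply, ContinuousLinearMap.coe_coe]
  fin_cases i <;> fin_cases j <;> simp_all

theorem mem_zero_one_of_mem_frontier {p : Fin 2 → ℝ}
    (hp : p ∈ frontier (Icc (0 : Fin 2 → ℝ) 1)) : ∃ i, p i = 0 ∨ p i = 1 := by
  have hI := isClosed_Icc.frontier_subset hp
  by_contra! h
  refine hp.2 ?_
  rw [← pi_univ_Icc, interior_pi_set finite_univ]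
  intro i _
  simp only [interior_Icc]
  exact ⟨lt_of_le_of_ne (hI.1 i) (h i).1.symm, lt_of_le_of_ne (hI.2 i) (h i).2⟩

/-- A diffeomorphism of the plane moving only the `i`-th coordinate, fixing the boundary lines of
the square, with Jacobian determinant `F` on the edges where the `i`-th coordinate is
constant and `1` on the other edges. -/
theorem exists_edge_diffeo {n : WithTop ℕ∞} (hn : n ≠ 0) {F : (Fin 2 → ℝ) → ℝ} (hF : ContDiff ℝ n F)
    (hpos : ∀ p, 0 < F p) (hcorners : ∀ p : Fin 2 → ℝ, (∀ i, p i = 0 ∨ p i = 1) → F p = 1)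
    {i j : Fin 2} (hij : i ≠ j) :
    ∃ v w : (Fin 2 → ℝ) → (Fin 2 → ℝ), ContDiff ℝ n v ∧ ContDiff ℝ n w ∧
      Function.LeftInverse w v ∧ Function.RightInverse w v ∧
      (∀ p, (p i = 0 ∨ p i = 1) →
        v p = p ∧ LinearMap.det (fderiv ℝ v p).toLinearMap = F p) ∧
      (∀ p, (p j = 0 ∨ p j = 1) →
        v p = p ∧ LinearMap.det (fderiv ℝ v p).toLinearMap = 1) := by
  have hline : ∀ e : ℝ, ContDiff ℝ n fun t : ℝ ↦ F (Function.update (fun _ ↦ t) i e) := by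
    intro e
    refine hF.comp (contDiff_pi.2 fun m ↦ ?_)
    by_cases hm : m = i
    · subst hm
      simpa using contDiff_const
    · simpa [hm] using contDiff_fun_id
  have hupd : ∀ p : Fin 2 → ℝ, Function.update (fun _ ↦ p j) i (p i) = p := by
    intro p
    ext m
    by_cases hm : m = i
    · simp [hm]
    · have : m = j := by omega
      simp [this, hij.symm]
  have hend : ∀ t e : ℝ, (t = 0 ∨ t = 1) → (e = 0 ∨ e = 1) →
      F (Function.update (fun _ ↦ t) i e) = 1 := by
    intro t e ht he
    refine hcorners _ fun m ↦ ?_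
    by_cases hm : m = i
    · simpa [hm] using he
    · simpa [hm] using ht
  obtain ⟨φ, ψ, hφ, hψ, hl, hr, h0, h1, hd0, hd1, hid⟩ :=
    exists_diffeo_family (hline 0) (hline 1) (fun _ ↦ hpos _) (fun _ ↦ hpos _)
  have hdiff := (contDiff_coordMap (i := i) (j := j) hφ).differentiable hn
  refine ⟨coordMap i j φ, coordMap i j ψ, contDiff_coordMap hφ, contDiff_coordMap hψ,
    leftInverse_coordMap hij hl, leftInverse_coordMap hij hr, fun p hp ↦ ⟨?_, ?_⟩,
    fun p hp ↦ ⟨?_, ?_⟩⟩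
  · rcases hp with hp | hp
    · rw [coordMap, hp, h0, ← hp, Function.update_eq_self]
    · rw [coordMap, hp, h1, ← hp, Function.update_eq_self]
  · refine det_fderiv_coordMap hij (hdiff p) ?_
    have hp' := hupd p
    rcases hp with hp | hp <;> rw [hp] at hp' ⊢
    · simpa [hp'] using hd0 (p j)
    · simpa [hp'] using hd1 (p j)
  · rw [coordMap, hid (p j) (hend _ _ hp (.inl rfl)) (hend _ _ hp (.inr rfl)), id,
      Function.update_eq_self]
  · refine det_fderiv_coordMap hij (hdiff p) ?_
    rw [hid (p j) (hend _ _ hp (.inl rfl)) (hend _ _ hp (.inr rfl))]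
    exact hasDerivAt_id _

/-- **Separation lemma for the square.**  If `f > 0` is `C^k` on a neighborhood of
`B = [0,1]²` and `f = 1` at the four corners of `B`, then there is a `C^k`
diffeomorphism `v` of `ℝ²` with `det(Dv) = f` on `∂B` and `v = id` on `∂B`. -/
theorem square_separation (k : ℕ) (hk : 1 ≤ k)
    (f : (Fin 2 → ℝ) → ℝ) (V : Set (Fin 2 → ℝ)) (hV : IsOpen V)
    (hBV : Set.Icc (0 : Fin 2 → ℝ) 1 ⊆ V)
    (hf : ContDiffOn ℝ (k : ℕ∞) f V) (hfpos : ∀ x ∈ V, 0 < f x)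
    (hcorners : ∀ x : Fin 2 → ℝ, (∀ i, x i = 0 ∨ x i = 1) → f x = 1) :
    ∃ v : (Fin 2 → ℝ) → (Fin 2 → ℝ),
      ContDiff ℝ (k : ℕ∞) v ∧
      (∃ w, ContDiff ℝ (k : ℕ∞) w ∧ Function.LeftInverse w v ∧ Function.RightInverse w v) ∧
      (∀ x ∈ frontier (Set.Icc (0 : Fin 2 → ℝ) 1),
        LinearMap.det (fderiv ℝ v x).toLinearMap = f x) ∧
      (∀ x ∈ frontier (Set.Icc (0 : Fin 2 → ℝ) 1), v x = x) := by
  have hk0 : (((k : ℕ∞)) : WithTop ℕ∞) ≠ 0 := by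
    simpa using Nat.one_le_iff_ne_zero.1 hk
  obtain ⟨F, hF, hFpos, hFf⟩ := exists_contDiff_pos_eqOn isClosed_Icc hV hBV hf hfpos
  have hFc : ∀ p : Fin 2 → ℝ, (∀ i, p i = 0 ∨ p i = 1) → F p = 1 := by
    intro p hp
    rw [hFf ⟨fun i ↦ ?_, fun i ↦ ?_⟩, hcorners p hp] <;> rcases hp i with h | h <;> simp [h]
  obtain ⟨v₁, w₁, hv₁, hw₁, hl₁, hr₁, he₁, ho₁⟩ :=
    exists_edge_diffeo hk0 hF hFpos hFc (i := 0) (j := 1) (by simp)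
  obtain ⟨v₂, w₂, hv₂, hw₂, hl₂, hr₂, he₂, ho₂⟩ :=
    exists_edge_diffeo hk0 hF hFpos hFc (i := 1) (j := 0) (by simp)
  have key : ∀ p ∈ frontier (Icc (0 : Fin 2 → ℝ) 1), v₁ p = p ∧ v₂ p = p ∧
      LinearMap.det (fderiv ℝ v₁ p).toLinearMap * LinearMap.det (fderiv ℝ v₂ p).toLinearMap
        = F p := by
    intro p hp
    obtain ⟨i, hi⟩ := mem_zero_one_of_mem_frontier hp
    fin_cases i
    · exact ⟨(he₁ p hi).1, (ho₂ p hi).1, by rw [(he₁ p hi).2, (ho₂ p hi).2, mul_one]⟩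
    · exact ⟨(ho₁ p hi).1, (he₂ p hi).1, by rw [(ho₁ p hi).2, (he₂ p hi).2, one_mul]⟩
  refine ⟨v₁ ∘ v₂, hv₁.comp hv₂, ⟨w₂ ∘ w₁, hw₂.comp hw₁, hl₁.comp hl₂, hr₁.comp hr₂⟩,
    fun p hp ↦ ?_, fun p hp ↦ ?_⟩
  · obtain ⟨-, h2, h3⟩ := key p hp
    rw [fderiv_comp p (hv₁.differentiable hk0 _) (hv₂.differentiable hk0 _), h2,
      ContinuousLinearMap.toLinearMap_comp, LinearMap.det_comp, h3,
      hFf (isClosed_Icc.frontier_subset hp)]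
  · obtain ⟨h1, h2, -⟩ := key p hp
    rw [Function.comp_apply, h2, h1]
end

section
/- Let k ≥ 1 be an integer, B = [0,1]² ⊂ ℝ², and let f : ℝ² → ℝ be a positive C^k function which equals 1 at each of the four corners (ε₁, ε₂) with ε₁, ε₂ ∈ {0,1}. Then there exists a C^k diffeomorphism v : ℝ² → ℝ² such that v(x) = x for all x ∈ ∂B and det(Dv(x)) · f(v(x)) = 1 for all x ∈ ∂B. -/
open Set

open Filter

/-- A `C^n` bijection of a finite-dimensional space with nonvanishing Jacobian determinant has a
`C^n` inverse. -/
theorem ContDiff.exists_contDiff_inverse {E : Type*} [NormedAddCommGroup E] [NormedSpace ℝ E]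
    [FiniteDimensional ℝ E] {n : WithTop ℕ∞} {v : E → E} (hv : ContDiff ℝ n v) (hn : n ≠ 0)
    (hbij : Function.Bijective v) (hdet : ∀ x, (fderiv ℝ v x).det ≠ 0) :
    ∃ w, ContDiff ℝ n w ∧ Function.LeftInverse w v ∧ Function.RightInverse w v := by
  have : CompleteSpace E := FiniteDimensional.complete ℝ E
  have hstrict (x : E) : HasStrictFDerivAt v
      ((fderiv ℝ v x).toContinuousLinearEquivOfDetNeZero (hdet x) : E →L[ℝ] E) x := by
    simpa using hv.contDiffAt.hasStrictFDerivAt hn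
  let e := (Equiv.ofBijective v hbij).toHomeomorphOfContinuousOpen hv.continuous
    (isOpenMap_of_hasStrictFDerivAt_equiv hstrict)
  exact ⟨e.symm, e.contDiff_symm (fun x ↦ (hstrict x).hasFDerivAt) hv,
    e.symm_apply_apply, e.apply_symm_apply⟩

theorem mem_Icc_and_exists_of_mem_frontier_Icc {ι : Type*} [Finite ι] {x : ι → ℝ}
    (hx : x ∈ frontier (Icc (0 : ι → ℝ) 1)) :
    (∀ i, x i ∈ Icc (0 : ℝ) 1) ∧ ∃ i, x i = 0 ∨ x i = 1 := by
  rw [isClosed_Icc.frontier_eq, ← pi_univ_Icc, interior_pi_set finite_univ] at hx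
  obtain ⟨hmem, hint⟩ := hx
  have hmem' : ∀ i, x i ∈ Icc (0 : ℝ) 1 := fun i ↦ hmem i (mem_univ i)
  refine ⟨hmem', ?_⟩
  by_contra! h
  refine hint fun i _ ↦ ?_
  simp only [Pi.zero_apply, Pi.one_apply, interior_Icc]
  exact ⟨(hmem' i).1.lt_of_ne' (h i).1, (hmem' i).2.lt_of_ne (h i).2⟩

/-- `d` is the Jacobian determinant along the boundary of the unit square of some
`C^n` diffeomorphism of the plane that fixes this boundary pointwise. -/
def IsBoundaryJacobian (n : WithTop ℕ∞) (d : (Fin 2 → ℝ) → ℝ) : Prop :=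
  ∃ v : (Fin 2 → ℝ) → (Fin 2 → ℝ),
    ContDiff ℝ n v ∧
    (∃ w, ContDiff ℝ n w ∧ Function.LeftInverse w v ∧ Function.RightInverse w v) ∧
    (∀ x ∈ frontier (Icc (0 : Fin 2 → ℝ) 1), v x = x) ∧
    ∀ x ∈ frontier (Icc (0 : Fin 2 → ℝ) 1), (fderiv ℝ v x).det = d x

namespace IsBoundaryJacobian

variable {n : WithTop ℕ∞} {d e : (Fin 2 → ℝ) → ℝ}

theorem congr (hd : IsBoundaryJacobian n d)
    (h : ∀ x ∈ frontier (Icc (0 : Fin 2 → ℝ) 1), d x = e x) : IsBoundaryJacobian n e := by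
  obtain ⟨v, hv, hw, hfix, hdet⟩ := hd
  exact ⟨v, hv, hw, hfix, fun x hx ↦ (hdet x hx).trans (h x hx)⟩

theorem one : IsBoundaryJacobian n 1 :=
  ⟨id, contDiff_id, ⟨id, contDiff_id, fun _ ↦ rfl, fun _ ↦ rfl⟩, fun _ _ ↦ rfl,
    fun x _ ↦ by simp [ContinuousLinearMap.det]⟩

theorem mul (hn : n ≠ 0) (hd : IsBoundaryJacobian n d) (he : IsBoundaryJacobian n e) :
    IsBoundaryJacobian n (d * e) := by
  obtain ⟨v, hv, ⟨v', hv', hvl, hvr⟩, hvfix, hvdet⟩ := hd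
  obtain ⟨w, hw, ⟨w', hw', hwl, hwr⟩, hwfix, hwdet⟩ := he
  refine ⟨v ∘ w, hv.comp hw, ⟨w' ∘ v', hw'.comp hv', hvl.comp hwl, hvr.comp hwr⟩,
    fun x hx ↦ by simp [hvfix x hx, hwfix x hx], fun x hx ↦ ?_⟩
  rw [fderiv_comp x (hv.differentiable hn _) (hw.differentiable hn _), hwfix x hx, Pi.mul_apply,
    ← hvdet x hx, ← hwdet x hx]
  exact LinearMap.det_comp _ _

theorem pow (hn : n ≠ 0) (hd : IsBoundaryJacobian n d) (m : ℕ) :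
    IsBoundaryJacobian n (d ^ m) := by
  induction m with
  | zero => simpa using one
  | succ m ih => simpa [pow_succ] using ih.mul hn hd

end IsBoundaryJacobian

/-- A bounded function with slope `1` at the zero `0` and slope `0` at the zeros `1` and `-1`,
whose slopes are bounded by `1`. -/
noncomputable def sineProfile (t : ℝ) : ℝ :=
  (Real.sin (Real.pi * t) + Real.sin (2 * Real.pi * t) / 2) / (2 * Real.pi)

theorem contDiff_sineProfile {n : WithTop ℕ∞} : ContDiff ℝ n sineProfile := by
  unfold sineProfile
  fun_prop

theorem hasDerivAt_sineProfile (t : ℝ) :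
    HasDerivAt sineProfile ((Real.cos (Real.pi * t) + Real.cos (2 * Real.pi * t)) / 2) t := by
  have h₁ := ((hasDerivAt_id t).const_mul Real.pi).sin
  have h₂ := (((hasDerivAt_id t).const_mul (2 * Real.pi)).sin).div_const 2
  refine ((h₁.add h₂).div_const (2 * Real.pi)).congr_deriv ?_
  simp only [id]
  field_simp

theorem abs_deriv_sineProfile_le (t : ℝ) : |deriv sineProfile t| ≤ 1 := by
  rw [(hasDerivAt_sineProfile t).deriv, abs_le]
  constructor <;>
    linarith [Real.cos_le_one (Real.pi * t), Real.cos_le_one (2 * Real.pi * t),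
      Real.neg_one_le_cos (Real.pi * t), Real.neg_one_le_cos (2 * Real.pi * t)]

theorem abs_sineProfile_le (t : ℝ) : |sineProfile t| ≤ 1 := by
  have hpi := Real.pi_gt_three
  rw [sineProfile, abs_div, abs_of_pos (by positivity : 0 < 2 * Real.pi), div_le_one (by positivity),
    abs_le]
  constructor <;>
    linarith [Real.sin_le_one (Real.pi * t), Real.sin_le_one (2 * Real.pi * t),
      Real.neg_one_le_sin (Real.pi * t), Real.neg_one_le_sin (2 * Real.pi * t)]

@[simp] theorem sineProfile_zero : sineProfile 0 = 0 := by simp [sineProfile]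

@[simp] theorem sineProfile_one : sineProfile 1 = 0 := by simp [sineProfile]

@[simp] theorem sineProfile_neg_one : sineProfile (-1) = 0 := by simp [sineProfile]

@[simp] theorem deriv_sineProfile_zero : deriv sineProfile 0 = 1 := by
  simp [(hasDerivAt_sineProfile 0).deriv]

@[simp] theorem deriv_sineProfile_one : deriv sineProfile 1 = 0 := by
  simp [(hasDerivAt_sineProfile 1).deriv]

@[simp] theorem deriv_sineProfile_neg_one : deriv sineProfile (-1) = 0 := by
  simp [(hasDerivAt_sineProfile (-1)).deriv]

theorem bijective_add_sineProfile_mul (c : ℝ) {s : ℝ} (hs : |s| < 1) :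
    Function.Bijective fun t ↦ t + sineProfile (t - c) * s := by
  have hderiv (t : ℝ) : HasDerivAt (fun t ↦ t + sineProfile (t - c) * s)
      (1 + deriv sineProfile (t - c) * s) t := by
    have h := (hasDerivAt_sineProfile (t - c)).differentiableAt.hasDerivAt.comp_sub_const t c
    exact (hasDerivAt_id t).add (h.mul_const s)
  have hcont : Continuous fun t ↦ t + sineProfile (t - c) * s :=
    continuous_iff_continuousAt.2 fun t ↦ (hderiv t).continuousAt
  have hbound (t : ℝ) : |sineProfile (t - c) * s| ≤ 1 := by
    rw [abs_mul]
    exact mul_le_one₀ (abs_sineProfile_le _) (abs_nonneg _) hs.le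
  refine ⟨(strictMono_of_deriv_pos fun t ↦ ?_).injective, hcont.surjective ?_ ?_⟩
  · have h : |deriv sineProfile (t - c) * s| < 1 := by
      rw [abs_mul]
      exact mul_lt_one_of_nonneg_of_lt_one_right (abs_deriv_sineProfile_le _) (abs_nonneg _) hs
    rw [(hderiv t).deriv]
    linarith [(abs_lt.1 h).1]
  · exact tendsto_atTop_add_right_of_le _ (-1) tendsto_id fun t ↦ (abs_le.1 (hbound t)).1
  · exact tendsto_atBot_add_right_of_ge _ 1 tendsto_id fun t ↦ (abs_le.1 (hbound t)).2

/-- The map moving the `j`-th coordinate near the line `x j = c` by an amount depending on the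
`i`-th coordinate. -/
noncomputable def sineShear (i j : Fin 2) (c : ℝ) (a : ℝ → ℝ) (x : Fin 2 → ℝ) : Fin 2 → ℝ :=
  x + (sineProfile (x j - c) * a (x i)) • Pi.single j 1

section sineShear

variable {i j : Fin 2} {n : WithTop ℕ∞} {a : ℝ → ℝ}

theorem contDiff_sineShear (c : ℝ) (ha : ContDiff ℝ n a) : ContDiff ℝ n (sineShear i j c a) := by
  have := contDiff_sineProfile (n := n)
  unfold sineShear
  fun_prop

theorem det_fderiv_sineShear (hij : i ≠ j) (c : ℝ) (ha : Differentiable ℝ a) (x : Fin 2 → ℝ) :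
    (fderiv ℝ (sineShear i j c a) x).det = 1 + deriv sineProfile (x j - c) * a (x i) := by
  have hsub : HasFDerivAt (fun x : Fin 2 → ℝ ↦ x j - c)
      (ContinuousLinearMap.proj (R := ℝ) (φ := fun _ ↦ ℝ) j) x :=
    (hasFDerivAt_apply (𝕜 := ℝ) j x).sub_const c
  have hj : HasFDerivAt (fun x : Fin 2 → ℝ ↦ sineProfile (x j - c))
      (deriv sineProfile (x j - c) • ContinuousLinearMap.proj (R := ℝ) j) x :=
    HasDerivAt.comp_hasFDerivAt (h₂ := sineProfile) x
      (hasDerivAt_sineProfile (x j - c)).differentiableAt.hasDerivAt hsub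
  have hi : HasFDerivAt (fun x : Fin 2 → ℝ ↦ a (x i))
      (deriv a (x i) • ContinuousLinearMap.proj (R := ℝ) i) x :=
    (ha (x i)).hasDerivAt.comp_hasFDerivAt x (hasFDerivAt_apply i x)
  have h := (hasFDerivAt_id x).add ((hj.mul hi).smul_const (Pi.single j (1 : ℝ)))
  have hfderiv : fderiv ℝ (sineShear i j c a) x = _ := HasFDerivAt.fderiv h
  rw [hfderiv]
  refine (LinearMap.transvection.det _ _).trans ?_
  simp [hij, mul_comm]

theorem bijective_sineShear (hij : i ≠ j) (c : ℝ) (hbound : ∀ t, |a t| < 1) :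
    Function.Bijective (sineShear i j c a) := by
  have happ_i (x) : sineShear i j c a x i = x i := by simp [sineShear, hij]
  have happ_j (x) : sineShear i j c a x j = x j + sineProfile (x j - c) * a (x i) := by
    simp [sineShear]
  have hcases (l : Fin 2) : l = i ∨ l = j := by omega
  constructor
  · intro x y hxy
    have hi : x i = y i := by rw [← happ_i x, hxy, happ_i]
    have hj : x j = y j := by
      refine (bijective_add_sineProfile_mul c (hbound (x i))).injective ?_
      rw [← happ_j, hxy, happ_j, hi]
    ext l
    obtain rfl | rfl := hcases l <;> assumption
  · intro y
    obtain ⟨t, ht⟩ := (bijective_add_sineProfile_mul c (hbound (y i))).surjective (y j)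
    refine ⟨Function.update y j t, ?_⟩
    ext l
    obtain rfl | rfl := hcases l
    · simp [happ_i, hij]
    · simpa [happ_j, hij] using ht

theorem isBoundaryJacobian_ite_one_add (hn : n ≠ 0) (hij : i ≠ j) {c : ℝ} (hc : c = 0 ∨ c = 1)
    (ha : ContDiff ℝ n a) (hbound : ∀ t, |a t| < 1) (ha₀ : a 0 = 0) (ha₁ : a 1 = 0) :
    IsBoundaryJacobian n fun x ↦ if x j = c then 1 + a (x i) else 1 := by
  have hdet := det_fderiv_sineShear hij c (ha.differentiable hn)
  have hcases {x : Fin 2 → ℝ} (hx : x ∈ frontier (Icc (0 : Fin 2 → ℝ) 1)) :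
      a (x i) = 0 ∨ x j = 0 ∨ x j = 1 := by
    obtain ⟨l, hl⟩ := (mem_Icc_and_exists_of_mem_frontier_Icc hx).2
    obtain rfl | rfl : l = i ∨ l = j := by omega
    · obtain h | h := hl <;> simp [h, ha₀, ha₁]
    · exact Or.inr hl
  have hcont := contDiff_sineShear (i := i) (j := j) c ha
  refine ⟨sineShear i j c a, hcont,
    hcont.exists_contDiff_inverse hn (bijective_sineShear hij c hbound) fun x ↦ ?_,
    fun x hx ↦ ?_, fun x hx ↦ ?_⟩
  · have h : |deriv sineProfile (x j - c) * a (x i)| < 1 := by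
      rw [abs_mul]
      exact mul_lt_one_of_nonneg_of_lt_one_right (abs_deriv_sineProfile_le _) (abs_nonneg _)
        (hbound _)
    rw [hdet]
    linarith [(abs_lt.1 h).1]
  · rw [sineShear, add_eq_left]
    obtain h | h | h := hcases hx <;> obtain rfl | rfl := hc <;> simp [h]
  · rw [hdet]
    obtain h | h | h := hcases hx <;> obtain rfl | rfl := hc <;> simp [h]

theorem isBoundaryJacobian_ite_exp (hn : n ≠ 0) (hn' : n ≤ (⊤ : ℕ∞)) (hij : i ≠ j) {c : ℝ}
    (hc : c = 0 ∨ c = 1) {L : ℝ → ℝ} (hL : ContDiff ℝ n L) (hL₀ : L 0 = 0) (hL₁ : L 1 = 0) :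
    IsBoundaryJacobian n fun x ↦ if x j = c then Real.exp (L (x i)) else 1 := by
  let χ : ContDiffBump (1 / 2 : ℝ) := ⟨1 / 2, 1, by norm_num, by norm_num⟩
  have hχ : ContDiff ℝ n χ := χ.contDiff.of_le hn'
  obtain ⟨M, hM⟩ := (χ.hasCompactSupport.mul_right (f' := L)).exists_bound_of_continuous
    (hχ.continuous.mul hL.continuous)
  obtain ⟨N, hN⟩ := exists_nat_gt (max 1 (4 * M))
  have hN₁ : (1 : ℝ) < N := (le_max_left _ _).trans_lt hN
  have hNM : 4 * M < N := (le_max_right _ _).trans_lt hN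
  have hbound (t : ℝ) : |Real.exp (χ t * L t / N) - 1| < 1 := by
    have h : |χ t * L t / N| ≤ 1 / 4 := by
      rw [abs_div, Nat.abs_cast, div_le_iff₀ (by linarith)]
      have hMt : |χ t * L t| ≤ M := hM t
      linarith
    linarith [Real.abs_exp_sub_one_le (h.trans (by norm_num))]
  have hroot := (isBoundaryJacobian_ite_one_add hn hij hc
    (a := fun t ↦ Real.exp (χ t * L t / N) - 1) (by fun_prop) hbound
    (by simp [hL₀]) (by simp [hL₁])).pow hn N
  refine hroot.congr fun x hx ↦ ?_
  have hxi := (mem_Icc_and_exists_of_mem_frontier_Icc hx).1 i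
  have hχx : χ (x i) = 1 := by
    refine χ.one_of_mem_closedBall ?_
    rw [Metric.mem_closedBall, Real.dist_eq, abs_le]
    constructor <;> norm_num [χ] <;> linarith [hxi.1, hxi.2]
  have hN₀ : (N : ℝ) ≠ 0 := by linarith
  by_cases h : x j = c
  · simp [h, hχx, ← Real.exp_nat_mul, mul_div_cancel₀ _ hN₀]
  · simp [h]

end sineShear

theorem isBoundaryJacobian_inv {n : WithTop ℕ∞} (hn : n ≠ 0) (hn' : n ≤ (⊤ : ℕ∞))
    {f : (Fin 2 → ℝ) → ℝ} (hf : ContDiff ℝ n f) (hfpos : ∀ x, 0 < f x)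
    (hcorners : ∀ x : Fin 2 → ℝ, (∀ i, x i = 0 ∨ x i = 1) → f x = 1) :
    IsBoundaryJacobian n fun x ↦ (f x)⁻¹ := by
  have hhor {c : ℝ} (hc : c = 0 ∨ c = 1) :
      IsBoundaryJacobian n fun x ↦ if x 1 = c then (f x)⁻¹ else 1 := by
    have hline : ContDiff ℝ n fun t : ℝ ↦ (![t, c] : Fin 2 → ℝ) := by
      rw [contDiff_pi, Fin.forall_fin_two]
      exact ⟨contDiff_id, contDiff_const⟩
    refine (isBoundaryJacobian_ite_exp hn hn' (zero_ne_one (α := Fin 2)) hc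
      (L := fun t ↦ -Real.log (f ![t, c])) ((hf.comp hline).log fun t ↦ (hfpos _).ne').neg
      ?_ ?_).congr fun x _ ↦ ?_
    · simp [hcorners ![0, c] (by simpa [Fin.forall_fin_two] using hc)]
    · simp [hcorners ![1, c] (by simpa [Fin.forall_fin_two] using hc)]
    · refine if_ctx_congr Iff.rfl (fun h ↦ ?_) fun _ ↦ rfl
      have hx : ![x 0, c] = x := by ext l; fin_cases l <;> simp [h]
      rw [hx, Real.exp_neg, Real.exp_log (hfpos x)]
  have hver {c : ℝ} (hc : c = 0 ∨ c = 1) :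
      IsBoundaryJacobian n fun x ↦ if x 0 = c then (f x)⁻¹ else 1 := by
    have hline : ContDiff ℝ n fun t : ℝ ↦ (![c, t] : Fin 2 → ℝ) := by
      rw [contDiff_pi, Fin.forall_fin_two]
      exact ⟨contDiff_const, contDiff_id⟩
    refine (isBoundaryJacobian_ite_exp hn hn' (one_ne_zero (α := Fin 2)) hc
      (L := fun t ↦ -Real.log (f ![c, t])) ((hf.comp hline).log fun t ↦ (hfpos _).ne').neg
      ?_ ?_).congr fun x _ ↦ ?_
    · simp [hcorners ![c, 0] (by simpa [Fin.forall_fin_two] using hc)]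
    · simp [hcorners ![c, 1] (by simpa [Fin.forall_fin_two] using hc)]
    · refine if_ctx_congr Iff.rfl (fun h ↦ ?_) fun _ ↦ rfl
      have hx : ![c, x 1] = x := by ext l; fin_cases l <;> simp [h]
      rw [hx, Real.exp_neg, Real.exp_log (hfpos x)]
  refine (((hhor (Or.inl rfl)).mul hn (hhor (Or.inr rfl))).mul hn
    ((hver (Or.inl rfl)).mul hn (hver (Or.inr rfl)))).congr fun x hx ↦ ?_
  have hcorner (h₀ : x 0 = 0 ∨ x 0 = 1) (h₁ : x 1 = 0 ∨ x 1 = 1) : f x = 1 :=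
    hcorners x (Fin.forall_fin_two.2 ⟨h₀, h₁⟩)
  have hside := (mem_Icc_and_exists_of_mem_frontier_Icc hx).2
  rw [Fin.exists_fin_two] at hside
  by_cases h₀ : x 0 = 0 ∨ x 0 = 1 <;> by_cases h₁ : x 1 = 0 ∨ x 1 = 1
  · simp [hcorner h₀ h₁]
  · obtain h | h := h₀ <;> simp_all
  · obtain h | h := h₁ <;> simp_all
  · exact absurd hside (by tauto)

/-- If `f : ℝ² → ℝ` is a positive `C^k` function equal to `1` at the four corners of
`B = [0,1]²`, then there is a `C^k` diffeomorphism `v` of `ℝ²` fixing `∂B` pointwise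
such that `det(Dv) · (f ∘ v) = 1` on `∂B`. -/
theorem square_separation_corollary (k : ℕ) (hk : 1 ≤ k)
    (f : (Fin 2 → ℝ) → ℝ) (hf : ContDiff ℝ (k : ℕ∞) f) (hfpos : ∀ x, 0 < f x)
    (hcorners : ∀ x : Fin 2 → ℝ, (∀ i, x i = 0 ∨ x i = 1) → f x = 1) :
    ∃ v : (Fin 2 → ℝ) → (Fin 2 → ℝ),
      ContDiff ℝ (k : ℕ∞) v ∧
      (∃ w, ContDiff ℝ (k : ℕ∞) w ∧ Function.LeftInverse w v ∧ Function.RightInverse w v) ∧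
      (∀ x ∈ frontier (Set.Icc (0 : Fin 2 → ℝ) 1), v x = x) ∧
      (∀ x ∈ frontier (Set.Icc (0 : Fin 2 → ℝ) 1),
        LinearMap.det (fderiv ℝ v x).toLinearMap * f (v x) = 1) := by
  have hk₀ : ((k : ℕ∞) : WithTop ℕ∞) ≠ 0 := by
    norm_cast
    omega
  obtain ⟨v, hv, hw, hfix, hdet⟩ :=
    isBoundaryJacobian_inv hk₀ (by exact_mod_cast le_top) hf hfpos hcorners
  refine ⟨v, hv, hw, hfix, fun x hx ↦ ?_⟩
  rw [hfix x hx]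
  exact (congrArg (· * f x) (hdet x hx)).trans (inv_mul_cancel₀ (hfpos x).ne')
end
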